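/- arXiv:2308.11002 — 2 statements merged into one kernel-verified Lean document; each statement's English description precedes it below -/
import Mathlib

section
/- Assume the ABC-conjecture. Let f(x) ∈ ℚ[x] be a polynomial of degree d ≥ 2 which is not a monomial and which has at least two distinct complex roots. Let b be a fixed non-zero integer and A_1,...,A_r fixed positive integers. Then the equation b·(n_1!·A_1^{n_1})···(n_r!·A_r^{n_r}) = f(x) has only finitely many solutions in positive integers n_1,...,n_r and integers x. -/
/-- The algebraic radical of an integer: the product of the distinct primes dividing it. -/
def rad (m : ℤ) : ℕ := ∏ p ∈ m.natAbs.primeFactors, p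

/-- The ABC-conjecture: for every `ε > 0` there is a constant `K(ε) > 0` such that for all
non-zero pairwise coprime integers `A, B, C` with `A + B = C` one has
`max (|A|, |B|, |C|) < K(ε) * rad (A*B*C) ^ (1+ε)`. -/
def ABCConjecture : Prop :=
  ∀ ε : ℝ, 0 < ε → ∃ K : ℝ, 0 < K ∧ ∀ A B C : ℤ, A ≠ 0 → B ≠ 0 → C ≠ 0 →
    IsCoprime A B → IsCoprime A C → IsCoprime B C → A + B = C →
    ((max (max |A| |B|) |C| : ℤ) : ℝ) < K * (rad (A * B * C) : ℝ) ^ (1 + ε)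

open Polynomial in
lemma poly_bound (P : ℤ[X]) (m : ℕ) (h : P.natDegree ≤ m) :
    ∃ C : ℝ, 0 < C ∧ ∀ Y : ℤ, Y ≠ 0 → |((P.eval Y : ℤ) : ℝ)| ≤ C * |(Y : ℝ)| ^ m := by
  refine ⟨1 + ∑ i ∈ Finset.range (m + 1), |(P.coeff i : ℝ)|, ?_, ?_⟩
  · have : 0 ≤ ∑ i ∈ Finset.range (m + 1), |(P.coeff i : ℝ)| :=
      Finset.sum_nonneg (fun i _ => abs_nonneg _)
    linarith
  · intro Y hY
    have hY1 : 1 ≤ |(Y : ℝ)| := by exact_mod_cast Int.one_le_abs hY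
    rw [eval_eq_sum_range' (Nat.lt_succ_of_le h)]
    push_cast
    refine (Finset.abs_sum_le_sum_abs _ _).trans ?_
    rw [add_mul, Finset.sum_mul]
    have h0 : 0 ≤ 1 * |(Y : ℝ)| ^ m := by positivity
    refine le_trans ?_ (le_add_of_nonneg_left h0)
    apply Finset.sum_le_sum
    intro i hi
    rw [abs_mul, abs_pow]
    have : i ≤ m := by simpa [Nat.lt_succ_iff] using hi
    gcongr

lemma rad_pos (m : ℤ) : 0 < rad m :=
  Finset.prod_pos fun p hp => (Nat.prime_of_mem_primeFactors hp).pos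

lemma rad_le_of_dvd {m n : ℤ} (h : m ∣ n) (hn : n ≠ 0) : rad m ≤ rad n := by
  unfold rad
  apply Finset.prod_le_prod_of_subset_of_one_le'
  · exact Nat.primeFactors_mono (Int.natAbs_dvd_natAbs.2 h) (by simpa using hn)
  · intro p hp _
    exact (Nat.prime_of_mem_primeFactors hp).one_le

lemma rad_le {m : ℤ} (hm : m ≠ 0) : rad m ≤ m.natAbs :=
  Nat.le_of_dvd (Int.natAbs_pos.2 hm) (Nat.prod_primeFactors_dvd _)

lemma rad_mul_le {m n : ℤ} (hm : m ≠ 0) (hn : n ≠ 0) : rad (m * n) ≤ rad m * rad n := by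
  unfold rad
  rw [Int.natAbs_mul, Nat.primeFactors_mul (by simpa using hm) (by simpa using hn),
    ← Finset.prod_union_inter]
  apply Nat.le_mul_of_pos_right
  exact Finset.prod_pos fun p hp =>
    (Nat.prime_of_mem_primeFactors (Finset.mem_inter.1 hp).1).pos

lemma rad_pow_le (m : ℤ) (k : ℕ) (hk : k ≠ 0) : rad (m ^ k) = rad m := by
  unfold rad
  rw [Int.natAbs_pow, Nat.primeFactors_pow _ hk]

open Polynomial in
lemma core_abc (habc : ABCConjecture) (a : ℤ) (ha : a ≠ 0) (S : ℤ[X]) (k : ℕ)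
    (hk : S.natDegree + 2 ≤ k) (hS : S.coeff 0 ≠ 0) :
    ∃ K : ℝ, 0 < K ∧ ∀ Y : ℤ, a * Y ^ k + S.eval Y ≠ 0 →
      |(Y : ℝ)| ≤ K * (rad (a * Y ^ k + S.eval Y) : ℝ) ^ 4 := by
  have hk0 : (0 : ℝ) < k := by
    have : 0 < k := by omega
    exact_mod_cast this
  obtain ⟨K, hK, habc⟩ := habc (1 / (2 * k)) (by positivity)
  obtain ⟨C, hC, hCb⟩ := poly_bound S (k - 2) (by omega)
  set c := S.coeff 0 with hc
  have hSne : S ≠ 0 := by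
    rintro rfl
    simp at hc
    exact hS hc
  -- bound for the roots of S
  obtain ⟨B, hB⟩ : ∃ B : ℝ, ∀ Y : ℤ, S.eval Y = 0 → |(Y : ℝ)| ≤ B := by
    refine ⟨∑ y ∈ S.roots.toFinset, |(y : ℝ)|, fun Y hY => ?_⟩
    apply Finset.single_le_sum (f := fun y : ℤ => |(y : ℝ)|) (fun i _ => abs_nonneg _)
    simp [hSne, hY]
  set e : ℝ := 1 + 1 / (2 * k) with he
  have he2 : e ≤ 2 := by
    have : 1 / (2 * (k : ℝ)) ≤ 1 := by
      rw [div_le_one (by positivity)]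
      have : (1 : ℝ) ≤ k := by
        have : 1 ≤ k := by omega
        exact_mod_cast this
      linarith
    linarith
  have he0 : 0 < e := by positivity
  set K2 : ℝ := |(a * c ^ k : ℝ)| * K * (|(a : ℝ)| * C) ^ e with hK2
  have haR : (0 : ℝ) < |(a : ℝ)| := by simpa using ha
  have hcR : (c : ℝ) ≠ 0 := by exact_mod_cast hS
  have hK2pos : 0 < K2 := by
    have : 0 < |(a * c ^ k : ℝ)| := by
      rw [abs_pos]; exact mul_ne_zero (by exact_mod_cast ha) (pow_ne_zero _ hcR)
    positivity
  refine ⟨K2 ^ 2 + |B| , by positivity, fun Y hG => ?_⟩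
  set G := a * Y ^ k + S.eval Y with hGdef
  have hr1 : (1 : ℝ) ≤ rad G := by exact_mod_cast rad_pos G
  have hr4 : (1 : ℝ) ≤ (rad G : ℝ) ^ 4 := one_le_pow₀ hr1
  by_cases hSY : S.eval Y = 0
  · have := hB Y hSY
    have h1 := le_abs_self B
    have h2 : 0 ≤ K2 ^ 2 := by positivity
    nlinarith [abs_nonneg B]
  by_cases hY : Y = 0
  · subst hY
    simp only [Int.cast_zero, abs_zero]
    positivity
  suffices h : |(Y : ℝ)| ≤ K2 ^ 2 * (rad G : ℝ) ^ 4 by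
    have : 0 ≤ |B| * (rad G : ℝ) ^ 4 := by positivity
    nlinarith
  have hP : a * Y ^ k ≠ 0 := mul_ne_zero ha (pow_ne_zero _ hY)
  obtain ⟨D, hDdef⟩ : ∃ D : ℤ, D = (Int.gcd (a * Y ^ k) (S.eval Y) : ℤ) := ⟨_, rfl⟩
  have hD1 : D ∣ a * Y ^ k := hDdef ▸ Int.gcd_dvd_left _ _
  have hD2 : D ∣ S.eval Y := hDdef ▸ Int.gcd_dvd_right _ _
  have hDc : D ∣ a * c ^ k := by
    have hYd : Y ∣ S.eval Y - c := by
      have := S.sub_dvd_eval_sub Y 0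
      rwa [sub_zero, ← coeff_zero_eq_eval_zero] at this
    obtain ⟨T, hT⟩ := hYd
    have h1 : S.eval Y ∣ c ^ k - (-(Y * T)) ^ k := by
      have h2 := sub_dvd_pow_sub_pow c (-(Y * T)) k
      have h3 : c - -(Y * T) = S.eval Y := by linarith
      rwa [h3] at h2
    have h4 : D ∣ a * (c ^ k - (-(Y * T)) ^ k) := (hD2.trans h1).mul_left a
    have h5 : D ∣ a * (-(Y * T)) ^ k := by
      have : a * (-(Y * T)) ^ k = (a * Y ^ k) * (-T) ^ k := by
        rw [← mul_neg, mul_pow]; ring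
      rw [this]
      exact hD1.mul_right _
    have := dvd_add h4 h5
    rwa [← mul_add, sub_add_cancel] at this
  obtain ⟨A, hA⟩ := hD1
  obtain ⟨B', hB'⟩ := hD2
  have hD0 : D ≠ 0 := by
    rintro rfl
    simp at hA; tauto
  have hA0 : A ≠ 0 := by rintro rfl; simp at hA; tauto
  have hB0 : B' ≠ 0 := by rintro rfl; simp at hB'; tauto
  have hGD : G = D * (A + B') := by rw [hGdef, hA, hB']; ring
  have hC0 : A + B' ≠ 0 := by intro h; rw [h, mul_zero] at hGD; exact hG hGD
  have hcop : IsCoprime A B' := by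
    rw [Int.isCoprime_iff_gcd_eq_one]
    have h1 : Int.gcd (a * Y ^ k) (S.eval Y) = D.natAbs * Int.gcd A B' := by
      rw [hA, hB', Int.gcd_mul_left]
    have h2 : D.natAbs = Int.gcd (a * Y ^ k) (S.eval Y) := by rw [hDdef]; simp
    rw [← h2] at h1
    have h3 : 0 < D.natAbs := Int.natAbs_pos.2 hD0
    nlinarith
  have hcop1 : IsCoprime A (A + B') := by
    have := (IsCoprime.add_mul_left_right_iff (x := A) (y := B') (z := 1)).2 hcop
    rwa [mul_one, add_comm] at this
  have hcop2 : IsCoprime B' (A + B') := by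
    have := (IsCoprime.add_mul_left_right_iff (x := B') (y := A) (z := 1)).2 hcop.symm
    rwa [mul_one] at this
  have key := habc A B' (A + B') hA0 hB0 hC0 hcop hcop1 hcop2 rfl
  have hAle : |(A : ℝ)| ≤ ((max (max |A| |B'|) |A + B'| : ℤ) : ℝ) := by
    exact_mod_cast (le_max_left |A| |B'|).trans (le_max_left _ _)
  have hy1 : 1 ≤ |(Y : ℝ)| := by exact_mod_cast Int.one_le_abs hY
  set y := |(Y : ℝ)| with hy
  have hrad : (rad (A * B' * (A + B')) : ℝ) ≤ (|(a : ℝ)| * C) * y ^ (k - 1) * rad G := by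
    have h1 : rad (A * B' * (A + B')) ≤ rad ((a * Y ^ k) * S.eval Y * G) := by
      apply rad_le_of_dvd
      · exact mul_dvd_mul (mul_dvd_mul ⟨D, by rw [hA]; ring⟩ ⟨D, by rw [hB']; ring⟩)
          ⟨D, by rw [hGD]; ring⟩
      · exact mul_ne_zero (mul_ne_zero hP hSY) hG
    have h2 : rad ((a * Y ^ k) * S.eval Y * G) ≤
        ((a.natAbs * Y.natAbs) * (S.eval Y).natAbs) * rad G := by
      refine (rad_mul_le (mul_ne_zero hP hSY) hG).trans (Nat.mul_le_mul_right _ ?_)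
      refine (rad_mul_le hP hSY).trans (Nat.mul_le_mul ?_ (rad_le hSY))
      refine (rad_mul_le ha (pow_ne_zero _ hY)).trans (Nat.mul_le_mul (rad_le ha) ?_)
      rw [rad_pow_le _ _ (by omega)]
      exact rad_le hY
    have h3 : (rad (A * B' * (A + B')) : ℝ) ≤
        ((|(a : ℝ)| * |(Y : ℝ)|) * |((S.eval Y : ℤ) : ℝ)|) * rad G := by
      have := h1.trans h2
      have h4 : ((rad (A * B' * (A + B')) : ℕ) : ℝ) ≤
        (((a.natAbs * Y.natAbs) * (S.eval Y).natAbs * rad G : ℕ) : ℝ) := by exact_mod_cast this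
      simpa [Nat.cast_natAbs] using h4
    refine h3.trans ?_
    have h5 : y ^ (k - 1) = y * y ^ (k - 2) := by
      rw [← pow_succ']; congr 1; omega
    rw [h5]
    have h6 := hCb Y hY
    calc _ ≤ ((|(a : ℝ)| * y) * (C * y ^ (k - 2))) * rad G := by gcongr
      _ = _ := by ring
  have hDabs : |(D : ℝ)| ≤ |(a * c ^ k : ℝ)| := by
    have h1 : a * c ^ k ≠ 0 := mul_ne_zero ha (pow_ne_zero _ hS)
    have := Int.le_of_dvd (abs_pos.2 h1) ((abs_dvd_abs _ _).2 hDc)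
    exact_mod_cast this
  have hmain : y ^ k ≤ K2 * (y ^ ((k : ℝ) - 1 / 2) * (rad G : ℝ) ^ 2) := by
    have h1 : y ^ k ≤ |(D : ℝ)| * |(A : ℝ)| := by
      have h2 : |(a : ℝ)| * y ^ k = |(D : ℝ)| * |(A : ℝ)| := by
        rw [hy, ← abs_pow, ← abs_mul, ← abs_mul]
        exact_mod_cast congrArg abs hA
      have h3 : (1 : ℝ) ≤ |(a : ℝ)| := by exact_mod_cast Int.one_le_abs ha
      rw [← h2]
      have : 0 ≤ y ^ k := by positivity
      nlinarith
    have h4 : (rad (A * B' * (A + B')) : ℝ) ^ e ≤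
        (|(a : ℝ)| * C) ^ e * (y ^ ((k : ℝ) - 1 / 2) * (rad G : ℝ) ^ 2) := by
      calc _ ≤ ((|(a : ℝ)| * C) * y ^ (k - 1) * rad G) ^ e :=
            Real.rpow_le_rpow (by positivity) hrad he0.le
        _ = (|(a : ℝ)| * C) ^ e * ((y ^ (k - 1)) ^ e * (rad G : ℝ) ^ e) := by
            rw [Real.mul_rpow (by positivity) (by positivity),
              Real.mul_rpow (by positivity) (by positivity), mul_assoc]
        _ ≤ _ := by
          have h5 : (y ^ (k - 1)) ^ e ≤ y ^ ((k : ℝ) - 1 / 2) := by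
            rw [← Real.rpow_natCast, ← Real.rpow_mul (by positivity)]
            apply Real.rpow_le_rpow_of_exponent_le hy1
            rw [Nat.cast_sub (by omega), he]
            have : ((k : ℝ) - ((1 : ℕ) : ℝ)) * (1 + 1 / (2 * k)) = k - 1 / 2 - 1 / (2 * k) := by
              push_cast
              field_simp
              ring
            rw [this]
            have : 0 < 1 / (2 * (k : ℝ)) := by positivity
            linarith
          have h6 : (rad G : ℝ) ^ e ≤ (rad G : ℝ) ^ 2 := by
            rw [← Real.rpow_natCast]
            apply Real.rpow_le_rpow_of_exponent_le hr1
            simpa using he2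
          gcongr
    calc y ^ k ≤ |(D : ℝ)| * |(A : ℝ)| := h1
      _ ≤ |(a * c ^ k : ℝ)| * (K * (rad (A * B' * (A + B')) : ℝ) ^ e) := by
          gcongr
          exact hAle.trans key.le
      _ ≤ |(a * c ^ k : ℝ)| * (K * ((|(a : ℝ)| * C) ^ e *
            (y ^ ((k : ℝ) - 1 / 2) * (rad G : ℝ) ^ 2))) := by gcongr
      _ = _ := by rw [hK2]; ring
  have hy0 : 0 < y := by linarith
  have hsplit : y ^ k = y ^ ((k : ℝ) - 1 / 2) * Real.sqrt y := by
    rw [Real.sqrt_eq_rpow, ← Real.rpow_add hy0, ← Real.rpow_natCast]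
    congr 1; ring
  have hpp : 0 < y ^ ((k : ℝ) - 1 / 2) := Real.rpow_pos_of_pos hy0 _
  have hsq : Real.sqrt y ≤ K2 * (rad G : ℝ) ^ 2 := by
    rw [hsplit] at hmain
    by_contra hcon
    push Not at hcon
    have := mul_lt_mul_of_pos_left hcon hpp
    nlinarith
  calc y = Real.sqrt y ^ 2 := (Real.sq_sqrt hy0.le).symm
    _ ≤ (K2 * (rad G : ℝ) ^ 2) ^ 2 := by gcongr
    _ = _ := by ring

open Polynomial in
lemma shift_poly (f : ℚ[X]) (hdeg : 2 ≤ f.natDegree)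
    (hroots : ∃ z w : ℂ, z ≠ w ∧ aeval z f = 0 ∧ aeval w f = 0) :
    ∃ (u v E a : ℤ) (R : ℤ[X]), E ≠ 0 ∧ a ≠ 0 ∧ R ≠ 0 ∧ R.natDegree + 2 ≤ f.natDegree ∧
      ∀ x : ℤ, ((a * (v * x - u) ^ f.natDegree + R.eval (v * x - u) : ℤ) : ℚ) =
        E * f.eval (x : ℚ) := by
  set d := f.natDegree with hd
  set l := f.leadingCoeff with hl
  have hf0 : f ≠ 0 := by rintro rfl; simp at hd; omega
  have hl0 : l ≠ 0 := leadingCoeff_ne_zero.2 hf0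
  have hd0 : (d : ℚ) ≠ 0 := by
    have : d ≠ 0 := by omega
    exact_mod_cast this
  set t : ℚ := - f.coeff (d - 1) / (d * l) with ht
  set R : ℚ[X] := f - C l * (X + C (-t)) ^ d with hR
  have hR0 : R ≠ 0 := by
    intro h
    have hf : f = C l * (X + C (-t)) ^ d := sub_eq_zero.1 h
    obtain ⟨z, w, hzw, hz, hw⟩ := hroots
    have aux : ∀ z : ℂ, aeval z f = 0 → z = (t : ℂ) := by
      intro z hz
      rw [hf] at hz
      simp [hl0] at hz
      exact add_neg_eq_zero.1 hz.1
    exact hzw ((aux z hz).trans (aux w hw).symm)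
  have hRdeg : R.natDegree + 2 ≤ d := by
    suffices h : R.natDegree ≤ d - 2 by omega
    rw [natDegree_le_iff_coeff_eq_zero]
    intro N hN
    rw [hR, coeff_sub, coeff_C_mul, coeff_X_add_C_pow]
    rcases (by omega : N = d - 1 ∨ N = d ∨ d < N) with h | h | h
    · subst h
      have h1 : d - (d - 1) = 1 := by omega
      have h2 : d.choose (d - 1) = d := by
        rw [Nat.choose_symm (by omega)]; simp
      rw [h1, h2, ht]
      field_simp
      ring
    · subst h
      rw [hl, leadingCoeff, ← hd]
      simp
    · rw [coeff_eq_zero_of_natDegree_lt h, Nat.choose_eq_zero_of_lt h]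
      simp
  set v : ℤ := (t.den : ℤ) with hv
  set u : ℤ := t.num with hu
  have hv0 : (v : ℚ) ≠ 0 := by simp [hv]
  have htuv : t = u / v := by rw [hv, hu]; exact_mod_cast (Rat.num_div_den t).symm
  set q : ℚ[X] := C (v : ℚ)⁻¹ * X + C t with hq
  have hqd : q.natDegree = 1 := natDegree_linear (inv_ne_zero hv0)
  set R2 := R.comp q with hR2
  have hR2d : R2.natDegree = R.natDegree := by rw [hR2, natDegree_comp, hqd, mul_one]
  have hR20 : R2 ≠ 0 := by
    intro h
    rw [hR2, comp_eq_zero_iff] at h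
    rcases h with h | ⟨_, h⟩
    · exact hR0 h
    · rw [h, natDegree_C] at hqd; omega
  obtain ⟨⟨E1, hE1'⟩, hmap⟩ :=
    IsLocalization.integerNormalization_map_to_map (nonZeroDivisors ℤ) R2
  have hE1 : E1 ≠ 0 := nonZeroDivisors.ne_zero hE1'
  simp only at hmap
  set R3 : ℤ[X] := IsLocalization.integerNormalization (nonZeroDivisors ℤ) R2 with hR3
  have hE1Q : (E1 : ℚ) ≠ 0 := by exact_mod_cast hE1
  have hmap' : R3.map (Int.castRingHom ℚ) = C (E1 : ℚ) * R2 := by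
    have h1 : algebraMap ℤ ℚ = Int.castRingHom ℚ := rfl
    rw [h1] at hmap
    rw [hmap]
    ext n
    simp
  have hinj : Function.Injective (Int.castRingHom ℚ) := Int.cast_injective
  have hR3d : R3.natDegree = R.natDegree := by
    rw [← natDegree_map_eq_of_injective hinj, hmap', natDegree_C_mul hE1Q, hR2d]
  have hR30 : R3 ≠ 0 := by
    rintro h
    rw [h, Polynomial.map_zero] at hmap'
    exact mul_ne_zero (C_ne_zero.2 hE1Q) hR20 hmap'.symm
  set a3 : ℚ := l / (v : ℚ) ^ d with ha3
  have ha30 : a3 ≠ 0 := div_ne_zero hl0 (pow_ne_zero _ hv0)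
  have hden : (a3.den : ℤ) ≠ 0 := by exact_mod_cast a3.den_nz
  refine ⟨u, v, a3.den * E1, a3.num * E1, C (a3.den : ℤ) * R3, mul_ne_zero hden hE1,
    mul_ne_zero (Rat.num_ne_zero.2 ha30) hE1, mul_ne_zero (C_ne_zero.2 hden) hR30, ?_, ?_⟩
  · rw [natDegree_C_mul hden, hR3d]; exact hRdeg
  · intro x
    have he : ((R3.eval (v * x - u) : ℤ) : ℚ) = E1 * R.eval (x : ℚ) := by
      have h1 : ((R3.eval (v * x - u) : ℤ) : ℚ) =
          (R3.map (Int.castRingHom ℚ)).eval (((v * x - u : ℤ)) : ℚ) := by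
        rw [← eq_intCast (Int.castRingHom ℚ) (v * x - u), eval_map_apply]
        rfl
      rw [h1, hmap', eval_mul, eval_C, hR2, eval_comp]
      congr 2
      rw [hq, htuv]
      simp
      field_simp
      ring
    have hfx : f.eval (x : ℚ) = l * (x - t) ^ d + R.eval (x : ℚ) := by
      rw [hR]; simp; ring
    have hnum : (a3.num : ℚ) = a3 * a3.den := (Rat.mul_den_eq_num a3).symm
    have hxt : (x : ℚ) - t = (v * x - u) / v := by
      rw [htuv]; field_simp
    rw [hfx, eval_mul, eval_C]
    push_cast
    rw [he, hnum, hxt, div_pow, ha3]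
    ring

lemma rad_le_of_primes {m n : ℤ} (hn : n ≠ 0)
    (h : ∀ p : ℕ, p.Prime → (p : ℤ) ∣ m → (p : ℤ) ∣ n) : rad m ≤ rad n := by
  unfold rad
  apply Finset.prod_le_prod_of_subset_of_one_le'
  · intro p hp
    rw [Nat.mem_primeFactors] at hp ⊢
    exact ⟨hp.1, Int.natCast_dvd.1 (h p hp.1 (Int.natCast_dvd.2 hp.2.1)), by simpa using hn⟩
  · intro p hp _
    exact (Nat.prime_of_mem_primeFactors hp).one_le

lemma rad_factorial_le (N : ℕ) : rad (N.factorial : ℤ) ≤ 4 ^ N := by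
  refine le_trans ?_ (primorial_le_four_pow N)
  unfold rad primorial
  apply Finset.prod_le_prod_of_subset_of_one_le'
  · intro p hp
    rw [Int.natAbs_natCast, Nat.mem_primeFactors] at hp
    simp only [Finset.mem_filter, Finset.mem_range]
    exact ⟨Nat.lt_succ_of_le ((hp.1.dvd_factorial).1 hp.2.1), hp.1⟩
  · intro p hp _
    exact (Finset.mem_filter.1 hp).2.one_le

lemma factorial_bound (C Q : ℝ) : ∃ M : ℕ, ∀ N : ℕ, (N.factorial : ℝ) ≤ C * Q ^ N → N ≤ M := by
  have h := (FloorSemiring.tendsto_pow_div_factorial_atTop Q).const_mul C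
  rw [mul_zero] at h
  have h2 := h.eventually (gt_mem_nhds (zero_lt_one))
  obtain ⟨M, hM⟩ := Filter.eventually_atTop.1 h2
  refine ⟨M, fun N hN => ?_⟩
  by_contra hcon
  have h3 := hM N (by omega)
  have h4 : (0 : ℝ) < N.factorial := by exact_mod_cast N.factorial_pos
  rw [← mul_div_assoc, div_lt_one h4] at h3
  linarith

open Polynomial in
/-- Assuming the ABC-conjecture, for a polynomial `f ∈ ℚ[x]` of degree `d ≥ 2`
which is not a monomial and has at least two distinct complex roots, a fixed non-zero integer
`b` and fixed positive integers `A 0, ..., A (r-1)`, the equation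
`b * (n₁! A₁^{n₁}) ⋯ (n_r! A_r^{n_r}) = f(x)` has only finitely many solutions in positive
integers `n₁, ..., n_r` and integers `x`. -/
theorem stmt_2 (habc : ABCConjecture) (f : Polynomial ℚ) (hdeg : 2 ≤ f.natDegree)
    (hmono : ¬∃ (k : ℕ) (a : ℚ), f = Polynomial.monomial k a)
    (hroots : ∃ z w : ℂ, z ≠ w ∧ Polynomial.aeval z f = 0 ∧ Polynomial.aeval w f = 0)
    (r : ℕ) (b : ℤ) (hb : b ≠ 0) (A : Fin r → ℕ) (hA : ∀ i, 0 < A i) :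
    {p : (Fin r → ℕ) × ℤ | (∀ i, 0 < p.1 i) ∧
      ((b * ∏ i, (((p.1 i).factorial : ℤ) * (A i : ℤ) ^ (p.1 i)) : ℤ) : ℚ) =
        f.eval (p.2 : ℚ)}.Finite := by
  obtain ⟨u, v, E, a, R, hE, ha, hR, hRd, hH⟩ := shift_poly f hdeg hroots
  set d := f.natDegree with hd
  obtain ⟨S, hRS, hS⟩ := exists_eq_pow_rootMultiplicity_mul_and_not_dvd R hR 0
  set m := rootMultiplicity 0 R with hm
  rw [C_0, sub_zero] at hRS hS
  have hS0 : S.coeff 0 ≠ 0 := fun h => hS (X_dvd_iff.2 h)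
  have hSne : S ≠ 0 := by rintro rfl; simp at hS
  have hdegS : R.natDegree = m + S.natDegree := by
    rw [hRS, natDegree_mul (pow_ne_zero _ X_ne_zero) hSne, natDegree_X_pow]
  obtain ⟨K, hK, hcore⟩ := core_abc habc a ha S (d - m) (by omega) hS0
  have hfact : ∀ Y : ℤ, a * Y ^ d + R.eval Y = Y ^ m * (a * Y ^ (d - m) + S.eval Y) := by
    intro Y
    have : Y ^ d = Y ^ m * Y ^ (d - m) := by rw [← pow_add]; congr 1; omega
    rw [hRS, this]; simp; ring
  obtain ⟨C0, hC0, hbd⟩ := poly_bound (C a * X ^ d + R) d (by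
    refine natDegree_add_le_of_degree_le (natDegree_C_mul_X_pow_le a d) (by omega))
  set c : ℤ := E * b * ∏ i, (A i : ℤ) with hc
  have hA' : ∀ i, (A i : ℤ) ≠ 0 := fun i => by exact_mod_cast (hA i).ne'
  have hc0 : c ≠ 0 := mul_ne_zero (mul_ne_zero hE hb) (Finset.prod_ne_zero_iff.2 fun i _ => hA' i)
  obtain ⟨M, hM⟩ := factorial_bound
    (C0 * K ^ d * (rad c : ℝ) ^ (4 * d) + |((R.eval 0 : ℤ) : ℝ)|) (4 ^ (4 * d))
  have hbound : ∀ (n : Fin r → ℕ) (x : ℤ),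
      ((b * ∏ i, (((n i).factorial : ℤ) * (A i : ℤ) ^ (n i)) : ℤ) : ℚ) = f.eval (x : ℚ) →
      Finset.univ.sup n ≤ M := by
    intro n x hx
    set N := Finset.univ.sup n with hN
    set L : ℤ := b * ∏ i, (((n i).factorial : ℤ) * (A i : ℤ) ^ (n i)) with hL
    have hL0 : L ≠ 0 := mul_ne_zero hb (Finset.prod_ne_zero_iff.2 fun i _ =>
      mul_ne_zero (by exact_mod_cast (n i).factorial_ne_zero) (pow_ne_zero _ (hA' i)))
    have hEL0 : E * L ≠ 0 := mul_ne_zero hE hL0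
    set Y := v * x - u with hY
    have hEL : a * Y ^ d + R.eval Y = E * L := by
      have := hH x
      rw [← hx] at this
      exact_mod_cast this
    have hNL : (N.factorial : ℤ) ∣ E * L := by
      apply Dvd.dvd.mul_left
      rw [hL]
      apply Dvd.dvd.mul_left
      rcases (Finset.univ : Finset (Fin r)).eq_empty_or_nonempty with h | h
      · have : N = 0 := by rw [hN, h]; simp
        rw [this]; simp
      · obtain ⟨i, hi, hi2⟩ := Finset.exists_mem_eq_sup _ h n
        rw [hN, hi2]
        exact (Dvd.intro _ rfl).trans (Finset.dvd_prod_of_mem _ hi)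
    have hNle : (N.factorial : ℝ) ≤ |((E * L : ℤ) : ℝ)| := by
      have := Int.le_of_dvd (abs_pos.2 hEL0) ((dvd_abs _ _).2 hNL)
      exact_mod_cast this
    have hradEL : rad (E * L) ≤ rad c * 4 ^ N := by
      have hNf : (N.factorial : ℤ) ≠ 0 := by exact_mod_cast N.factorial_ne_zero
      refine le_trans (rad_le_of_primes (n := c * N.factorial) (mul_ne_zero hc0 hNf) ?_)
        ((rad_mul_le hc0 hNf).trans (Nat.mul_le_mul_left _ (rad_factorial_le N)))
      intro p hp hpd
      have hpp : Prime (p : ℤ) := Nat.prime_iff_prime_int.1 hp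
      rcases hpp.dvd_or_dvd hpd with h | h
      · exact (((h.mul_right b).mul_right _)).mul_right _
      rcases hpp.dvd_or_dvd h with h | h
      · exact (((h.mul_left E).mul_right _)).mul_right _
      obtain ⟨i, hi, h⟩ := (Prime.dvd_finset_prod_iff hpp _).1 h
      rcases hpp.dvd_or_dvd h with h | h
      · apply Dvd.dvd.mul_left
        exact h.trans (by exact_mod_cast Nat.factorial_dvd_factorial (Finset.le_sup hi))
      · apply Dvd.dvd.mul_right
        apply Dvd.dvd.mul_left
        exact (hpp.dvd_of_dvd_pow h).trans (Finset.dvd_prod_of_mem _ hi)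
    apply hM
    have hQ1 : (1 : ℝ) ≤ ((4 : ℝ) ^ (4 * d)) ^ N := one_le_pow₀ (one_le_pow₀ (by norm_num))
    by_cases hY0 : Y = 0
    · have h1 : E * L = R.eval 0 := by
        rw [← hEL, hY0, zero_pow (by omega)]; ring
      rw [h1] at hNle
      refine hNle.trans ?_
      have h2 : 0 ≤ C0 * K ^ d * (rad c : ℝ) ^ (4 * d) := by positivity
      have h3 := abs_nonneg ((R.eval 0 : ℤ) : ℝ)
      nlinarith
    · have h1 := hbd Y hY0
      have h2 : (C a * X ^ d + R).eval Y = E * L := by rw [← hEL]; simp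
      rw [h2] at h1
      have hG : a * Y ^ (d - m) + S.eval Y ∣ E * L := by
        rw [← hEL, hfact]; exact Dvd.intro_left _ rfl
      have hG0 : a * Y ^ (d - m) + S.eval Y ≠ 0 := fun h => hEL0 (by
        rw [h] at hG; exact zero_dvd_iff.1 hG)
      have h3 := hcore Y hG0
      have h4 : (rad (a * Y ^ (d - m) + S.eval Y) : ℝ) ≤ rad c * 4 ^ N := by
        exact_mod_cast (rad_le_of_dvd hG hEL0).trans hradEL
      have h5 : |(Y : ℝ)| ≤ K * (rad c * 4 ^ N) ^ 4 := h3.trans (by gcongr)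
      calc (N.factorial : ℝ) ≤ C0 * |(Y : ℝ)| ^ d := hNle.trans h1
        _ ≤ C0 * (K * (rad c * 4 ^ N) ^ 4) ^ d := by gcongr
        _ = C0 * K ^ d * (rad c : ℝ) ^ (4 * d) * (4 ^ (4 * d)) ^ N := by
            rw [mul_pow, ← pow_mul, mul_pow, ← pow_mul, ← pow_mul, mul_comm N (4 * d)]; ring
        _ ≤ _ := by
            gcongr
            exact le_add_of_nonneg_right (abs_nonneg _)
  have hfin : (⋃ n ∈ (Set.Iic (fun _ : Fin r => M)),
      (Prod.mk n) '' {x : ℤ | f.eval (x : ℚ) =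
        ((b * ∏ i, (((n i).factorial : ℤ) * (A i : ℤ) ^ (n i)) : ℤ) : ℚ)}).Finite := by
    refine (Set.finite_Iic _).biUnion fun n _ => Set.Finite.image _ ?_
    set q : ℚ := ((b * ∏ i, (((n i).factorial : ℤ) * (A i : ℤ) ^ (n i)) : ℤ) : ℚ)
    have hne : f - C q ≠ 0 := by
      intro h
      have h1 : f = C q := sub_eq_zero.1 h
      have : d = 0 := by rw [hd, h1, natDegree_C]
      omega
    have hf := ((f - C q).roots.toFinset.finite_toSet).preimage
      (f := fun x : ℤ => (x : ℚ)) Int.cast_injective.injOn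
    refine hf.subset fun x hx => ?_
    have hx' : f.eval (x : ℚ) = q := hx
    simp [hne, hx', -eq_intCast, sub_eq_zero]
  refine hfin.subset ?_
  rintro ⟨n, x⟩ ⟨_, hx⟩
  simp only [Set.mem_iUnion]
  refine ⟨n, fun i => (Finset.le_sup (Finset.mem_univ i)).trans (hbound n x hx), x, hx.symm, rfl⟩
end

section
/- Let f(x,y) = a_d·x^d + a_{d-1}·x^{d-1}·y + ··· + a_1·x·y^{d-1} + a_0·y^d ∈ ℤ[x,y] be an irreducible homogeneous polynomial of degree d. Let b be a fixed non-zero integer and A_1,...,A_r fixed positive integers. If d > r, then there are only finitely many tuples (n_1,...,n_r) of positive integers such that b·(n_1!·A_1^{n_1})···(n_r!·A_r^{n_r}) = f(x,y) for some integers x, y. -/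
section part1
open Complex Filter Topology MeasureTheory Set

namespace Fact4

theorem zeta_cont (a : ℕ → ℝ) (ha : ∀ n, 0 ≤ a n) (κ C δ : ℝ) (hδ : 0 < δ) (hδ1 : δ < 1)
    (hS : ∀ x : ℝ, 1 ≤ x → |∑ k ∈ Finset.Icc 1 ⌊x⌋₊, a k - κ * x| ≤ C * x ^ (1 - δ)) :
    ∃ H : ℂ → ℂ, DifferentiableOn ℂ H {s | 1 - δ < s.re} ∧ H 1 = κ ∧
      (∀ s : ℂ, 1 < s.re → LSeriesSummable (fun n => (a n : ℂ)) s) ∧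
      ∀ s : ℂ, 1 < s.re → LSeries (fun n => (a n : ℂ)) s * (s - 1) = H s := by
  have hC : 0 ≤ C := by
    have := (abs_nonneg _).trans (hS 1 le_rfl)
    simpa using this
  have hbig : (fun n : ℕ => ∑ k ∈ Finset.Icc 1 n, a k) =O[atTop] fun n : ℕ => (n : ℝ) ^ (1 : ℝ) := by
    refine Asymptotics.IsBigO.of_bound (C + |κ|) ?_
    filter_upwards [eventually_ge_atTop 1] with n hn
    have hn1 : (1 : ℝ) ≤ n := by exact_mod_cast hn
    have h := hS n hn1
    rw [Nat.floor_natCast] at h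
    have h2 : (n : ℝ) ^ (1 - δ) ≤ n := by
      conv_rhs => rw [← Real.rpow_one (n : ℝ)]
      exact Real.rpow_le_rpow_of_exponent_le hn1 (by linarith)
    rw [Real.rpow_one, Real.norm_eq_abs, Real.norm_eq_abs, abs_of_nonneg (by linarith : (0:ℝ) ≤ n)]
    have h3 : |∑ k ∈ Finset.Icc 1 n, a k| ≤ |∑ k ∈ Finset.Icc 1 n, a k - κ * n| + |κ * n| := by
      simpa using abs_add_le (∑ k ∈ Finset.Icc 1 n, a k - κ * n) (κ * n)
    rw [abs_mul, abs_of_nonneg (by linarith : (0:ℝ) ≤ n)] at h3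
    nlinarith [mul_le_mul_of_nonneg_left h2 hC]
  set E : ℝ → ℂ := indicator (Ioi 1) (fun t => ((∑ k ∈ Finset.Icc 1 ⌊t⌋₊, a k - κ * t : ℝ) : ℂ))
    with hE
  have hEm : Measurable E := by
    refine Measurable.indicator ?_ measurableSet_Ioi
    refine measurable_ofReal.comp ?_
    refine Measurable.sub ?_ (by fun_prop)
    exact (measurable_from_nat (f := fun n => ∑ k ∈ Finset.Icc 1 n, a k)).comp Nat.measurable_floor
  have hEb : ∀ t : ℝ, 0 < t → ‖E t‖ ≤ C * t ^ (1 - δ) := by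
    intro t ht
    rw [hE]
    by_cases h : t ∈ Ioi (1:ℝ)
    · rw [indicator_of_mem h, norm_real, Real.norm_eq_abs]
      exact hS t (le_of_lt h)
    · rw [indicator_of_notMem h, norm_zero]; positivity
  have hEloc : LocallyIntegrableOn E (Ioi 0) := by
    have h1 : LocallyIntegrableOn (fun t : ℝ => C * t ^ (1 - δ)) (Ioi 0) := by
      refine ContinuousOn.locallyIntegrableOn ?_ measurableSet_Ioi
      refine continuousOn_const.mul ?_
      exact continuousOn_id.rpow_const (fun x hx => Or.inl (ne_of_gt hx))
    intro x hx
    obtain ⟨U, hU, hi⟩ := h1 x hx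
    refine ⟨U ∩ Ioi 0, inter_mem hU self_mem_nhdsWithin, ?_⟩
    refine Integrable.mono (hi.mono_set inter_subset_left) hEm.aestronglyMeasurable ?_
    have hU0 : ∀ᵐ t ∂(volume.restrict (U ∩ Ioi 0)), t ∈ Ioi (0:ℝ) := by
      exact (ae_restrict_mem (μ := (volume : Measure ℝ)) measurableSet_Ioi).filter_mono
        (ae_mono (Measure.restrict_mono inter_subset_right le_rfl))
    filter_upwards [hU0] with t ht
    exact (hEb t ht).trans (le_abs_self _)
  have hM : ∀ s : ℂ, 1 - δ < s.re → DifferentiableAt ℂ (mellin E) (-s) := by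
    intro s hs
    refine mellin_differentiableAt_of_isBigO_rpow (a := -(1 - δ)) (b := -s.re - 1) hEloc ?_ ?_ ?_ ?_
    · refine Asymptotics.IsBigO.of_bound C ?_
      filter_upwards [eventually_gt_atTop 0] with t ht
      rw [neg_neg, Real.norm_of_nonneg (by positivity)]
      exact hEb t ht
    · simp only [neg_re]; linarith
    · refine (Asymptotics.isBigO_zero _ _).congr' ?_ EventuallyEq.rfl
      have : Ioo (0:ℝ) 1 ∈ 𝓝[>] (0:ℝ) := Ioo_mem_nhdsGT one_pos
      filter_upwards [this] with t ht
      rw [hE, indicator_of_notMem]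
      simp only [mem_Ioi, not_lt]; exact ht.2.le
    · simp only [neg_re]; linarith
  refine ⟨fun s => κ * s + s * (s - 1) * mellin E (-s), ?_, by simp, ?_, ?_⟩
  · intro s hs
    have h1 : DifferentiableAt ℂ (fun s : ℂ => mellin E (-s)) s :=
      (hM s hs).comp s (by fun_prop)
    exact ((by fun_prop : DifferentiableAt ℂ (fun s : ℂ => κ * s) s).add
      ((by fun_prop : DifferentiableAt ℂ (fun s : ℂ => s * (s - 1)) s).mul h1)).differentiableWithinAt
  · intro s hs
    refine LSeriesSummable_of_sum_norm_bigO (r := 1) ?_ zero_le_one hs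
    simpa [abs_of_nonneg (ha _)] using hbig
  · intro s hs
    rw [LSeries_eq_mul_integral_of_nonneg a zero_le_one hs hbig ha]
    have hs1 : s - 1 ≠ 0 := by
      intro h
      rw [sub_eq_zero] at h; rw [h] at hs; simp at hs
    have hint1 : IntegrableOn (fun t : ℝ => (κ : ℂ) * (t : ℂ) ^ (-s)) (Ioi 1) := by
      exact (integrableOn_Ioi_cpow_of_lt (by simpa using by linarith) one_pos).const_mul _
    have hint2 : IntegrableOn (fun t : ℝ => (t : ℂ) ^ (-s - 1) * E t) (Ioi 1) := by
      have : MellinConvergent E (-s) := by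
        refine mellinConvergent_of_isBigO_rpow (a := -(1 - δ)) (b := -s.re - 1) hEloc ?_ ?_ ?_ ?_
        · refine Asymptotics.IsBigO.of_bound C ?_
          filter_upwards [eventually_gt_atTop 0] with t ht
          rw [neg_neg, Real.norm_of_nonneg (by positivity)]
          exact hEb t ht
        · simp only [neg_re]; linarith
        · refine (Asymptotics.isBigO_zero _ _).congr' ?_ EventuallyEq.rfl
          have : Ioo (0:ℝ) 1 ∈ 𝓝[>] (0:ℝ) := Ioo_mem_nhdsGT one_pos
          filter_upwards [this] with t ht
          rw [hE, indicator_of_notMem]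
          simp only [mem_Ioi, not_lt]; exact ht.2.le
        · simp only [neg_re]; linarith
      have h2 := IntegrableOn.mono_set this (Ioi_subset_Ioi (zero_le_one))
      simpa [smul_eq_mul] using h2
    have hmel : mellin E (-s) = ∫ t in Ioi (1:ℝ), (t : ℂ) ^ (-s - 1) * E t := by
      rw [mellin]
      simp only [smul_eq_mul]
      refine setIntegral_eq_of_subset_of_forall_sdiff_eq_zero measurableSet_Ioi
        (Ioi_subset_Ioi zero_le_one) ?_
      intro x hx
      rw [hE, indicator_of_notMem hx.2, mul_zero]
    have key : ∫ (t : ℝ) in Ioi 1, (∑ k ∈ Finset.Icc 1 ⌊t⌋₊, (a k : ℂ)) * (t : ℂ) ^ (-(s + 1)) =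
        (∫ t : ℝ in Ioi 1, (κ : ℂ) * (t : ℂ) ^ (-s)) + ∫ t in Ioi (1:ℝ), (t : ℂ) ^ (-s - 1) * E t := by
      rw [← integral_add hint1 hint2]
      refine setIntegral_congr_fun measurableSet_Ioi ?_
      intro t ht
      have ht0 : (t : ℂ) ≠ 0 := by
        have : (0:ℝ) < t := lt_trans one_pos ht
        exact_mod_cast this.ne'
      simp only [hE]
      rw [indicator_of_mem ht]
      have : (t : ℂ) ^ (-s) = (t : ℂ) ^ (-s - 1) * t := by
        rw [cpow_sub _ _ ht0, cpow_one]; field_simp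
      rw [this]
      push_cast
      rw [show -(s + 1) = -s - 1 by ring]
      ring
    rw [key, ← hmel, MeasureTheory.integral_const_mul,
      integral_Ioi_cpow_of_lt (by simpa using by linarith) one_pos]
    simp only [ofReal_one, one_cpow]
    have : -s + 1 ≠ 0 := by
      intro h; apply hs1; linear_combination -h
    field_simp
    ring

end Fact4
end part1

section part2
open Complex Filter Topology MeasureTheory Set

namespace Fact4

theorem isPreconnected_re_gt : IsPreconnected {s : ℂ | 1 < s.re} :=
  (convex_halfSpace_re_gt 1).isPreconnected

theorem isOpen_re_gt (r : ℝ) : IsOpen {s : ℂ | r < s.re} :=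
  isOpen_lt continuous_const continuous_re

/-- The combination `3 + 4 cos + cos` inequality for Dirichlet series with nonnegative
coefficients. -/
theorem three_four_one (b : ℕ → ℝ) (hb : ∀ n, 0 ≤ b n)
    (hsum : ∀ s : ℂ, 1 < s.re → LSeriesSummable (fun n => (b n : ℂ)) s) (σ t : ℝ) (hσ : 1 < σ) :
    0 ≤ (3 * LSeries (fun n => (b n : ℂ)) σ + 4 * LSeries (fun n => (b n : ℂ)) (σ + t * I)
      + LSeries (fun n => (b n : ℂ)) (σ + 2 * t * I)).re := by
  have h0 := (hsum σ (by simpa using hσ)).hasSum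
  have h1 := (hsum (σ + t * I) (by simpa using hσ)).hasSum
  have h2 := (hsum (σ + 2 * t * I) (by simpa using hσ)).hasSum
  have h := ((h0.mul_left 3).add (h1.mul_left 4)).add h2
  have h' := Complex.hasSum_re h
  refine h'.nonneg ?_
  intro n
  simp only [LSeries.term_def]
  by_cases hn : n = 0
  · simp [hn]
  simp only [hn, if_false]
  have hn0 : (n : ℂ) ≠ 0 := by exact_mod_cast hn
  have hnpos : (0 : ℝ) < n := by positivity
  set z : ℂ := (n : ℂ) ^ (-(t * I)) with hz
  have hznorm : ‖z‖ = 1 := by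
    rw [hz, norm_natCast_cpow_of_pos (Nat.pos_of_ne_zero hn)]
    simp
  have e1 : (b n : ℂ) / (n : ℂ) ^ ((σ : ℂ) + t * I) = ((b n / (n : ℝ) ^ σ : ℝ) : ℂ) * z := by
    rw [cpow_add _ _ hn0, hz, cpow_neg]
    push_cast
    rw [ofReal_cpow hnpos.le]
    push_cast
    field_simp
  have e2 : (b n : ℂ) / (n : ℂ) ^ ((σ : ℂ) + 2 * t * I) = ((b n / (n : ℝ) ^ σ : ℝ) : ℂ) * z ^ 2 := by
    rw [cpow_add _ _ hn0, hz, ← cpow_nat_mul]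
    rw [show ((2:ℕ) : ℂ) * -(t * I) = -(2 * t * I) by push_cast; ring, cpow_neg]
    push_cast
    rw [ofReal_cpow hnpos.le]
    push_cast
    field_simp
  have e0 : (b n : ℂ) / (n : ℂ) ^ (σ : ℂ) = ((b n / (n : ℝ) ^ σ : ℝ) : ℂ) := by
    push_cast
    rw [ofReal_cpow hnpos.le]
    push_cast; rfl
  rw [e0, e1, e2]
  have hq : 0 ≤ b n / (n : ℝ) ^ σ := div_nonneg (hb n) (by positivity)
  set q := b n / (n : ℝ) ^ σ
  have hz2 : z.re ^ 2 + z.im ^ 2 = 1 := by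
    have := Complex.sq_norm z
    rw [hznorm, normSq_apply] at this
    nlinarith
  have : (3 * (q : ℂ) + 4 * ((q : ℂ) * z) + (q : ℂ) * z ^ 2).re = q * (2 * (1 + z.re) ^ 2) := by
    simp [pow_two]
    nlinarith
  rw [this]
  positivity

theorem nonvanish (Z H B : ℂ → ℂ) (c : ℂ) (hc : c ≠ 0) (δ : ℝ) (hδ : 0 < δ)
    (hH : DifferentiableOn ℂ H {s | 1 - δ < s.re})
    (hZH : ∀ s : ℂ, 1 < s.re → Z s * (s - 1) = H s)
    (hZB : ∀ s : ℂ, 1 < s.re → Z s = c * exp (B s))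
    (h341 : ∀ σ t : ℝ, 1 < σ → 0 ≤ (3 * B σ + 4 * B (σ + t * I) + B (σ + 2 * t * I)).re)
    (t : ℝ) (ht : t ≠ 0) : H (1 + t * I) ≠ 0 := by
  intro h0
  have hmem : ∀ u : ℝ, (1 + u * I : ℂ) ∈ {s : ℂ | 1 - δ < s.re} := by
    intro u; simp [hδ]
  have hd : ∀ u : ℝ, DifferentiableAt ℂ H (1 + u * I) := fun u =>
    (hH _ (hmem u)).differentiableAt ((isOpen_re_gt _).mem_nhds (hmem u))
  -- path
  have htend : ∀ u : ℝ, Tendsto (fun σ : ℝ => (σ + u * I : ℂ)) (𝓝[>] 1) (𝓝 (1 + u * I)) := by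
    intro u
    have : Continuous (fun σ : ℝ => (σ + u * I : ℂ)) := by fun_prop
    have h := this.tendsto 1
    simp only [ofReal_one] at h
    exact h.mono_left nhdsWithin_le_nhds
  have hbd : ∀ u : ℝ, ∃ M : ℝ, 0 < M ∧ ∀ᶠ σ : ℝ in 𝓝[>] 1, ‖H (σ + u * I)‖ ≤ M := by
    intro u
    refine ⟨‖H (1 + u * I)‖ + 1, by positivity, ?_⟩
    have := ((hd u).continuousAt.tendsto.comp (htend u)).norm
    filter_upwards [this.eventually (gt_mem_nhds (lt_add_one _))] with σ hσ
    exact hσ.le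
  obtain ⟨M0, hM0, hb0⟩ := hbd 0
  obtain ⟨M2, hM2, hb2⟩ := hbd (2 * t)
  have hO := (hd t).hasDerivAt.isBigO_sub
  rw [h0] at hO
  obtain ⟨M1, hM1, hO1⟩ := hO.exists_pos
  have hb1 := (htend t).eventually hO1.bound
  have hkey : ∀ᶠ σ : ℝ in 𝓝[>] 1, ‖c‖ ^ 8 * |t| ^ 5 ≤ M0 ^ 3 * M1 ^ 4 * M2 * (σ - 1) := by
    filter_upwards [hb0, hb1, hb2, self_mem_nhdsWithin] with σ h1 h2 h3 h4
    have hσ : 1 < σ := h4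
    have hσ' : 0 < σ - 1 := by linarith
    have hr : ∀ u : ℝ, 1 < ((σ : ℂ) + u * I).re := by intro u; simpa using hσ
    have hprod : ‖c‖ ^ 8 ≤ ‖Z σ‖ ^ 3 * ‖Z (σ + t * I)‖ ^ 4 * ‖Z (σ + (2 * t : ℝ) * I)‖ := by
      rw [hZB σ (by simpa using hσ), hZB _ (hr t), hZB _ (hr (2 * t))]
      simp only [norm_mul, norm_exp]
      have := h341 σ t hσ
      have h5 : (3 * B σ + 4 * B (σ + t * I) + B (σ + 2 * t * I)).re =
        3 * (B σ).re + 4 * (B (σ + t * I)).re + (B (σ + (2 * t : ℝ) * I)).re := by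
        simp
      rw [h5] at this
      have h6 := Real.one_le_exp this
      rw [Real.exp_add, Real.exp_add, show (3 : ℝ) * (B σ).re = ((3 : ℕ) : ℝ) * (B σ).re by norm_num,
        show (4 : ℝ) * (B (σ + t * I)).re = ((4 : ℕ) : ℝ) * (B (σ + t * I)).re by norm_num,
        Real.exp_nat_mul, Real.exp_nat_mul] at h6
      calc ‖c‖ ^ 8 = ‖c‖ ^ 8 * 1 := by ring
        _ ≤ ‖c‖ ^ 8 * (Real.exp (B σ).re ^ 3 * Real.exp (B (σ + t * I)).re ^ 4
            * Real.exp (B (σ + (2 * t : ℝ) * I)).re) := by gcongr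
        _ = _ := by ring
    have hA : ‖Z σ‖ * (σ - 1) ≤ M0 := by
      have := hZH σ (by simpa using hσ)
      have h7 : ‖Z σ‖ * (σ - 1) = ‖H σ‖ := by
        rw [← this, norm_mul]
        congr 1
        rw [show (σ : ℂ) - 1 = ((σ - 1 : ℝ) : ℂ) by push_cast; ring, norm_real,
          Real.norm_of_nonneg hσ'.le]
      rw [h7]; simpa using h1
    have hB : ‖Z (σ + t * I)‖ * |t| ≤ M1 * (σ - 1) := by
      have := hZH _ (hr t)
      have h8 : |t| ≤ ‖(σ + t * I : ℂ) - 1‖ := by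
        have := Complex.abs_im_le_norm ((σ + t * I : ℂ) - 1)
        simpa using this
      calc ‖Z (σ + t * I)‖ * |t| ≤ ‖Z (σ + t * I)‖ * ‖(σ + t * I : ℂ) - 1‖ := by gcongr
        _ = ‖H (σ + t * I)‖ := by rw [← norm_mul, this]
        _ ≤ M1 * (σ - 1) := by
          have h9 : ‖(σ + t * I : ℂ) - (1 + t * I)‖ = σ - 1 := by
            rw [show (σ + t * I : ℂ) - (1 + t * I) = ((σ - 1 : ℝ) : ℂ) by push_cast; ring,
              norm_real, Real.norm_of_nonneg hσ'.le]
          rw [sub_zero, h9] at h2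
          exact h2
    have hCc : ‖Z (σ + (2 * t : ℝ) * I)‖ * |t| ≤ M2 := by
      have := hZH _ (hr (2 * t))
      have h8 : |t| ≤ ‖(σ + (2 * t : ℝ) * I : ℂ) - 1‖ := by
        have := Complex.abs_im_le_norm ((σ + (2 * t : ℝ) * I : ℂ) - 1)
        simp [abs_mul] at this
        have h9 := abs_nonneg t
        push_cast
        linarith
      calc ‖Z (σ + (2 * t : ℝ) * I)‖ * |t|
          ≤ ‖Z (σ + (2 * t : ℝ) * I)‖ * ‖(σ + (2 * t : ℝ) * I : ℂ) - 1‖ := by gcongr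
        _ = ‖H (σ + (2 * t : ℝ) * I)‖ := by rw [← norm_mul, this]
        _ ≤ M2 := h3
    have hfin : ‖c‖ ^ 8 * |t| ^ 5 * (σ - 1) ^ 3 ≤ M0 ^ 3 * M1 ^ 4 * M2 * (σ - 1) * (σ - 1) ^ 3 := by
      calc ‖c‖ ^ 8 * |t| ^ 5 * (σ - 1) ^ 3
          ≤ (‖Z σ‖ ^ 3 * ‖Z (σ + t * I)‖ ^ 4 * ‖Z (σ + (2 * t : ℝ) * I)‖) * |t| ^ 5 * (σ - 1) ^ 3 := by
            gcongr
        _ = (‖Z σ‖ * (σ - 1)) ^ 3 * (‖Z (σ + t * I)‖ * |t|) ^ 4 *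
            (‖Z (σ + (2 * t : ℝ) * I)‖ * |t|) := by ring
        _ ≤ M0 ^ 3 * (M1 * (σ - 1)) ^ 4 * M2 := by gcongr
        _ = _ := by ring
    exact le_of_mul_le_mul_right hfin (by positivity)
  have hlim : Tendsto (fun σ : ℝ => M0 ^ 3 * M1 ^ 4 * M2 * (σ - 1)) (𝓝[>] 1) (𝓝 0) := by
    have : Continuous (fun σ : ℝ => M0 ^ 3 * M1 ^ 4 * M2 * (σ - 1)) := by fun_prop
    have h := this.tendsto 1
    simp only [sub_self, mul_zero] at h
    exact h.mono_left nhdsWithin_le_nhds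
  have hle := ge_of_tendsto hlim hkey
  have : 0 < ‖c‖ ^ 8 * |t| ^ 5 := by
    have := norm_pos_iff.mpr hc
    have := abs_pos.mpr ht
    positivity
  linarith

open scoped ComplexOrder in
theorem logDeriv_cont (a : ℕ → ℝ) (ha : ∀ n, 0 ≤ a n) (ha1 : 0 < a 1) (κ C δ D : ℝ) (hκ : 0 < κ)
    (hδ : 0 < δ) (hδ1 : δ < 1)
    (hS : ∀ x : ℝ, 1 ≤ x → |∑ k ∈ Finset.Icc 1 ⌊x⌋₊, a k - κ * x| ≤ C * x ^ (1 - δ))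
    (L : ℕ → ℝ) (hL0 : ∀ n, 0 ≤ L n) (hLD : ∀ n, L n ≤ D * ArithmeticFunction.vonMangoldt n)
    (hconv : ∀ n, a n * Real.log n = ∑ p ∈ n.divisorsAntidiagonal, L p.1 * a p.2) :
    ∃ F : ℂ → ℂ, ContinuousOn F {s | 1 ≤ s.re} ∧
      ∀ s : ℂ, 1 < s.re → LSeries (fun n => ((L n - 1 : ℝ) : ℂ)) s = F s := by
  obtain ⟨H, hHd, hH1, hZs, hZH⟩ := zeta_cont a ha κ C δ hδ hδ1 hS
  obtain ⟨H₁, hHd₁, hH1₁, hZs₁, hZH₁⟩ := zeta_cont (fun _ => 1) (fun _ => zero_le_one) 1 1 (1/2)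
    (by norm_num) (by norm_num) (by
      intro x hx
      have h1 := Nat.floor_le (zero_le_one.trans hx)
      have h2 := Nat.lt_floor_add_one x
      have h3 : (1:ℝ) ≤ x ^ (1 - 1 / 2 : ℝ) := Real.one_le_rpow hx (by norm_num)
      simp only [Finset.sum_const, Nat.card_Icc, Nat.add_sub_cancel, nsmul_eq_mul, mul_one, one_mul]
      rw [abs_le]; constructor <;> linarith)
  set b : ℕ → ℝ := fun n => L n / Real.log n with hbdef
  have hD : 0 ≤ D := by
    have h := hLD 2
    rw [ArithmeticFunction.vonMangoldt_apply_prime Nat.prime_two] at h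
    have := hL0 2
    have h2 : 0 < Real.log (2 : ℕ) := Real.log_pos (by norm_num)
    by_contra hneg
    push Not at hneg
    nlinarith
  have hLlog : ∀ n, L n ≤ D * Real.log n := fun n =>
    (hLD n).trans (mul_le_mul_of_nonneg_left ArithmeticFunction.vonMangoldt_le_log hD)
  have hlog0 : ∀ n : ℕ, 0 ≤ Real.log n := fun n => Real.log_natCast_nonneg n
  have hb0 : ∀ n, 0 ≤ b n := fun n => div_nonneg (hL0 n) (hlog0 n)
  have hbD : ∀ n, b n ≤ D := fun n => div_le_of_le_mul₀ (hlog0 n) hD (hLlog n)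
  have hbs : ∀ s : ℂ, 1 < s.re → LSeriesSummable (fun n => (b n : ℂ)) s := by
    intro s hs
    refine LSeriesSummable_of_bounded_of_one_lt_re (m := D) (fun n _ => ?_) hs
    rw [norm_real, Real.norm_of_nonneg (hb0 n)]
    exact hbD n
  have hbL : LSeries.logMul (fun n => (b n : ℂ)) = fun n => (L n : ℂ) := by
    funext n
    simp only [LSeries.logMul, hbdef]
    rw [← natCast_log, ← ofReal_mul]
    congr 1
    by_cases h : Real.log n = 0
    · have h1 := hLlog n
      rw [h, mul_zero] at h1
      rw [h, zero_mul]; exact le_antisymm (hL0 n) h1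
    · field_simp
  have habs : ∀ (f : ℕ → ℂ), (∀ s : ℂ, 1 < s.re → LSeriesSummable f s) → ∀ s : ℂ, 1 < s.re →
      LSeries.abscissaOfAbsConv f < s.re := by
    intro f hf s hs
    refine lt_of_le_of_lt (LSeries.abscissaOfAbsConv_le_of_forall_lt_LSeriesSummable (x := 1) ?_) ?_
    · intro y hy; exact hf y (by simpa using hy)
    · exact_mod_cast hs
  set Z := LSeries (fun n => (a n : ℂ)) with hZ
  set B := LSeries (fun n => (b n : ℂ)) with hB
  set G := LSeries (fun n => (L n : ℂ)) with hG
  have hLs : ∀ s : ℂ, 1 < s.re → LSeriesSummable (fun n => (L n : ℂ)) s := by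
    intro s hs
    rw [← hbL]
    exact LSeriesSummable_logMul_of_lt_re (habs _ hbs s hs)
  have hBd : ∀ s : ℂ, 1 < s.re → HasDerivAt B (- G s) s := by
    intro s hs
    have := LSeries_hasDerivAt (habs _ hbs s hs)
    rwa [hbL] at this
  have hZd : ∀ s : ℂ, 1 < s.re → HasDerivAt Z (- (G s * Z s)) s := by
    intro s hs
    have h1 := LSeries_hasDerivAt (habs _ hZs s hs)
    have h2 : LSeries.logMul (fun n => (a n : ℂ)) =
        LSeries.convolution (fun n => (L n : ℂ)) (fun n => (a n : ℂ)) := by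
      rw [LSeries.convolution_def]
      funext n
      have := hconv n
      simp only [LSeries.logMul]
      rw [← natCast_log, ← ofReal_mul, mul_comm, this]
      push_cast; rfl
    rw [h2, LSeries_convolution' (hLs s hs) (hZs s hs)] at h1
    exact h1
  have hconst : ∀ s : ℂ, 1 < s.re → HasDerivAt (fun s => Z s * exp (- B s)) 0 s := by
    intro s hs
    have := (hZd s hs).mul ((hBd s hs).neg.cexp)
    refine this.congr_deriv ?_
    ring
  obtain ⟨c, hcc⟩ := (isOpen_re_gt 1).exists_is_const_of_deriv_eq_zero isPreconnected_re_gt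
    (f := fun s => Z s * exp (- B s))
    (fun s hs => (hconst s hs).differentiableAt.differentiableWithinAt)
    (fun s hs => (hconst s hs).deriv)
  have hZB : ∀ s : ℂ, 1 < s.re → Z s = c * exp (B s) := by
    intro s hs
    rw [← hcc s hs, mul_assoc, ← exp_add]; simp
  have hc0 : c ≠ 0 := by
    intro hc
    have h2 : (0:ℂ) < Z (2 : ℝ) := by
      refine LSeries.positive ?_ ?_ (habs _ hZs ((2:ℝ):ℂ) (by simp))
      · intro n; simpa using ha n
      · simpa using ha1
    have h3 := hZB (2:ℝ) (by simp)
    rw [hc, zero_mul] at h3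
    rw [h3] at h2
    exact lt_irrefl _ h2
  have hnv := nonvanish Z H B c hc0 δ hδ hHd hZH hZB
    (fun σ t hσ => three_four_one b hb0 hbs σ t hσ)
  have hZ0 : ∀ s : ℂ, 1 < s.re → Z s ≠ 0 := by
    intro s hs
    rw [hZB s hs]; exact mul_ne_zero hc0 (exp_ne_zero _)
  have hs1 : ∀ s : ℂ, 1 < s.re → s - 1 ≠ 0 := by
    intro s hs h
    rw [sub_eq_zero] at h; rw [h] at hs; simp at hs
  have hH0 : ∀ s : ℂ, 1 ≤ s.re → H s ≠ 0 := by
    intro s hs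
    rcases hs.lt_or_eq with h | h
    · rw [← hZH s h]; exact mul_ne_zero (hZ0 s h) (hs1 s h)
    · have hse : s = 1 + s.im * I := by
        apply Complex.ext <;> simp [← h]
      by_cases him : s.im = 0
      · rw [hse, him]; simp [hH1, hκ.ne']
      · rw [hse]; exact hnv _ him
  refine ⟨fun s => - (deriv H s / H s) - dslope H₁ 1 s, ?_, ?_⟩
  · have hsub : {s : ℂ | 1 ≤ s.re} ⊆ {s | 1 - δ < s.re} := by
      intro s hs
      simp only [mem_ofPred_eq] at hs ⊢
      linarith
    have hsub₁ : {s : ℂ | 1 ≤ s.re} ⊆ {s | 1 - 1/2 < s.re} := by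
      intro s hs
      simp only [mem_ofPred_eq] at hs ⊢
      linarith
    have hm : {s : ℂ | 1 - 1/2 < s.re} ∈ 𝓝 (1:ℂ) :=
      (isOpen_re_gt _).mem_nhds (by simp)
    refine ContinuousOn.sub (ContinuousOn.neg (ContinuousOn.div ?_ ?_ ?_)) ?_
    · exact ((hHd.deriv (isOpen_re_gt _)).continuousOn).mono hsub
    · exact hHd.continuousOn.mono hsub
    · exact hH0
    · exact ((continuousOn_dslope hm).2 ⟨hHd₁.continuousOn, hHd₁.differentiableAt hm⟩).mono hsub₁
  · intro s hs
    have hone := hZs₁ s hs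
    have h1 : (fun n => ((L n - 1 : ℝ) : ℂ)) =
        (fun n => (L n : ℂ)) - (fun n => (((fun _ => 1 : ℕ → ℝ) n : ℝ) : ℂ)) := by
      funext n; simp
    rw [h1, LSeries_sub (hLs s hs) hone]
    have hne : s ≠ 1 := sub_ne_zero.mp (hs1 s hs)
    have hH' : deriv H s = - (G s * Z s) * (s - 1) + Z s := by
      have h2 : H =ᶠ[𝓝 s] fun s => Z s * (s - 1) := by
        filter_upwards [(isOpen_re_gt 1).mem_nhds hs] with w hw
        exact (hZH w hw).symm
      rw [h2.deriv_eq]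
      have h3 : HasDerivAt (fun s => Z s * (s - 1)) (-(G s * Z s) * (s - 1) + Z s * 1) s :=
        (hZd s hs).mul ((hasDerivAt_id s).sub_const 1)
      rw [h3.deriv, mul_one]
    show _ = -(deriv H s / H s) - dslope H₁ 1 s
    rw [dslope_of_ne _ hne, slope_def_field, hH1₁, hH', ← hZH s hs, ← hZH₁ s hs]
    have := hZ0 s hs
    have := hs1 s hs
    push_cast
    field_simp
    ring

end Fact4
end part2

section part3
open Complex Filter Topology MeasureTheory Set

namespace Fact4

/-- The Fejer kernel. -/
noncomputable def fej (R u : ℝ) : ℝ := R * Real.sinc (R * u / 2) ^ 2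

theorem fej_nonneg {R : ℝ} (hR : 0 < R) (u : ℝ) : 0 ≤ fej R u := by
  unfold fej; positivity

theorem fej_le {R : ℝ} (hR : 0 < R) (u : ℝ) : fej R u ≤ R := by
  unfold fej
  have h := Real.abs_sinc_le_one (R * u / 2)
  have : Real.sinc (R * u / 2) ^ 2 ≤ 1 := by
    rw [← sq_abs]; exact pow_le_one₀ (abs_nonneg _) h
  nlinarith

theorem fej_mul_sq_le {R : ℝ} (hR : 0 < R) (u : ℝ) : fej R u * u ^ 2 ≤ 4 / R := by
  unfold fej
  by_cases hu : u = 0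
  · rw [hu]; simp; positivity
  · have hx : R * u / 2 ≠ 0 := by positivity
    rw [Real.sinc_of_ne_zero hx, div_pow]
    have h1 : Real.sin (R * u / 2) ^ 2 ≤ 1 := Real.sin_sq_le_one _
    have : R * (Real.sin (R * u / 2) ^ 2 / (R * u / 2) ^ 2) * u ^ 2
      = Real.sin (R * u / 2) ^ 2 * (4 / R) := by field_simp; ring
    rw [this]
    have : 0 < 4 / R := by positivity
    nlinarith

theorem fej_le' {R : ℝ} (hR : 0 < R) (u : ℝ) : fej R u ≤ (R + 4 / R) / (1 + u ^ 2) := by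
  rw [le_div_iff₀ (by positivity)]
  have := fej_le hR u
  have := fej_mul_sq_le hR u
  linarith

theorem fej_lower {R u : ℝ} (hR : 0 < R) (hu : |u| ≤ 1 / R) : R / 4 ≤ fej R u := by
  unfold fej
  have key : ∀ x : ℝ, 0 ≤ x → x ≤ 1 / 2 → 1 / 2 ≤ Real.sinc x := by
    intro x hx hx2
    rcases hx.eq_or_lt with h | h
    · rw [← h]; simp; norm_num
    · rw [Real.sinc_of_ne_zero h.ne', le_div_iff₀ h]
      have h1 := Real.mul_le_sin hx (by linarith [Real.pi_gt_three])
      have h2 : 1 / 2 ≤ 2 / Real.pi := by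
        rw [div_le_div_iff₀ (by norm_num) Real.pi_pos]; linarith [Real.pi_le_four]
      nlinarith
  have h1 : |R * u / 2| ≤ 1 / 2 := by
    rw [abs_div, abs_mul, abs_of_pos hR]
    have : R * |u| ≤ R * (1 / R) := by gcongr
    rw [mul_one_div_cancel hR.ne'] at this
    rw [abs_of_pos (by norm_num : (0:ℝ) < 2)]; linarith
  have h2 := key _ (abs_nonneg _) h1
  have h3 : Real.sinc |R * u / 2| = Real.sinc (R * u / 2) := by
    rcases abs_choice (R * u / 2) with h | h <;> rw [h]
    exact Real.sinc_neg _
  rw [h3] at h2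
  nlinarith [mul_le_mul h2 h2 (by norm_num) (by linarith)]

theorem fej_fourier {R : ℝ} (hR : 0 < R) (u : ℝ) :
    ∫ t in (-R)..R, ((1 - |t| / R : ℝ) : ℂ) * cexp (I * t * u) = (fej R u : ℂ) := by
  set g : ℝ → ℂ := fun t => ((1 - |t| / R : ℝ) : ℂ) * cexp (I * t * u) with hg
  have hgc : Continuous g := by
    rw [hg]; fun_prop
  have h1 : ∫ t in (-R)..R, g t = ∫ t in (0:ℝ)..R, (g t + g (-t)) := by
    have hgn : Continuous (fun t => g (-t)) := hgc.comp continuous_neg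
    rw [intervalIntegral.integral_add (hgc.intervalIntegrable _ _) (hgn.intervalIntegrable _ _), intervalIntegral.integral_comp_neg, neg_zero,
      add_comm, intervalIntegral.integral_add_adjacent_intervals (hgc.intervalIntegrable _ _)
      (hgc.intervalIntegrable _ _)]
  rw [h1]
  have h2 : ∀ t ∈ uIcc 0 R, g t + g (-t) = ((2 * (1 - t / R) * Real.cos (t * u) : ℝ) : ℂ) := by
    intro t ht
    rw [uIcc_of_le hR.le] at ht
    simp only [hg, abs_neg, abs_of_nonneg ht.1]
    push_cast
    rw [Complex.cos]
    have e1 : I * (t:ℂ) * u = t * u * I := by ring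
    have e2 : I * (-(t:ℂ)) * u = -(t * u) * I := by ring
    rw [e1, e2]; ring
  rw [intervalIntegral.integral_congr h2, intervalIntegral.integral_ofReal]
  congr 1
  by_cases hu : u = 0
  · rw [hu]
    have : ∫ t in (0:ℝ)..R, 2 * (1 - t / R) * Real.cos (t * 0) =
      (2 * R - R ^ 2 / R) - (2 * 0 - 0 ^ 2 / R) := by
      apply intervalIntegral.integral_eq_sub_of_hasDerivAt (f := fun t => 2 * t - t ^ 2 / R)
      · intro t _
        have := ((hasDerivAt_id t).const_mul 2).sub (((hasDerivAt_id t).pow 2).div_const R)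
        refine this.congr_deriv ?_
        simp; ring
      · exact Continuous.intervalIntegrable (by fun_prop) _ _
    rw [this]; simp [fej]; field_simp; ring
  · have : ∫ t in (0:ℝ)..R, 2 * (1 - t / R) * Real.cos (t * u) =
      (2 * (1 - R / R) * Real.sin (R * u) / u - 2 * Real.cos (R * u) / (R * u ^ 2)) -
      (2 * (1 - 0 / R) * Real.sin (0 * u) / u - 2 * Real.cos (0 * u) / (R * u ^ 2)) := by
      apply intervalIntegral.integral_eq_sub_of_hasDerivAt
        (f := fun t => 2 * (1 - t / R) * Real.sin (t * u) / u - 2 * Real.cos (t * u) / (R * u ^ 2))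
      · intro t _
        have hm : HasDerivAt (fun t : ℝ => t * u) u t := by
          simpa using (hasDerivAt_id t).mul_const u
        have hw : HasDerivAt (fun t : ℝ => 2 * (1 - t / R)) (2 * (- (1 / R))) t := by
          have := (((hasDerivAt_id t).div_const R).const_sub 1).const_mul 2
          exact this
        have := ((hw.mul hm.sin).div_const u).sub ((hm.cos.const_mul 2).div_const (R * u ^ 2))
        refine this.congr_deriv ?_
        field_simp; ring
      · exact Continuous.intervalIntegrable (by fun_prop) _ _
    rw [this]
    have hx : R * u / 2 ≠ 0 := by positivity
    unfold fej
    rw [Real.sinc_of_ne_zero hx, div_pow, Real.sin_sq_eq_half_sub]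
    have : 2 * (R * u / 2) = R * u := by ring
    rw [this]
    simp
    field_simp
    ring

theorem int_sum_bdd : Summable (fun k : ℤ => 1 / (1 + (k:ℝ) ^ 2)) := by
  have h1 := Real.summable_one_div_int_pow.mpr (by norm_num : 1 < 2)
  have h2 : Summable (fun k : ℤ => if k = 0 then (1:ℝ) else 0) :=
    summable_of_hasFiniteSupport ((Set.finite_singleton 0).subset (by intro k; simp))
  refine Summable.of_nonneg_of_le (fun k => by positivity) (fun k => ?_) (h1.add h2)
  by_cases hk : k = 0
  · simp [hk]
  · simp only [hk, if_false, add_zero]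
    have : (0:ℝ) < (k:ℝ) ^ 2 := by positivity
    gcongr; linarith

theorem theta_sum_le : ∃ C : ℝ, 0 < C ∧ ∀ x : ℝ, 0 ≤ x →
    ∑ n ∈ Finset.Ioc 0 ⌊x⌋₊, (ArithmeticFunction.vonMangoldt n + 1) ≤ C * x := by
  refine ⟨Real.log 4 + 4 + 1, by positivity, fun x hx => ?_⟩
  rw [Finset.sum_add_distrib]
  have h1 := Chebyshev.psi_le_const_mul_self hx
  unfold Chebyshev.psi at h1
  have h2 : ∑ n ∈ Finset.Ioc 0 ⌊x⌋₊, (1:ℝ) ≤ x := by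
    simp only [Finset.sum_const, Nat.card_Ioc, Nat.sub_zero, nsmul_eq_mul, mul_one]
    exact Nat.floor_le hx
  linarith

theorem unif_bound : ∃ C : ℝ, 0 < C ∧ ∀ T : ℝ,
    Summable (fun n : ℕ => (ArithmeticFunction.vonMangoldt n + 1) / n / (1 + (Real.log n - T) ^ 2)) ∧
    ∑' n : ℕ, (ArithmeticFunction.vonMangoldt n + 1) / n / (1 + (Real.log n - T) ^ 2) ≤ C := by
  obtain ⟨C1, hC1, hθ⟩ := theta_sum_le
  set S := ∑' k : ℤ, 1 / (1 + (k:ℝ) ^ 2) with hS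
  have hS0 : 0 ≤ S := tsum_nonneg (fun k => by positivity)
  set C := C1 * Real.exp 1 * 3 * S + 1
  have hC : 0 < C := by positivity
  have hΛ : ∀ n : ℕ, 0 ≤ ArithmeticFunction.vonMangoldt n + 1 := fun n => by
    have := ArithmeticFunction.vonMangoldt_nonneg (n := n); linarith
  refine ⟨C, hC, fun T => ?_⟩
  have hnn : ∀ n : ℕ, 0 ≤ (ArithmeticFunction.vonMangoldt n + 1) / n / (1 + (Real.log n - T) ^ 2) := by
    intro n; have := hΛ n; positivity
  have hfin : ∀ s : Finset ℕ, ∑ n ∈ s, (ArithmeticFunction.vonMangoldt n + 1) / n /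
      (1 + (Real.log n - T) ^ 2) ≤ C := by
    intro s
    have hk0 : ∀ n ∈ s, (fun n : ℕ => ⌊Real.log n - T⌋) n ∈ s.image (fun n : ℕ => ⌊Real.log n - T⌋) :=
      fun n hn => Finset.mem_image_of_mem _ hn
    rw [← Finset.sum_fiberwise_of_maps_to hk0]
    have hblock : ∀ k ∈ s.image (fun n : ℕ => ⌊Real.log n - T⌋),
        ∑ n ∈ s with ⌊Real.log (n:ℕ) - T⌋ = k, (ArithmeticFunction.vonMangoldt n + 1) / n /
          (1 + (Real.log n - T) ^ 2) ≤ C1 * Real.exp 1 * 3 * (1 / (1 + (k:ℝ) ^ 2)) := by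
      intro k _
      have hE := Real.exp_pos (T + k)
      have h1 : ∀ n ∈ s.filter (fun n : ℕ => ⌊Real.log n - T⌋ = k),
          (ArithmeticFunction.vonMangoldt n + 1) / n / (1 + (Real.log n - T) ^ 2) ≤
          (if n = 0 then 0 else (ArithmeticFunction.vonMangoldt n + 1)) *
            (3 / Real.exp (T + k) * (1 / (1 + (k:ℝ) ^ 2))) := by
        intro n hn
        rw [Finset.mem_filter, Int.floor_eq_iff] at hn
        obtain ⟨_, hl, hr⟩ := hn
        by_cases hn0 : n = 0
        · simp [hn0]
        · simp only [hn0, if_false]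
          have hnpos : (0:ℝ) < n := by positivity
          have hne : Real.exp (T + k) ≤ n := by
            rw [← Real.le_log_iff_exp_le hnpos]; linarith
          have h3 : 1 + (k:ℝ) ^ 2 ≤ 3 * (1 + (Real.log n - T) ^ 2) := by
            nlinarith [sq_nonneg (Real.log n - T - (k - (Real.log n - T)) )]
          have h4 : 1 / (1 + (Real.log n - T) ^ 2) ≤ 3 * (1 / (1 + (k:ℝ) ^ 2)) := by
            rw [mul_one_div, div_le_div_iff₀ (by positivity) (by positivity)]; linarith
          calc (ArithmeticFunction.vonMangoldt n + 1) / n / (1 + (Real.log n - T) ^ 2)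
              = (ArithmeticFunction.vonMangoldt n + 1) * (1 / n) * (1 / (1 + (Real.log n - T) ^ 2)) := by
                field_simp
            _ ≤ (ArithmeticFunction.vonMangoldt n + 1) * (1 / Real.exp (T + k)) *
                (3 * (1 / (1 + (k:ℝ) ^ 2))) := by
                have := hΛ n
                gcongr
            _ = _ := by ring
      refine (Finset.sum_le_sum h1).trans ?_
      rw [← Finset.sum_mul]
      have h2 : ∑ n ∈ s with ⌊Real.log (n:ℕ) - T⌋ = k,
          (if n = 0 then 0 else (ArithmeticFunction.vonMangoldt n + 1)) ≤ C1 * Real.exp (T + k + 1) := by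
        refine le_trans ?_ (hθ _ (Real.exp_pos _).le)
        rw [← Finset.sum_filter_add_sum_filter_not _ (fun n : ℕ => n = 0)]
        rw [Finset.sum_eq_zero (s := Finset.filter (fun n : ℕ => n = 0) _), zero_add]
        · rw [Finset.sum_congr rfl (g := fun n => ArithmeticFunction.vonMangoldt n + 1)]
          · apply Finset.sum_le_sum_of_subset_of_nonneg
            · intro n hn
              simp only [Finset.mem_filter, Int.floor_eq_iff] at hn
              obtain ⟨⟨_, hl, hr⟩, hn0⟩ := hn
              rw [Finset.mem_Ioc]
              refine ⟨Nat.pos_of_ne_zero hn0, Nat.le_floor ?_⟩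
              have hnpos : (0:ℝ) < n := by positivity
              rw [← Real.log_le_iff_le_exp hnpos]; linarith
            · intro n _ _; exact hΛ n
          · intro n hn
            simp only [Finset.mem_filter] at hn
            simp [hn.2]
        · intro n hn
          simp only [Finset.mem_filter] at hn
          simp [hn.2]
      calc _ ≤ C1 * Real.exp (T + k + 1) * (3 / Real.exp (T + k) * (1 / (1 + (k:ℝ) ^ 2))) := by
            gcongr
        _ = _ := by rw [Real.exp_add (T + k) 1]; field_simp
    refine (Finset.sum_le_sum hblock).trans ?_
    rw [← Finset.mul_sum]
    have := int_sum_bdd.sum_le_tsum (s.image (fun n : ℕ => ⌊Real.log n - T⌋))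
      (fun k _ => by positivity)
    have h5 : 0 ≤ C1 * Real.exp 1 * 3 := by positivity
    have := mul_le_mul_of_nonneg_left this h5
    simp only [C]; linarith
  have hsum := summable_of_sum_le hnn hfin
  exact ⟨hsum, hsum.tsum_le_of_sum_le hfin⟩

end Fact4
end part3

section part4
open Complex Filter Topology MeasureTheory Set

namespace Fact4

theorem summable_fej {R : ℝ} (hR : 0 < R) (c : ℕ → ℝ) (D : ℝ) 
    (hc : ∀ n, |c n| ≤ D * (ArithmeticFunction.vonMangoldt n + 1)) (T : ℝ) :
    Summable (fun n : ℕ => |c n| * (fej R (Real.log n - T) / n)) := by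
  obtain ⟨C, -, hC⟩ := unif_bound
  refine Summable.of_nonneg_of_le (fun n => ?_) (fun n => ?_)
    ((hC T).1.mul_left (D * (R + 4 / R)))
  · have := fej_nonneg hR (Real.log n - T); positivity
  · have h1 := fej_nonneg hR (Real.log n - T)
    calc |c n| * (fej R (Real.log n - T) / n)
        ≤ (D * (ArithmeticFunction.vonMangoldt n + 1)) *
          (((R + 4 / R) / (1 + (Real.log n - T) ^ 2)) / n) := by
          gcongr
          · exact (abs_nonneg _).trans (hc n)
          · exact hc n
          · exact fej_le' hR _
      _ = _ := by ring

theorem fej_fubini {R : ℝ} (hR : 0 < R) (c : ℕ → ℝ) (F : ℂ → ℂ)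
    (hF : ContinuousOn F {s | 1 ≤ s.re})
    (hs : ∀ s : ℂ, 1 < s.re → LSeriesSummable (fun n => (c n : ℂ)) s)
    (hcF : ∀ s : ℂ, 1 < s.re → LSeries (fun n => (c n : ℂ)) s = F s) (T σ : ℝ) (hσ : 1 < σ) :
    HasSum (fun n : ℕ => if n = 0 then (0:ℂ) else
      (c n : ℂ) * ((n:ℝ) ^ (-σ) : ℝ) * (fej R (Real.log n - T) : ℂ))
      (∫ t in (-R)..R, ((1 - |t| / R : ℝ) : ℂ) * cexp (-(I * t * T)) * F (σ - t * I)) := by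
  set Fn : ℕ → ℝ → ℂ := fun n t => if n = 0 then (0:ℂ) else
      ((1 - |t| / R : ℝ) : ℂ) * cexp (-(I * t * T)) *
        ((c n : ℂ) * ((n:ℝ) ^ (-σ) : ℝ) * cexp (I * t * Real.log n)) with hFn
  have hsum : Summable (fun n : ℕ => ‖LSeries.term (fun n => (c n : ℂ)) (σ:ℂ) n‖) :=
    (hs σ (by simpa using hσ)).norm
  have hterm : ∀ n : ℕ, ∀ t : ℝ, Fn n t = ((1 - |t| / R : ℝ) : ℂ) * cexp (-(I * t * T)) *
      LSeries.term (fun n => (c n : ℂ)) (σ - t * I) n := by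
    intro n t
    simp only [hFn]
    rw [LSeries.term_def]
    by_cases hn : n = 0
    · simp [hn]
    · simp only [hn, if_false]
      congr 1
      have hnc : (n:ℂ) ≠ 0 := by exact_mod_cast hn
      have hnp : (0:ℝ) ≤ n := by positivity
      rw [mul_assoc, div_eq_mul_inv]
      congr 1
      rw [← cpow_neg, ofReal_cpow hnp, cpow_def_of_ne_zero hnc, ofReal_natCast,
        cpow_def_of_ne_zero hnc, ← Complex.exp_add]
      congr 1
      rw [ofReal_log hnp]
      push_cast; ring
  have h := intervalIntegral.hasSum_integral_of_dominated_convergence (a := -R) (b := R)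
    (μ := volume) (F := Fn)
    (f := fun t => ((1 - |t| / R : ℝ) : ℂ) * cexp (-(I * t * T)) * F (σ - t * I))
    (fun n _ => ‖LSeries.term (fun n => (c n : ℂ)) (σ:ℂ) n‖) ?_ ?_ ?_ ?_ ?_
  · refine h.congr_fun ?_
    intro n
    simp only [hFn]
    by_cases hn : n = 0
    · simp [hn]
    · simp only [hn, if_false]
      rw [← fej_fourier hR, ← intervalIntegral.integral_const_mul]
      apply intervalIntegral.integral_congr
      intro t _
      show _ = _
      have : cexp (I * t * ((Real.log n - T : ℝ) : ℂ)) = cexp (-(I * t * T)) * cexp (I * t * Real.log n) := by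
        rw [← Complex.exp_add]; congr 1; push_cast; ring
      simp only [this]
      ring
  · intro n
    apply Continuous.aestronglyMeasurable
    simp only [hFn]
    by_cases hn : n = 0
    · simp only [hn, if_true]; fun_prop
    · simp only [hn, if_false]; fun_prop
  · intro n
    refine ae_of_all _ (fun t ht => ?_)
    rw [hterm, norm_mul, norm_mul]
    have htR : |t| ≤ R := by
      rw [uIoc_of_le (by linarith)] at ht
      rw [abs_le]; exact ⟨ht.1.le, ht.2⟩
    have h1 : ‖((1 - |t| / R : ℝ) : ℂ)‖ ≤ 1 := by
      rw [norm_real, Real.norm_eq_abs, abs_le]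
      have h2 : 0 ≤ |t| / R := by positivity
      have h3 : |t| / R ≤ 1 := by rw [div_le_one hR]; exact htR
      constructor <;> linarith
    have h2 : ‖cexp (-(I * t * T))‖ = 1 := by
      rw [norm_exp]; simp
    have h3 : ‖LSeries.term (fun n => (c n : ℂ)) (σ - t * I) n‖ =
        ‖LSeries.term (fun n => (c n : ℂ)) (σ:ℂ) n‖ := by
      rw [LSeries.norm_term_eq, LSeries.norm_term_eq]; simp
    rw [h2, h3, mul_one]
    have := norm_nonneg (LSeries.term (fun n => (c n : ℂ)) (σ:ℂ) n)
    nlinarith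
  · exact ae_of_all _ (fun t _ => hsum)
  · exact _root_.intervalIntegrable_const
  · refine ae_of_all _ (fun t _ => ?_)
    have hre : 1 < ((σ:ℂ) - t * I).re := by simpa using hσ
    rw [← hcF _ hre]
    simp_rw [hterm]
    exact (hs _ hre).hasSum.mul_left _

theorem fej_identity {R : ℝ} (hR : 0 < R) (c : ℕ → ℝ) (D : ℝ) 
    (hc : ∀ n, |c n| ≤ D * (ArithmeticFunction.vonMangoldt n + 1)) (F : ℂ → ℂ)
    (hF : ContinuousOn F {s | 1 ≤ s.re})
    (hs : ∀ s : ℂ, 1 < s.re → LSeriesSummable (fun n => (c n : ℂ)) s)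
    (hcF : ∀ s : ℂ, 1 < s.re → LSeries (fun n => (c n : ℂ)) s = F s) (T : ℝ) :
    ((∑' n : ℕ, c n * (fej R (Real.log n - T) / n) : ℝ) : ℂ) =
      ∫ t in (-R)..R, ((1 - |t| / R : ℝ) : ℂ) * cexp (-(I * t * T)) * F (1 - t * I) := by
  have hev : ∀ᶠ σ : ℝ in 𝓝[>] 1, 1 < σ ∧ σ < 2 := by
    have := Ioo_mem_nhdsGT (show (1:ℝ) < 2 by norm_num)
    filter_upwards [this] with σ hσ using hσ
  have hA : Tendsto (fun σ : ℝ => ∑' n : ℕ, if n = 0 then (0:ℂ) else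
      (c n : ℂ) * ((n:ℝ) ^ (-σ) : ℝ) * (fej R (Real.log n - T) : ℂ)) (𝓝[>] 1)
      (𝓝 (∑' n : ℕ, ((c n * (fej R (Real.log n - T) / n) : ℝ) : ℂ))) := by
    refine tendsto_tsum_of_dominated_convergence (summable_fej hR c D hc T) ?_ ?_
    · intro n
      by_cases hn : n = 0
      · simp [hn]
      · simp only [hn, if_false]
        have hnp : (0:ℝ) < n := by positivity
        have h1 : Tendsto (fun σ : ℝ => (n:ℝ) ^ (-σ)) (𝓝[>] 1) (𝓝 ((n:ℝ) ^ (-1:ℝ))) := by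
          have : Continuous (fun σ : ℝ => (n:ℝ) ^ (-σ)) := by
            exact continuous_const.rpow continuous_neg (fun _ => Or.inl hnp.ne')
          exact (this.tendsto 1).mono_left nhdsWithin_le_nhds
        have h2 := (((continuous_ofReal.tendsto _).comp h1).const_mul (c n : ℂ)).mul_const
          (fej R (Real.log n - T) : ℂ)
        have he : ((c n * (fej R (Real.log n - T) / n) : ℝ) : ℂ) =
            (c n : ℂ) * ((n:ℝ) ^ (-1:ℝ) : ℝ) * (fej R (Real.log n - T) : ℂ) := by
          rw [Real.rpow_neg_one]; push_cast; ring
        rw [he]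
        exact h2
    · filter_upwards [hev] with σ hσ n
      by_cases hn : n = 0
      · simp [hn]
      · simp only [hn, if_false]
        have hnp : (0:ℝ) < n := by positivity
        have hn1 : (1:ℝ) ≤ n := by exact_mod_cast Nat.one_le_iff_ne_zero.mpr hn
        rw [norm_mul, norm_mul, norm_real, norm_real, norm_real, Real.norm_eq_abs,
          Real.norm_of_nonneg (fej_nonneg hR _), Real.norm_of_nonneg (Real.rpow_nonneg hnp.le _)]
        have : (n:ℝ) ^ (-σ) ≤ (n:ℝ)⁻¹ := by
          rw [← Real.rpow_neg_one]
          exact Real.rpow_le_rpow_of_exponent_le hn1 (by linarith [hσ.1])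
        have h3 := fej_nonneg hR (Real.log n - T)
        calc |c n| * (n:ℝ) ^ (-σ) * fej R (Real.log n - T)
            ≤ |c n| * (n:ℝ)⁻¹ * fej R (Real.log n - T) := by gcongr
          _ = _ := by ring
  have hcomp : IsCompact ((Icc (1:ℝ) 2) ×ℂ (Icc (-R) R)) := isCompact_Icc.reProdIm isCompact_Icc
  obtain ⟨M, hM⟩ := hcomp.exists_bound_of_continuousOn (f := F) (hF.mono (by
    intro s hs
    rw [mem_reProdIm] at hs
    exact hs.1.1))
  have hB : Tendsto (fun σ : ℝ => ∫ t in (-R)..R, ((1 - |t| / R : ℝ) : ℂ) * cexp (-(I * t * T)) *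
      F (σ - t * I)) (𝓝[>] 1)
      (𝓝 (∫ t in (-R)..R, ((1 - |t| / R : ℝ) : ℂ) * cexp (-(I * t * T)) * F (1 - t * I))) := by
    refine intervalIntegral.tendsto_integral_filter_of_dominated_convergence (fun _ => M) ?_ ?_
      _root_.intervalIntegrable_const ?_
    · filter_upwards [hev] with σ hσ
      apply Continuous.aestronglyMeasurable
      have : Continuous (fun t : ℝ => F (σ - t * I)) := by
        refine hF.comp_continuous (by fun_prop) ?_
        intro t; simp only [mem_ofPred_eq]; simpa using hσ.1.le
      refine Continuous.mul ?_ this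
      fun_prop
    · filter_upwards [hev] with σ hσ
      refine ae_of_all _ (fun t ht => ?_)
      have htR : |t| ≤ R := by
        rw [uIoc_of_le (by linarith)] at ht
        rw [abs_le]; exact ⟨ht.1.le, ht.2⟩
      rw [norm_mul, norm_mul]
      have h1 : ‖((1 - |t| / R : ℝ) : ℂ)‖ ≤ 1 := by
        rw [norm_real, Real.norm_eq_abs, abs_le]
        have h2 : 0 ≤ |t| / R := by positivity
        have h3 : |t| / R ≤ 1 := by rw [div_le_one hR]; exact htR
        constructor <;> linarith
      have h2 : ‖cexp (-(I * t * T))‖ = 1 := by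
        rw [norm_exp]; simp
      have h3 : ‖F (σ - t * I)‖ ≤ M := by
        apply hM
        rw [mem_reProdIm]
        have := abs_le.mp htR
        constructor
        · simpa using ⟨hσ.1.le, hσ.2.le⟩
        · simpa using ⟨this.2, by linarith [this.1]⟩
      rw [h2, mul_one]
      have := norm_nonneg (F (σ - t * I))
      nlinarith
    · refine ae_of_all _ (fun t ht => ?_)
      refine Tendsto.const_mul _ ?_
      have hmem : (1 - t * I : ℂ) ∈ {s : ℂ | 1 ≤ s.re} := by simp
      refine (hF _ hmem).tendsto.comp (tendsto_nhdsWithin_iff.mpr ⟨?_, ?_⟩)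
      · have : Continuous (fun σ : ℝ => (σ - t * I : ℂ)) := by fun_prop
        have h := this.tendsto 1
        simp only [ofReal_one] at h
        exact h.mono_left nhdsWithin_le_nhds
      · filter_upwards [hev] with σ hσ
        show 1 ≤ ((σ:ℂ) - t * I).re
        simpa using hσ.1.le
  rw [ofReal_tsum]
  refine tendsto_nhds_unique hA (hB.congr' ?_)
  filter_upwards [hev] with σ hσ
  exact (fej_fubini hR c F hF hs hcF T σ hσ.1).tsum_eq.symm

theorem riemann_lebesgue (R : ℝ) (hR : 0 < R) (g : ℝ → ℂ) :
    Tendsto (fun T : ℝ => ∫ t in (-R)..R, cexp (-(I * t * T)) * g t) atTop (𝓝 0) := by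
  have h := Real.tendsto_integral_exp_smul_cocompact ((Ioc (-R) R).indicator g)
  have h2 : Tendsto (fun T : ℝ => T / (2 * Real.pi)) atTop (cocompact ℝ) := by
    refine Tendsto.mono_right (tendsto_id.atTop_div_const (by positivity)) ?_
    exact atTop_le_cocompact
  have h3 := h.comp h2
  refine h3.congr (fun T => ?_)
  rw [intervalIntegral.integral_of_le (by linarith), ← integral_indicator measurableSet_Ioc]
  apply integral_congr_ae
  refine ae_of_all _ (fun t => ?_)
  by_cases ht : t ∈ Ioc (-R) R
  · simp only [indicator_of_mem ht]
    rw [Circle.smul_def, Real.fourierChar_apply, smul_eq_mul]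
    congr 2
    have : (Real.pi : ℂ) ≠ 0 := by exact_mod_cast Real.pi_ne_zero
    push_cast; field_simp
  · simp only [indicator_of_notMem ht, smul_zero]

theorem tauber {R : ℝ} (hR : 0 < R) (c : ℕ → ℝ) (D : ℝ) 
    (hc : ∀ n, |c n| ≤ D * (ArithmeticFunction.vonMangoldt n + 1)) (F : ℂ → ℂ)
    (hF : ContinuousOn F {s | 1 ≤ s.re})
    (hs : ∀ s : ℂ, 1 < s.re → LSeriesSummable (fun n => (c n : ℂ)) s)
    (hcF : ∀ s : ℂ, 1 < s.re → LSeries (fun n => (c n : ℂ)) s = F s) :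
    Tendsto (fun T : ℝ => ∑' n : ℕ, c n * (fej R (Real.log n - T) / n)) atTop (𝓝 0) := by
  have h := riemann_lebesgue R hR (fun t => ((1 - |t| / R : ℝ) : ℂ) * F (1 - t * I))
  have h2 : Tendsto (fun T : ℝ => ((∑' n : ℕ, c n * (fej R (Real.log n - T) / n) : ℝ) : ℂ)) atTop
      (𝓝 0) := by
    refine h.congr (fun T => ?_)
    rw [fej_identity hR c D hc F hF hs hcF T]
    apply intervalIntegral.integral_congr
    intro t _
    simp only
    ring
  have h3 := (continuous_re.tendsto 0).comp h2
  simpa [Function.comp_def] using h3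

end Fact4
end part4

section part5
open Complex Filter Topology MeasureTheory Set

namespace Fact4

local notation "Λ" => ArithmeticFunction.vonMangoldt

theorem abs_sub_one_le {L : ℕ → ℝ} {D : ℝ} (hL0 : ∀ n, 0 ≤ L n) (hLD : ∀ n, L n ≤ D * Λ n) 
    (hD : 0 ≤ D) (n : ℕ) : |L n - 1| ≤ (D + 1) * (Λ n + 1) := by
  have h1 := hL0 n
  have h2 := hLD n
  have h3 : 0 ≤ Λ n := ArithmeticFunction.vonMangoldt_nonneg
  rw [abs_le]; constructor <;> nlinarith

theorem tau_of_counting (a : ℕ → ℝ) (ha : ∀ n, 0 ≤ a n) (ha1 : 0 < a 1) (κ C δ D : ℝ) (hκ : 0 < κ)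
    (hδ : 0 < δ) (hδ1 : δ < 1)
    (hS : ∀ x : ℝ, 1 ≤ x → |∑ k ∈ Finset.Icc 1 ⌊x⌋₊, a k - κ * x| ≤ C * x ^ (1 - δ))
    (L : ℕ → ℝ) (hL0 : ∀ n, 0 ≤ L n) (hD : 0 ≤ D) (hLD : ∀ n, L n ≤ D * Λ n)
    (hconv : ∀ n, a n * Real.log n = ∑ p ∈ n.divisorsAntidiagonal, L p.1 * a p.2)
    (R : ℝ) (hR : 0 < R) :
    Tendsto (fun T : ℝ => ∑' n : ℕ, (L n - 1) * (fej R (Real.log n - T) / n)) atTop (𝓝 0) := by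
  obtain ⟨F, hF, hLF⟩ := logDeriv_cont a ha ha1 κ C δ D hκ hδ hδ1 hS L hL0 hLD hconv
  have hc := abs_sub_one_le hL0 hLD hD
  refine tauber hR (fun n => L n - 1) (D + 1) hc F hF ?_ hLF
  intro s hs
  have h1 := (ArithmeticFunction.LSeriesSummable_vonMangoldt hs).norm
  have h2 := (LSeriesSummable_of_bounded_of_one_lt_re (f := fun _ => (1:ℂ)) (m := 1) (by simp) hs).norm
  refine Summable.of_norm_bounded ((h1.add h2).mul_left (D + 1)) (fun n => ?_)
  rw [LSeries.norm_term_eq, LSeries.norm_term_eq, LSeries.norm_term_eq]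
  by_cases hn : n = 0
  · simp [hn]
  · simp only [hn, if_false]
    rw [norm_real, norm_real, Real.norm_of_nonneg ArithmeticFunction.vonMangoldt_nonneg,
      Real.norm_eq_abs, norm_one, ← add_div, ← mul_div_assoc]
    have := hc n
    gcongr

theorem fej_sum_lower {R : ℝ} (hR : 2 ≤ R) :
    ∀ᶠ T in atTop, 1 / 8 ≤ ∑' n : ℕ, (fej R (Real.log n - T) / n) := by
  have hR0 : 0 < R := by linarith
  have hlim : Tendsto (fun T : ℝ => R * Real.exp (-T)) atTop (𝓝 0) := by
    have := (Real.tendsto_exp_neg_atTop_nhds_zero).const_mul R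
    simpa using this
  filter_upwards [hlim.eventually_le_const (show (0:ℝ) < 1 / 2 by norm_num), eventually_ge_atTop 1]
    with T hT hT1
  have hsum : Summable (fun n : ℕ => fej R (Real.log n - T) / n) := by
    have := summable_fej hR0 (fun _ => 1) 1 (fun n => by
      have h3 : 0 ≤ Λ n := ArithmeticFunction.vonMangoldt_nonneg
      simpa using h3) T
    simpa using this
  set s := Finset.Ioc ⌊Real.exp (T - 1 / R)⌋₊ ⌊Real.exp (T + 1 / R)⌋₊ with hs
  have h1 := hsum.sum_le_tsum s (fun n _ => div_nonneg (fej_nonneg hR0 _) (Nat.cast_nonneg n))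
  refine le_trans ?_ h1
  have h2 : ∀ n ∈ s, R / 4 / Real.exp (T + 1 / R) ≤ fej R (Real.log n - T) / n := by
    intro n hn
    rw [hs, Finset.mem_Ioc] at hn
    have hl : Real.exp (T - 1 / R) < n := (Nat.floor_lt (Real.exp_pos _).le).mp hn.1
    have hr : (n:ℝ) ≤ Real.exp (T + 1 / R) := (Nat.le_floor_iff (Real.exp_pos _).le).mp hn.2
    have hnp : (0:ℝ) < n := (Real.exp_pos _).trans hl
    have hl' : T - 1 / R < Real.log n := (Real.lt_log_iff_exp_lt hnp).mpr hl
    have hr' : Real.log n ≤ T + 1 / R := (Real.log_le_iff_le_exp hnp).mpr hr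
    have := fej_lower hR0 (u := Real.log n - T) (by rw [abs_le]; constructor <;> linarith)
    gcongr
    exact fej_nonneg hR0 _
  have h3 := Finset.card_nsmul_le_sum s _ _ h2
  refine le_trans ?_ h3
  rw [nsmul_eq_mul, hs, Nat.card_Ioc]
  have h4 : Real.exp (T + 1 / R) - Real.exp (T - 1 / R) - 1 ≤
      ((⌊Real.exp (T + 1 / R)⌋₊ - ⌊Real.exp (T - 1 / R)⌋₊ : ℕ) : ℝ) := by
    have h5 : Real.exp (T - 1 / R) ≤ Real.exp (T + 1 / R) := Real.exp_le_exp.mpr (by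
      have : 0 < 1 / R := by positivity
      linarith)
    rw [Nat.cast_sub (Nat.floor_mono h5)]
    have := Nat.lt_floor_add_one (Real.exp (T + 1 / R))
    have := Nat.floor_le (Real.exp_pos (T - 1 / R)).le
    linarith
  have hE := Real.exp_pos (T + 1 / R)
  have hR1 : 1 / R ≤ 1 / 2 := by
    rw [div_le_div_iff₀ hR0 (by norm_num)]; linarith
  have hRp : 0 < 1 / R := by positivity
  have h6 : Real.exp (T - 1 / R) = Real.exp (T + 1 / R) * Real.exp (-(2 / R)) := by
    rw [← Real.exp_add]; congr 1; ring
  have h7 : Real.exp (-(2 / R)) ≤ 1 - 1 / R := by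
    have hx0 : 0 < 2 / R := by positivity
    have hx1 : 2 / R = 2 * (1 / R) := by ring
    have hq := Real.add_one_le_exp (2 / R)
    rw [Real.exp_neg]
    have : (Real.exp (2 / R))⁻¹ ≤ (2 / R + 1)⁻¹ := by gcongr
    refine this.trans ?_
    rw [inv_le_iff_one_le_mul₀ (by positivity), hx1]
    nlinarith
  have h8 : 1 ≤ Real.exp (T + 1 / R) * Real.exp (-T) := by
    rw [← Real.exp_add]; exact Real.one_le_exp (by linarith)
  rw [mul_div_assoc', le_div_iff₀ hE]
  have h9 : 1 / R * R = 1 := by field_simp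
  have h10 : Real.exp (T + 1 / R) * (1 / R) - 1 ≤
      ((⌊Real.exp (T + 1 / R)⌋₊ - ⌊Real.exp (T - 1 / R)⌋₊ : ℕ) : ℝ) := by
    refine le_trans ?_ h4
    rw [h6]
    nlinarith
  have h11 : (Real.exp (T + 1 / R) * (1 / R) - 1) * (R / 4) ≤
      ((⌊Real.exp (T + 1 / R)⌋₊ - ⌊Real.exp (T - 1 / R)⌋₊ : ℕ) : ℝ) * (R / 4) := by gcongr
  refine le_trans ?_ h11
  have h12 : Real.exp (T + 1 / R) * (1 / R) * R = Real.exp (T + 1 / R) := by field_simp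
  nlinarith

theorem nonprime_small {R : ℝ} (hR : 0 < R) :
    Tendsto (fun T : ℝ => ∑' n : ℕ, (if n.Prime then 0 else Λ n) * (fej R (Real.log n - T) / n)) atTop
      (𝓝 0) := by
  have hs : Summable fun n : ℕ => (if n.Prime then 0 else Λ n) / n := by
    have := ArithmeticFunction.vonMangoldt.summable_residueClass_non_primes_div (q := 1) 0
    refine this.congr (fun n => ?_)
    congr 2
    simp only [ArithmeticFunction.vonMangoldt.residueClass]
    rw [Set.indicator_of_mem]
    exact Subsingleton.elim (α := ZMod 1) _ _
  have h := tendsto_tsum_of_dominated_convergence (𝓕 := atTop)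
    (f := fun (T : ℝ) (n : ℕ) => (if n.Prime then 0 else Λ n) * (fej R (Real.log n - T) / n))
    (g := fun _ => 0) (hs.mul_left R) ?_ ?_
  · simpa using h
  · intro n
    have h0 : Tendsto (fun T : ℝ => fej R (Real.log n - T)) atTop (𝓝 0) := by
      have h1 : Tendsto (fun T : ℝ => (R + 4 / R) / (1 + (Real.log n - T) ^ 2)) atTop (𝓝 0) := by
        refine Tendsto.const_div_atTop ?_ _
        refine tendsto_atTop_add_const_left _ _ ?_
        have : (fun T : ℝ => (Real.log n - T) ^ 2) = fun T => (T - Real.log n) ^ 2 := by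
          funext T; ring
        rw [this]
        exact (tendsto_pow_atTop two_ne_zero).comp (tendsto_atTop_add_const_right _ _ tendsto_id)
      exact squeeze_zero (fun T => fej_nonneg hR _) (fun T => fej_le' hR _) h1
    have := (h0.div_const (n:ℝ)).const_mul (if n.Prime then 0 else Λ n)
    simpa using this
  · refine Eventually.of_forall (fun T n => ?_)
    have h1 := fej_nonneg hR (Real.log n - T)
    have h2 := fej_le hR (Real.log n - T)
    have h3 : 0 ≤ (if n.Prime then 0 else Λ n) := by
      split_ifs
      · exact le_rfl
      · exact ArithmeticFunction.vonMangoldt_nonneg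
    rw [Real.norm_of_nonneg (by positivity)]
    calc (if n.Prime then 0 else Λ n) * (fej R (Real.log n - T) / n)
        ≤ (if n.Prime then 0 else Λ n) * (R / n) := by gcongr
      _ = _ := by ring

/-- uniform tail estimate -/
theorem tail_small : ∃ C : ℝ, 0 < C ∧ ∀ R : ℝ, 0 < R → ∀ (T : ℝ) (P : ℕ → Prop) [DecidablePred P],
    (∀ n : ℕ, 0 < n → P n → Real.log 2 / 2 ≤ |Real.log n - T|) →
    Summable (fun n : ℕ => (if P n then Λ n else 0) * (fej R (Real.log n - T) / n)) ∧
    ∑' n : ℕ, (if P n then Λ n else 0) * (fej R (Real.log n - T) / n) ≤ C / R := by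
  obtain ⟨C, hC0, hC⟩ := unif_bound
  set h := Real.log 2 / 2 with hh
  have hpos : 0 < h := by have := Real.log_pos (show (1:ℝ) < 2 by norm_num); positivity
  set M := 4 * (1 / h ^ 2 + 1) with hM
  have hM0 : 0 < M := by positivity
  refine ⟨M * C, by positivity, fun R hR T P _ hP => ?_⟩
  obtain ⟨hs, hb⟩ := hC T
  have hle : ∀ n : ℕ, (if P n then Λ n else 0) * (fej R (Real.log n - T) / n) ≤
      M / R * ((Λ n + 1) / n / (1 + (Real.log n - T) ^ 2)) := by
    intro n
    have hΛ : 0 ≤ Λ n := ArithmeticFunction.vonMangoldt_nonneg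
    split_ifs with hPn
    · rcases Nat.eq_zero_or_pos n with hn | hn
      · simp [hn]
      set u := Real.log n - T with hu
      have h1 := hP n hn hPn
      have h2 := fej_mul_sq_le hR u
      have hu2 : h ^ 2 ≤ u ^ 2 := by rw [← sq_abs u]; gcongr
      have hu0 : 0 < u ^ 2 := lt_of_lt_of_le (by positivity) hu2
      have h3 : fej R u ≤ M / R / (1 + u ^ 2) := by
        rw [le_div_iff₀ (by positivity)]
        have h4 : 1 + u ^ 2 ≤ u ^ 2 * (1 / h ^ 2 + 1) := by
          have : 1 ≤ u ^ 2 * (1 / h ^ 2) := by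
            rw [mul_one_div, one_le_div (by positivity)]; exact hu2
          linarith
        calc fej R u * (1 + u ^ 2) ≤ fej R u * (u ^ 2 * (1 / h ^ 2 + 1)) := by
              have := fej_nonneg hR u; gcongr
          _ = fej R u * u ^ 2 * (1 / h ^ 2 + 1) := by ring
          _ ≤ 4 / R * (1 / h ^ 2 + 1) := by gcongr
          _ = M / R := by rw [hM]; ring
      calc Λ n * (fej R u / n) ≤ (Λ n + 1) * (M / R / (1 + u ^ 2) / n) := by
            have := fej_nonneg hR u
            gcongr; linarith
        _ = _ := by ring
    · rw [zero_mul]; positivity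
  have hnn : ∀ n : ℕ, 0 ≤ (if P n then Λ n else 0) * (fej R (Real.log n - T) / n) := by
    intro n
    have hΛ : 0 ≤ Λ n := ArithmeticFunction.vonMangoldt_nonneg
    have := fej_nonneg hR (Real.log n - T)
    split_ifs <;> positivity
  have hsum := Summable.of_nonneg_of_le hnn hle (hs.mul_left (M / R))
  refine ⟨hsum, (hsum.tsum_le_tsum hle (hs.mul_left (M / R))).trans ?_⟩
  rw [tsum_mul_left]
  calc M / R * _ ≤ M / R * C := by gcongr
    _ = _ := by ring

end Fact4
end part5

section part6
open Complex Filter Topology MeasureTheory Set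

namespace Fact4

local notation "Λ" => ArithmeticFunction.vonMangoldt

theorem tau_vonMangoldt (R : ℝ) (hR : 0 < R) :
    Tendsto (fun T : ℝ => ∑' n : ℕ, (Λ n - 1) * (fej R (Real.log n - T) / n)) atTop (𝓝 0) := by
  refine tau_of_counting (fun _ => 1) (fun _ => zero_le_one) one_pos 1 1 (1/2) 1 one_pos
    (by norm_num) (by norm_num) ?_ (fun n => Λ n) (fun _ => ArithmeticFunction.vonMangoldt_nonneg)
    zero_le_one (fun n => by rw [one_mul]) ?_ R hR
  · intro x hx
    have h1 := Nat.floor_le (zero_le_one.trans hx)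
    have h2 := Nat.lt_floor_add_one x
    have h3 : (1:ℝ) ≤ x ^ (1 - 1 / 2 : ℝ) := Real.one_le_rpow hx (by norm_num)
    simp only [Finset.sum_const, Nat.card_Icc, Nat.add_sub_cancel, nsmul_eq_mul, mul_one, one_mul]
    rw [abs_le]; constructor <;> linarith
  · intro n
    rw [one_mul, ← ArithmeticFunction.vonMangoldt_sum]
    simp only [mul_one]
    rw [Nat.sum_divisorsAntidiagonal (fun d _ => Λ d)]

theorem window (L L' : ℕ → ℝ) (D : ℝ) (hD : 0 ≤ D) (hL0 : ∀ n, 0 ≤ L n) (hLD : ∀ n, L n ≤ D * Λ n)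
    (hL0' : ∀ n, 0 ≤ L' n) (hLD' : ∀ n, L' n ≤ D * Λ n)
    (hL : ∀ R : ℝ, 0 < R →
      Tendsto (fun T : ℝ => ∑' n : ℕ, (L n - 1) * (fej R (Real.log n - T) / n)) atTop (𝓝 0))
    (hL' : ∀ R : ℝ, 0 < R →
      Tendsto (fun T : ℝ => ∑' n : ℕ, (L' n - 1) * (fej R (Real.log n - T) / n)) atTop (𝓝 0))
    (P0 : ℕ) (hP : ∀ p : ℕ, p.Prime → P0 ≤ p → L p ≠ 0 → L' p ≤ D * (L p - Real.log p)) :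
    ∃ N0 : ℕ, ∀ N : ℕ, N0 ≤ N → ∃ p : ℕ, p.Prime ∧ N < 2 * p ∧ p ≤ N ∧ L p = 0 := by
  classical
  obtain ⟨C, hC0, hC⟩ := tail_small
  obtain ⟨R, hR2, hRC⟩ : ∃ R : ℝ, 2 ≤ R ∧ 2 * D * (C / R) ≤ 1 / 64 := by
    refine ⟨max 2 (128 * D * C), le_max_left _ _, ?_⟩
    have hm : 0 < max 2 (128 * D * C) := lt_of_lt_of_le (by norm_num) (le_max_left _ _)
    rw [mul_div_assoc', div_le_iff₀ hm]
    have := le_max_right 2 (128 * D * C)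
    linarith
  have hR : 0 < R := by linarith
  set W : ℝ → ℕ → ℝ := fun T n => fej R (Real.log n - T) / n with hW
  have hW0 : ∀ T n, 0 ≤ W T n := fun T n => div_nonneg (fej_nonneg hR _) (Nat.cast_nonneg _)
  have hΛ0 : ∀ n, 0 ≤ Λ n := fun _ => ArithmeticFunction.vonMangoldt_nonneg
  have hsm : ∀ (c : ℕ → ℝ) (E : ℝ), (∀ n, |c n| ≤ E * (Λ n + 1)) → ∀ T,
      Summable (fun n => c n * W T n) := by
    intro c E hc T
    have := summable_fej hR c E hc T
    refine Summable.of_norm_bounded this (fun n => ?_)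
    rw [norm_mul, Real.norm_eq_abs, Real.norm_of_nonneg (hW0 T n)]
  have hone : ∀ T, Summable (fun n => W T n) := by
    intro T
    simpa using hsm (fun _ => 1) 1 (fun n => by simp) T
  have hbd : ∀ (M : ℕ → ℝ), (∀ n, 0 ≤ M n) → (∀ n, M n ≤ D * Λ n) → ∀ T,
      Summable (fun n => M n * W T n) := by
    intro M h0 hM T
    refine hsm M D (fun n => ?_) T
    rw [abs_of_nonneg (h0 n)]
    have := hM n
    nlinarith
  have hsL := hbd L hL0 hLD
  have hsL' := hbd L' hL0' hLD'
  have hsΛ : ∀ T, Summable (fun n => Λ n * W T n) := fun T => hsm (fun n => Λ n) 1 (fun n => by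
    rw [abs_of_nonneg (hΛ0 n)]; linarith) T
  have hsN : ∀ T, Summable (fun n : ℕ => (if n.Prime then 0 else Λ n) * W T n) := fun T =>
    hsm (fun n => if n.Prime then 0 else Λ n) 1 (fun n => by
      have := hΛ0 n
      split_ifs
      · simp; linarith
      · rw [abs_of_nonneg this]; linarith) T
  set η : ℝ := 1 / (64 * (D + 1)) with hη
  have hηp : 0 < η := by positivity
  have hηD : (D + 1) * η = 1 / 64 := by rw [hη]; field_simp
  -- eventually facts in T
  have hev : ∀ᶠ T in atTop, (1 / 8 ≤ ∑' n, W T n) ∧ |∑' n : ℕ, (L n - 1) * W T n| < η ∧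
      |∑' n : ℕ, (L' n - 1) * W T n| < η ∧ |∑' n : ℕ, (Λ n - 1) * W T n| < η ∧
      |∑' n : ℕ, (if n.Prime then 0 else Λ n) * W T n| < η := by
    have key : ∀ g : ℝ → ℝ, Tendsto g atTop (𝓝 0) → ∀ᶠ T in atTop, |g T| < η := by
      intro g hg
      have := hg.eventually (Metric.ball_mem_nhds 0 hηp)
      filter_upwards [this] with T hT
      simpa using hT
    filter_upwards [fej_sum_lower hR2, key _ (hL R hR), key _ (hL' R hR),
      key _ (tau_vonMangoldt R hR), key _ (nonprime_small hR)] with T h1 h2 h3 h4 h5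
    exact ⟨h1, h2, h3, h4, h5⟩
  have hT : Tendsto (fun N : ℕ => Real.log N - Real.log 2 / 2) atTop atTop :=
    tendsto_atTop_add_const_right _ _ (Real.tendsto_log_atTop.comp tendsto_natCast_atTop_atTop)
  obtain ⟨N1, hN1⟩ := eventually_atTop.mp (hT.eventually hev)
  refine ⟨max N1 (2 * P0 + 1), fun N hN => ?_⟩
  by_contra hcon
  push Not at hcon
  have hNP : 2 * P0 + 1 ≤ N := le_trans (le_max_right _ _) hN
  obtain ⟨e1, e2, e3, e4, e5⟩ := hN1 N (le_trans (le_max_left _ _) hN)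
  set T := Real.log N - Real.log 2 / 2 with hTdef
  obtain ⟨ht1, ht2⟩ := hC R hR T (fun n => ¬ (N < 2 * n ∧ n ≤ N)) (by
    intro n hn hPn
    have hl2 := Real.log_pos (show (1:ℝ) < 2 by norm_num)
    have hnp : (0:ℝ) < n := by exact_mod_cast hn
    have hNp : (0:ℝ) < N := by
      have : 0 < N := by omega
      exact_mod_cast this
    by_cases h : n ≤ N
    · have h2 : 2 * n ≤ N := by
        by_contra h3; exact hPn ⟨by omega, h⟩
      have h3 : Real.log (2 * n) ≤ Real.log N := Real.log_le_log (by positivity) (by exact_mod_cast h2)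
      rw [Real.log_mul (by norm_num) hnp.ne'] at h3
      rw [abs_of_nonpos] <;> linarith
    · have h3 : Real.log N ≤ Real.log n := Real.log_le_log hNp (by
        have : N ≤ n := by omega
        exact_mod_cast this)
      rw [abs_of_nonneg] <;> linarith)
  have hpt : ∀ n : ℕ, L' n * W T n ≤ D * (L n * W T n - Λ n * W T n) +
      (2 * D * ((if ¬ (N < 2 * n ∧ n ≤ N) then Λ n else 0) * W T n) +
       2 * D * ((if n.Prime then 0 else Λ n) * W T n)) := by
    intro n
    have hw := hW0 T n
    have h0 := hΛ0 n
    have hl := hL0 n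
    have hl' := hLD' n
    suffices h : L' n ≤ D * (L n - Λ n) + (2 * D * (if ¬ (N < 2 * n ∧ n ≤ N) then Λ n else 0) +
       2 * D * (if n.Prime then 0 else Λ n)) by
      have := mul_le_mul_of_nonneg_right h hw
      linarith
    have hDL : 0 ≤ D * L n := by positivity
    have hDΛ : 0 ≤ D * Λ n := by positivity
    by_cases hp : n.Prime
    · by_cases hI : N < 2 * n ∧ n ≤ N
      · have h1 := hP n hp (by omega) (hcon n hp hI.1 hI.2)
        rw [← ArithmeticFunction.vonMangoldt_apply_prime hp] at h1
        simp only [hp, hI, if_true, not_true_eq_false, if_false, and_self]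
        linarith
      · simp only [hp, hI, if_true, not_false_eq_true]
        linarith
    · simp only [hp, if_false]
      have : 0 ≤ 2 * D * (if ¬ (N < 2 * n ∧ n ≤ N) then Λ n else 0) := by
        split_ifs <;> positivity
      linarith
  have hsumR : Summable (fun n : ℕ => D * (L n * W T n - Λ n * W T n) +
      (2 * D * ((if ¬ (N < 2 * n ∧ n ≤ N) then Λ n else 0) * W T n) +
       2 * D * ((if n.Prime then 0 else Λ n) * W T n))) :=
    (((hsL T).sub (hsΛ T)).mul_left D).add ((ht1.mul_left _).add ((hsN T).mul_left _))
  have hle := (hsL' T).tsum_le_tsum hpt hsumR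
  rw [Summable.tsum_add (((hsL T).sub (hsΛ T)).mul_left D) ((ht1.mul_left _).add ((hsN T).mul_left _)),
    Summable.tsum_add (ht1.mul_left _) ((hsN T).mul_left _), tsum_mul_left, tsum_mul_left,
    tsum_mul_left, Summable.tsum_sub (hsL T) (hsΛ T)] at hle
  have hsub : ∀ M : ℕ → ℝ, Summable (fun n => M n * W T n) →
      ∑' n, (M n - 1) * W T n = ∑' n, M n * W T n - ∑' n, W T n := by
    intro M hM
    rw [← Summable.tsum_sub hM (hone T)]
    congr 1; funext n; ring
  rw [hsub L (hsL T)] at e2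
  rw [hsub L' (hsL' T)] at e3
  rw [hsub (fun n => Λ n) (hsΛ T)] at e4
  rw [abs_lt] at e2 e3 e4 e5
  have h1 : D * (∑' n, L n * W T n - ∑' n, Λ n * W T n) ≤ D * (2 * η) := by
    gcongr; linarith
  have h2 : 2 * D * ∑' n : ℕ, (if n.Prime then 0 else Λ n) * W T n ≤ 2 * D * η := by
    gcongr; linarith
  have h3 : 2 * D * ∑' n : ℕ, (if ¬ (N < 2 * n ∧ n ≤ N) then Λ n else 0) * W T n ≤ 2 * D * (C / R) := by
    gcongr
  nlinarith

end Fact4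
end part6

section part7
namespace Fact4
section lat
open NumberField NumberField.InfinitePlace NumberField.mixedEmbedding NumberField.Units NumberField.Units.dirichletUnitTheorem Module MeasureTheory ENNReal
open NumberField.mixedEmbedding.fundamentalCone
open scoped Real NNReal
variable (K : Type*) [Field K] [NumberField K]

open scoped Classical in
noncomputable def pbox (a : ℝ) : Set (realSpace K) :=
  Set.univ.pi fun w ↦ if w = w₀ then Set.Iic a else Set.Ico (-a) (1 + a)

noncomputable def dset (a : ℝ) : Set (mixedSpace K) :=
  normAtAllPlaces ⁻¹' (expMapBasis '' pbox K a)

theorem dset_zero : dset K 0 = normLeOne K := by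
  rw [normLeOne_eq_preimage, dset, pbox]
  congr! 4
  simp

theorem measurableSet_pbox (a : ℝ) : MeasurableSet (pbox K a) := by
  refine MeasurableSet.univ_pi fun _ ↦ ?_
  split_ifs
  · exact measurableSet_Iic
  · exact measurableSet_Ico

theorem lint_pbox (a : ℝ) (ha : -(1/4) ≤ a) {n : ℕ} (hn : 0 < n) :
    ∫⁻ (x : realSpace K) in pbox K a, .ofReal (Real.exp (x w₀ * n)) =
      (n : ℝ≥0∞)⁻¹ * ENNReal.ofReal (Real.exp (n * a) * (1 + 2 * a) ^ (Fintype.card (InfinitePlace K) - 1)) := by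
  classical
  have hn : 0 < (n : ℝ) := Nat.cast_pos.mpr hn
  rw [volume_pi, pbox, Measure.restrict_pi_pi, lintegral_eq_lmarginal_univ 0,
    lmarginal_erase' _ (by fun_prop) (Finset.mem_univ w₀), if_pos rfl]
  simp_rw [Function.update_self, lmarginal, lintegral_const, Measure.pi_univ, if_neg
    (Finset.ne_of_mem_erase (Subtype.prop _)), Measure.restrict_apply_univ, Real.volume_Ico,
     mul_comm _ (n : ℝ)]
  rw [← ofReal_integral_eq_lintegral_ofReal (integrableOn_exp_mul_Iic hn _), integral_exp_mul_Iic
    hn,  ofReal_div_of_pos hn, ofReal_natCast]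
  · rw [Finset.prod_const, Finset.card_univ, Fintype.card_coe, Finset.card_erase_of_mem (Finset.mem_univ _),
      Finset.card_univ, ENNReal.ofReal_mul (Real.exp_nonneg _), ENNReal.ofReal_pow (by linarith),
      show 1 + a - -a = 1 + 2 * a by ring, ENNReal.div_eq_inv_mul, mul_assoc]
  filter_upwards with _ using Real.exp_nonneg _

theorem measurableSet_dset (a : ℝ) : MeasurableSet (dset K a) := by
  refine MeasurableSet.preimage ?_ (continuous_normAtAllPlaces K).measurable
  exact MeasurableSet.image_of_continuousOn_injOn (measurableSet_pbox K a)
    (continuous_expMapBasis K).continuousOn (injective_expMapBasis K).injOn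

open scoped Classical in
theorem volume_dset (a : ℝ) (ha : -(1/4) ≤ a) : volume (dset K a) =
    volume (normLeOne K) * ENNReal.ofReal (Real.exp (finrank ℚ K * a) * (1 + 2 * a) ^ (Fintype.card (InfinitePlace K) - 1)) := by
  have key : ∀ a : ℝ, -(1/4) ≤ a → volume (dset K a) = volume (normLeOne K) * ENNReal.ofReal (Real.exp (finrank ℚ K * a) * (1 + 2 * a) ^ (Fintype.card (InfinitePlace K) - 1)) := by
    intro a ha
    rw [volume_normLeOne, volume_eq_two_pow_mul_two_pi_pow_mul_integral (A := dset K a) Set.preimage_image_preimage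
      (measurableSet_dset K a), dset,
      normAtAllPlaces_image_preimage_expMapBasis,
      setLIntegral_expMapBasis_image (measurableSet_pbox K a) (by fun_prop)]
    simp_rw [ENNReal.inv_mul_cancel_right
      (Finset.prod_ne_zero_iff.mpr fun _ _ ↦ ofReal_ne_zero_iff.mpr (expMapBasis_pos _ _))
      (prod_ne_top fun _ _ ↦ ofReal_ne_top)]
    rw [lint_pbox K a ha Module.finrank_pos, ofReal_mul zero_le_two, mul_pow,
      ofReal_ofNat, ← mul_assoc, ← mul_assoc]
    congr 1
    rw [mul_assoc _ _ (_⁻¹), ENNReal.mul_inv_cancel_right (Nat.cast_ne_zero.mpr Module.finrank_pos.ne')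
      (natCast_ne_top _), coe_nnreal_eq, NNReal.coe_real_pi, mul_mul_mul_comm, ← ENNReal.inv_pow,
      ← mul_assoc, ← mul_assoc, ENNReal.inv_mul_cancel_right (pow_ne_zero _ two_ne_zero)
      (pow_ne_top ENNReal.ofNat_ne_top)]
  exact key a ha

open scoped Classical in
theorem volume_dset_le : ∃ C : ℝ, 0 ≤ C ∧ ∀ a : ℝ, -(1/4) ≤ a → a ≤ 1/4 →
    |(volume (dset K a)).toReal - (volume (normLeOne K)).toReal| ≤ C * |a| := by
  set g : ℝ → ℝ := fun a => (volume (normLeOne K)).toReal * (Real.exp (finrank ℚ K * a) * (1 + 2 * a) ^ (Fintype.card (InfinitePlace K) - 1)) with hg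
  have hC : ContDiffOn ℝ 1 g (Set.Icc (-(1/4)) (1/4)) := by
    apply ContDiff.contDiffOn; fun_prop
  obtain ⟨C, hC⟩ := hC.exists_lipschitzOnWith one_ne_zero (convex_Icc _ _) isCompact_Icc
  refine ⟨C, C.2, fun a h1 h2 => ?_⟩
  have := hC.dist_le_mul a ⟨h1, h2⟩ 0 ⟨by norm_num, by norm_num⟩
  rw [Real.dist_eq, Real.dist_eq, sub_zero] at this
  have h0 : 0 ≤ (Real.exp (finrank ℚ K * a) * (1 + 2 * a) ^ (Fintype.card (InfinitePlace K) - 1)) :=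
    mul_nonneg (Real.exp_nonneg _) (pow_nonneg (by linarith) _)
  rw [volume_dset K a h1, ENNReal.toReal_mul, ENNReal.toReal_ofReal h0]
  simpa [hg] using this
end lat
end Fact4
end part7

section part8
namespace Fact4
section lat
open NumberField NumberField.InfinitePlace NumberField.mixedEmbedding NumberField.Units NumberField.Units.dirichletUnitTheorem Module MeasureTheory ENNReal
open NumberField.mixedEmbedding.fundamentalCone
open scoped Real NNReal Classical

theorem log_sub_aux {q u u' : ℝ} (hq : 0 < q) (hu : q ≤ u) (hu' : q ≤ u') (h : |u - u'| ≤ q ^ 2) :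
    Real.log u - Real.log u' ≤ q := by
  have h1 : 0 < u := hq.trans_le hu
  have h2 : 0 < u' := hq.trans_le hu'
  rw [← Real.log_div h1.ne' h2.ne']
  refine (Real.log_le_sub_one_of_pos (div_pos h1 h2)).trans ?_
  rw [div_sub_one h2.ne', div_le_iff₀ h2]
  have := le_abs_self (u - u')
  nlinarith

variable (K : Type*) [Field K] [NumberField K]

theorem normAtPlace_le_norm (w : InfinitePlace K) (v : mixedSpace K) : normAtPlace w v ≤ ‖v‖ := by
  rw [norm_eq_sup'_normAtPlace]
  exact Finset.le_sup' (fun w => normAtPlace w v) (Finset.mem_univ w)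

theorem exists_norm_eq (v : mixedSpace K) : ∃ w : InfinitePlace K, ‖v‖ = normAtPlace w v := by
  rw [norm_eq_sup'_normAtPlace]
  obtain ⟨w, _, h⟩ := Finset.exists_mem_eq_sup' (s := (Finset.univ : Finset (InfinitePlace K))) Finset.univ_nonempty (fun w => normAtPlace w v)
  exact ⟨w, h⟩

theorem abs_normAtPlace_sub (w : InfinitePlace K) (v v' : mixedSpace K) :
    |normAtPlace w v - normAtPlace w v'| ≤ ‖v - v'‖ := by
  have h1 := normAtPlace_add_le w (v - v') v'
  have h2 := normAtPlace_add_le w (-(v - v')) v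
  rw [normAtPlace_neg] at h2
  have h3 := normAtPlace_le_norm K w (v - v')
  rw [sub_add_cancel] at h1
  rw [show -(v - v') + v = v' by abel] at h2
  rw [abs_le]; constructor <;> linarith


theorem box_bounds : ∃ m M : ℝ, 0 < m ∧ 0 < M ∧ ∀ x : realSpace K, (∀ i, i ≠ w₀ → x i ∈ Set.Icc (-1) 2) →
    ∀ w, m * Real.exp (x w₀) ≤ expMapBasis x w ∧ expMapBasis x w ≤ M * Real.exp (x w₀) := by
  set S : Set (realSpace K) := Set.univ.pi fun w ↦ if w = w₀ then {0} else Set.Icc (-1) 2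
  have hS : IsCompact S := by
    refine isCompact_univ_pi fun w ↦ ?_
    split_ifs
    · exact isCompact_singleton
    · exact isCompact_Icc
  have hc : ∀ w, Continuous (fun x : realSpace K => expMapBasis x w) := fun w =>
    (continuous_apply w).comp (continuous_expMapBasis K)
  have hSne : S.Nonempty := by
    refine Set.univ_pi_nonempty_iff.mpr fun w => ?_
    split_ifs <;> norm_num
  have h1 : ∀ w, ∃ m > 0, ∀ x ∈ S, m ≤ expMapBasis x w := by
    intro w
    obtain ⟨x, hx, h⟩ := hS.exists_isMinOn hSne (hc w).continuousOn
    exact ⟨_, expMapBasis_pos x w, fun y hy => h hy⟩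
  have h2 : ∀ w, ∃ M > 0, ∀ x ∈ S, expMapBasis x w ≤ M := by
    intro w
    obtain ⟨x, hx, h⟩ := hS.exists_isMaxOn hSne (hc w).continuousOn
    exact ⟨_, expMapBasis_pos x w, fun y hy => h hy⟩
  choose m hm hm' using h1
  choose M hM hM' using h2
  have hw : (Finset.univ : Finset (InfinitePlace K)).Nonempty := Finset.univ_nonempty
  refine ⟨Finset.univ.inf' hw m, Finset.univ.sup' hw M, ?_, ?_, fun x hx w => ?_⟩
  · rw [Finset.lt_inf'_iff]; exact fun w _ => hm w
  · rw [Finset.lt_sup'_iff]; exact ⟨w₀, Finset.mem_univ _, hM _⟩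
  have hmem : (fun i ↦ if i = w₀ then 0 else x i) ∈ S := by
    intro i _
    dsimp only
    split_ifs with h
    · simp
    · exact hx i h
  rw [expMapBasis_apply'' x]
  simp only [Pi.smul_apply, smul_eq_mul]
  have e := Real.exp_pos (x w₀)
  constructor
  · rw [mul_comm]
    gcongr
    exact (Finset.inf'_le _ (Finset.mem_univ w)).trans (hm' w _ hmem)
  · rw [mul_comm]
    gcongr
    exact (hM' w _ hmem).trans (Finset.le_sup' _ (Finset.mem_univ w))

theorem pert : ∃ c : ℝ, 1 ≤ c ∧ ∀ q a : ℝ, 0 < q → q ≤ 1 → -(1/4) ≤ a → a ≤ 1/4 → ∀ v v' : mixedSpace K,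
    v ∈ dset K a → ‖v - v'‖ ≤ q ^ 2 → c * q < ‖v'‖ → v' ∈ dset K (a + c * q) := by

  obtain ⟨m, M, hm, hM, hmM⟩ := box_bounds K
  set B := ‖((completeBasis K).equivFunL : realSpace K →L[ℝ] realSpace K)‖ with hB
  have hB0 : 0 ≤ B := norm_nonneg _
  refine ⟨1 + 2 * (M / m) + 2 * B, ?_, ?_⟩
  · have := div_pos hM hm; nlinarith
  intro q a hq hq1 ha ha' v v' hv hvv hv'
  have hMm := div_pos hM hm
  set c := 1 + 2 * (M / m) + 2 * B
  obtain ⟨x, hx, hxv⟩ := hv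
  have hxv' : ∀ w, expMapBasis x w = normAtPlace w v := fun w => by rw [hxv, normAtAllPlaces_apply]
  have hbox := hmM x (fun i hi => by
    have := hx i (Set.mem_univ _)
    simp only [if_neg hi] at this
    exact ⟨by linarith [this.1], by linarith [this.2]⟩)
  have hvn : 2 * (M / m) * q ≤ ‖v‖ := by
    have h1 : ‖v'‖ ≤ ‖v‖ + ‖v - v'‖ := by
      have := norm_sub_le v (v - v')
      simpa using this
    have : q ^ 2 ≤ q := by nlinarith
    have : 0 ≤ B * q := by positivity
    have h2 : c * q = q + 2 * (M/m) * q + 2 * (B * q) := by simp only [c]; ring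
    linarith
  have hlow : ∀ w, 2 * q ≤ normAtPlace w v := by
    intro w
    obtain ⟨w', hw'⟩ := exists_norm_eq K v
    have h1 := (hbox w).1
    have h2 := (hbox w').2
    rw [hxv'] at h1 h2
    rw [← hw'] at h2
    have h3 : m / M * (2 * (M / m) * q) ≤ m / M * ‖v‖ := by gcongr
    have h4 : m / M * (2 * (M / m) * q) = 2 * q := by field_simp
    have h5 : m / M * ‖v‖ ≤ m / M * (M * Real.exp (x w₀)) := by gcongr
    have h6 : m / M * (M * Real.exp (x w₀)) = m * Real.exp (x w₀) := by field_simp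
    linarith
  have hlow' : ∀ w, q ≤ normAtPlace w v' := by
    intro w
    have := abs_le.mp (abs_normAtPlace_sub K w v v')
    have := hlow w
    have : q ^ 2 ≤ q := by nlinarith
    linarith
  have htar : normAtAllPlaces v' ∈ (expMapBasis (K := K)).target := by
    refine Set.mem_univ_pi.mpr fun w => ?_
    rw [normAtAllPlaces_apply]
    exact hq.trans_le (hlow' w)
  have hlog : ∀ w, |Real.log (normAtPlace w v') - Real.log (normAtPlace w v)| ≤ q := by
    intro w
    have h0 : q ≤ normAtPlace w v := by linarith [hlow w]
    have h := (abs_normAtPlace_sub K w v v').trans hvv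
    rw [abs_le]
    have h1 := log_sub_aux hq h0 (hlow' w) h
    have h2 := log_sub_aux hq (hlow' w) h0 (by rwa [abs_sub_comm])
    constructor <;> linarith
  set x' := expMapBasis.symm (normAtAllPlaces v') with hx'
  have hxx' : expMapBasis x' = normAtAllPlaces v' := expMapBasis.right_inv htar
  have e1 : x = (completeBasis K).equivFunL (expMap.symm (normAtAllPlaces v)) := by
    rw [← hxv, expMapBasis_apply, expMap.left_inv (by simp [expMap_source])]
    exact ((completeBasis K).equivFun.apply_symm_apply x).symm
  have e2 : x' = (completeBasis K).equivFunL (expMap.symm (normAtAllPlaces v')) := rfl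
  have hd : ‖x' - x‖ ≤ B * (2 * q) := by
    rw [e1, e2, ← map_sub]
    refine (ContinuousLinearMap.le_opNorm ((completeBasis K).equivFunL : realSpace K →L[ℝ] realSpace K) _).trans ?_
    gcongr
    refine (pi_norm_le_iff_of_nonneg (by positivity)).mpr fun w => ?_
    rw [Pi.sub_apply, expMap_symm_apply, expMap_symm_apply, ← mul_sub, norm_mul, normAtAllPlaces_apply, normAtAllPlaces_apply]
    have := hlog w
    rw [Real.norm_eq_abs, Real.norm_eq_abs]
    gcongr
    rw [Nat.abs_cast]
    rcases isReal_or_isComplex w with h | h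
    · rw [mult_isReal ⟨w, h⟩]; norm_num
    · rw [mult_isComplex ⟨w, h⟩]; norm_num
  have hd' : ∀ w, |x' w - x w| ≤ c * q := by
    intro w
    have := (norm_le_pi_norm (x' - x) w).trans hd
    rw [Pi.sub_apply, Real.norm_eq_abs] at this
    have : 0 ≤ (M / m) * q := by positivity
    have h2 : c * q = q + 2 * ((M/m) * q) + B * (2 * q) := by simp only [c]; ring
    linarith
  refine ⟨x', fun w _ => ?_, hxx'⟩
  have h := hx w (Set.mem_univ _)
  have h' := abs_le.mp (hd' w)
  dsimp only at h ⊢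
  split_ifs at h ⊢ with hw
  · simp only [Set.mem_Iic] at h ⊢; linarith
  · simp only [Set.mem_Ico] at h ⊢; constructor <;> linarith [h.1, h.2]
end lat
end Fact4
end part8

section part9
namespace Fact4
section lat2
open Module MeasureTheory Submodule
open scoped Pointwise
variable {E ι : Type*} [NormedAddCommGroup E] [NormedSpace ℝ E] [Fintype ι] (b : Basis ι ℝ E)
  [MeasurableSpace E] [BorelSpace E] (μ : Measure E) [μ.IsAddHaarMeasure]

theorem lat_upper (S : Finset E) (hS : ∀ v ∈ S, v ∈ span ℤ (Set.range b)) (T : Set E)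
    (h : ∀ v ∈ S, ∀ f ∈ ZSpan.fundamentalDomain b, v + f ∈ T) :
    S.card * μ (ZSpan.fundamentalDomain b) ≤ μ T := by
  have h1 : ∑ v ∈ S, μ (v +ᵥ ZSpan.fundamentalDomain b) = S.card * μ (ZSpan.fundamentalDomain b) := by
    simp [measure_vadd]
  rw [← h1, ← measure_biUnion_finset]
  · refine measure_mono ?_
    intro x hx
    simp only [Set.mem_iUnion] at hx
    obtain ⟨v, hv, f, hf, rfl⟩ := hx
    exact h v hv f hf
  · intro v hv w hw hvw
    refine Set.disjoint_left.mpr ?_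
    rintro x ⟨f, hf, rfl⟩ ⟨g, hg, hfg⟩
    apply hvw
    simp only [vadd_eq_add] at hfg
    have h2 : ZSpan.fract b (v + f) = f := by
      rw [ZSpan.fract_zSpan_add b f (hS v hv), ZSpan.fract_eq_self.mpr hf]
    have h3 : ZSpan.fract b (w + g) = g := by
      rw [ZSpan.fract_zSpan_add b g (hS w hw), ZSpan.fract_eq_self.mpr hg]
    rw [← hfg, h3] at h2
    rw [h2] at hfg
    exact (add_right_cancel hfg).symm
  · intro v _
    exact (ZSpan.fundamentalDomain_measurableSet b).const_vadd v

theorem lat_lower (S : Finset E) (T : Set E)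
    (h : ∀ u ∈ T, ∃ v ∈ S, u - v ∈ ZSpan.fundamentalDomain b) :
    μ T ≤ S.card * μ (ZSpan.fundamentalDomain b) := by
  have h1 : ∑ v ∈ S, μ (v +ᵥ ZSpan.fundamentalDomain b) = S.card * μ (ZSpan.fundamentalDomain b) := by
    simp [measure_vadd]
  rw [← h1]
  refine le_trans (measure_mono ?_) (measure_biUnion_finset_le S _)
  intro u hu
  obtain ⟨v, hv, hf⟩ := h u hu
  simp only [Set.mem_iUnion]
  exact ⟨v, hv, u - v, hf, by simp⟩

theorem lat_count (n : ℕ) (hn : 0 < n) (hnE : finrank ℝ E = n) (D : ℝ → Set E)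
    (hDm : ∀ a, MeasurableSet (D a))
    (V CV : ℝ) (hV : 0 ≤ V) (hCV : 0 ≤ CV)
    (hfin : ∀ a, -(1/4) ≤ a → a ≤ 1/4 → μ (D a) ≠ ⊤)
    (hvol : ∀ a, -(1/4) ≤ a → a ≤ 1/4 → |(μ (D a)).toReal - V| ≤ CV * |a|)
    (c : ℝ) (hc : 1 ≤ c)
    (hp : ∀ q a : ℝ, 0 < q → q ≤ 1 → -(1/4) ≤ a → a ≤ 1/4 → ∀ v v' : E,
      v ∈ D a → ‖v - v'‖ ≤ q ^ 2 → c * q < ‖v'‖ → v' ∈ D (a + c * q))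
    (hb : Bornology.IsBounded (D 0)) :
    ∃ C t0 : ℝ, 0 ≤ C ∧ 1 ≤ t0 ∧ ∀ t : ℝ, t0 ≤ t →
      |(Nat.card {v : E // v ∈ span ℤ (Set.range b) ∧ t⁻¹ • v ∈ D 0} : ℝ) -
        V / (μ (ZSpan.fundamentalDomain b)).toReal * t ^ n| ≤ C * (t ^ n / √t) := by
  have : FiniteDimensional ℝ E := Module.Finite.of_basis b
  set F := ZSpan.fundamentalDomain b with hF
  have hFb : Bornology.IsBounded F := ZSpan.fundamentalDomain_isBounded b
  have hF0 : μ F ≠ 0 := ZSpan.measure_fundamentalDomain_ne_zero b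
  have hFt : μ F ≠ ⊤ := hFb.measure_lt_top.ne
  set m := (μ F).toReal with hm
  have hmpos : 0 < m := ENNReal.toReal_pos hF0 hFt
  obtain ⟨ρ, hρ1, hρ⟩ : ∃ ρ : ℝ, 1 ≤ ρ ∧ ∀ f ∈ F, ‖f‖ ≤ ρ := by
    obtain ⟨R, hR⟩ := hFb.exists_norm_le
    exact ⟨max 1 R, le_max_left _ _, fun f hf => (hR f hf).trans (le_max_right _ _)⟩
  set β := (μ (Metric.closedBall (0 : E) 1)).toReal with hβ
  have hβ0 : 0 ≤ β := ENNReal.toReal_nonneg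
  refine ⟨(CV * c + 2 * c * β) * √ρ / m, ρ * (8 * c) ^ 2, by positivity, by nlinarith, fun t ht => ?_⟩
  have ht0 : 0 < t := lt_of_lt_of_le (by nlinarith) ht
  set q := √(ρ / t) with hq
  have hqpos : 0 < q := Real.sqrt_pos.mpr (by positivity)
  have hq2 : q ^ 2 = ρ / t := Real.sq_sqrt (by positivity)
  have hcq : 2 * c * q ≤ 1 / 4 := by
    have : (8 * c * q) ^ 2 ≤ 1 := by
      rw [mul_pow, hq2]
      rw [mul_div_assoc', div_le_one ht0]; linarith
    have h3 : 0 ≤ 8 * c * q := by positivity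
    nlinarith
  have hq1 : q ≤ 1 := by nlinarith
  have hSfin : {v : E | v ∈ span ℤ (Set.range b) ∧ t⁻¹ • v ∈ D 0}.Finite := by
    have h1 : Bornology.IsBounded (t • D 0) := hb.smul₀ t
    refine (ZSpan.setFinite_inter b h1).subset ?_
    rintro v ⟨hv, hv'⟩
    refine ⟨?_, hv⟩
    rwa [Set.mem_smul_set_iff_inv_smul_mem₀ ht0.ne']
  set S := hSfin.toFinset with hS
  have hcard : Nat.card {v : E // v ∈ span ℤ (Set.range b) ∧ t⁻¹ • v ∈ D 0} = S.card := by
    rw [hS, ← Set.ncard_eq_toFinset_card _ hSfin]; rfl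
  rw [hcard]
  have hball : ∀ r : ℝ, 0 ≤ r → r ≤ 1 → (μ (Metric.closedBall (0 : E) r)) ≠ ⊤ ∧ (μ (Metric.closedBall (0 : E) r)).toReal ≤ r * β := by
    intro r hr hr1
    refine ⟨Metric.isBounded_closedBall.measure_lt_top.ne, ?_⟩
    rw [Measure.addHaar_closedBall' μ 0 hr, ENNReal.toReal_mul, ENNReal.toReal_ofReal (by positivity), hnE]
    gcongr
    exact pow_le_of_le_one hr hr1 hn.ne'
  have hsm : ∀ A : Set E, (μ (t • A)) = ENNReal.ofReal (t ^ n) * μ A := by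
    intro A
    rw [Measure.addHaar_smul, hnE, abs_of_pos (by positivity)]
  -- upper bound
  have hup : S.card * m ≤ t ^ n * (V + (CV * c + 2 * c * β) * q) := by
    have h1 := lat_upper b μ S (fun v hv => by simp [hS] at hv; exact hv.1)
      (t • (D (0 + c * q) ∪ Metric.closedBall 0 (c * q))) (by
        intro v hv f hf
        rw [Set.mem_smul_set_iff_inv_smul_mem₀ ht0.ne']
        by_cases hh : t⁻¹ • (v + f) ∈ Metric.closedBall (0 : E) (c * q)
        · exact Or.inr hh
        · left
          rw [mem_closedBall_zero_iff, not_le] at hh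
          simp [hS] at hv
          refine hp q 0 hqpos hq1 (by norm_num) (by norm_num) (t⁻¹ • v) _ hv.2 ?_ hh
          rw [← smul_sub, norm_smul, hq2, norm_inv, Real.norm_of_nonneg ht0.le]
          simp only [sub_add_cancel_left, norm_neg]
          rw [inv_mul_eq_div]
          gcongr
          exact hρ f hf)
    have hcq4 : c * q ≤ 1 / 4 := by nlinarith
    have hcq0 : 0 ≤ c * q := by positivity
    have hD1 := hfin (0 + c * q) (by linarith) (by linarith)
    have hB1 := hball (c * q) hcq0 (by linarith)
    have h2 : (μ (t • (D (0 + c * q) ∪ Metric.closedBall 0 (c * q)))) ≤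
        ENNReal.ofReal (t ^ n) * (μ (D (0 + c * q)) + μ (Metric.closedBall 0 (c * q))) := by
      rw [hsm]; gcongr; exact measure_union_le _ _
    have h3 := ENNReal.toReal_mono (ENNReal.mul_ne_top ENNReal.ofReal_ne_top (ENNReal.add_ne_top.mpr ⟨hD1, hB1.1⟩)) (h1.trans h2)
    rw [ENNReal.toReal_mul, ENNReal.toReal_mul, ENNReal.toReal_natCast, ENNReal.toReal_ofReal (by positivity),
      ENNReal.toReal_add hD1 hB1.1] at h3
    refine h3.trans ?_
    refine mul_le_mul_of_nonneg_left ?_ (by positivity)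
    have e : (CV * c + 2 * c * β) * q = CV * (c * q) + 2 * (c * q * β) := by ring
    have h4 := (abs_le.mp (hvol (0 + c * q) (by linarith) (by linarith))).2
    rw [zero_add, abs_of_nonneg hcq0] at h4
    have h5 := hB1.2
    have : 0 ≤ c * q * β := by positivity
    rw [zero_add, e]
    linarith
  have hlow : t ^ n * (V - (CV * c + 2 * c * β) * q) ≤ S.card * m := by
    have h1 := lat_lower b μ S
      (t • (D (-(c * q)) \ Metric.closedBall 0 (2 * c * q))) (by
        intro u hu
        rw [Set.mem_smul_set_iff_inv_smul_mem₀ ht0.ne'] at hu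
        refine ⟨ZSpan.floor b u, ?_, ?_⟩
        · simp only [hS, Set.Finite.mem_toFinset]
          refine ⟨(ZSpan.floor b u).2, ?_⟩
          have hn1 : ‖t⁻¹ • u - t⁻¹ • (ZSpan.floor b u : E)‖ ≤ q ^ 2 := by
            rw [← smul_sub, norm_smul, hq2, norm_inv, Real.norm_of_nonneg ht0.le, inv_mul_eq_div]
            gcongr
            exact hρ _ (ZSpan.fract_mem_fundamentalDomain b u)
          have h0 := hp q (-(c * q)) hqpos hq1 (by nlinarith) (by nlinarith) (t⁻¹ • u) (t⁻¹ • (ZSpan.floor b u : E)) hu.1 hn1 ?_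
          · rwa [neg_add_cancel] at h0
          · have h6 := hu.2
            rw [mem_closedBall_zero_iff, not_le] at h6
            have h7 := norm_sub_norm_le (t⁻¹ • u) (t⁻¹ • (ZSpan.floor b u : E))
            have h8 : q ^ 2 ≤ c * q := by nlinarith
            linarith
        · exact ZSpan.fract_mem_fundamentalDomain b u)
    have hcq0 : 0 ≤ c * q := by positivity
    have hD1 := hfin (-(c * q)) (by linarith) (by linarith)
    have hB1 := hball (2 * c * q) (by positivity) (by linarith)
    rw [hsm] at h1
    have h2 : ENNReal.ofReal (t ^ n) * (μ (D (-(c * q))) - μ (Metric.closedBall 0 (2 * c * q))) ≤ S.card * μ F := by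
      refine le_trans ?_ h1
      gcongr
      exact le_measure_sdiff
    have h3 := ENNReal.toReal_mono (ENNReal.mul_ne_top (ENNReal.natCast_ne_top _) hFt) h2
    rw [ENNReal.toReal_mul, ENNReal.toReal_mul, ENNReal.toReal_natCast, ENNReal.toReal_ofReal (by positivity)] at h3
    refine le_trans ?_ h3
    have h9 := ENNReal.le_toReal_sub (a := μ (D (-(c * q)))) hB1.1
    refine le_trans ?_ (mul_le_mul_of_nonneg_left h9 (by positivity))
    refine mul_le_mul_of_nonneg_left ?_ (by positivity)
    have e : (CV * c + 2 * c * β) * q = CV * (c * q) + 2 * c * q * β := by ring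
    have h4 := (abs_le.mp (hvol (-(c * q)) (by linarith) (by linarith))).1
    rw [abs_neg, abs_of_nonneg hcq0] at h4
    have h5 := hB1.2
    rw [e]
    linarith
  have hqt : t ^ n * q = √ρ * (t ^ n / √t) := by
    rw [hq, Real.sqrt_div (by positivity)]; ring
  have hfinal : |(S.card : ℝ) * m - V * t ^ n| ≤ (CV * c + 2 * c * β) * √ρ * (t ^ n / √t) := by
    have h1 : (CV * c + 2 * c * β) * √ρ * (t ^ n / √t) = t ^ n * ((CV * c + 2 * c * β) * q) := by
      linear_combination -(CV * c + 2 * c * β) * hqt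
    rw [h1, abs_le]
    constructor <;> linarith
  have h2 : (S.card : ℝ) - V / m * t ^ n = ((S.card : ℝ) * m - V * t ^ n) / m := by
    field_simp
  rw [h2, abs_div, abs_of_pos hmpos, div_le_iff₀ hmpos]
  refine hfinal.trans (le_of_eq ?_)
  field_simp
end lat2
end Fact4
end part9

section part10
namespace Fact4
section lat
open NumberField NumberField.InfinitePlace NumberField.mixedEmbedding NumberField.Units NumberField.Units.dirichletUnitTheorem Module MeasureTheory ENNReal
open NumberField.mixedEmbedding.fundamentalCone
open Ideal
open scoped Real NNReal Classical nonZeroDivisors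

variable (K : Type*) [Field K] [NumberField K]

theorem volume_normLeOne_ne : volume (normLeOne K) ≠ 0 ∧ volume (normLeOne K) ≠ ⊤ := by
  constructor
  · rw [volume_normLeOne]
    have := regulator_pos K
    simp [this, NNReal.pi_ne_zero]
  · exact (isBounded_normLeOne K).measure_lt_top.ne

theorem idealSet_count (J : (Ideal (𝓞 K))⁰) : ∃ κ C t0 : ℝ, 0 < κ ∧ 0 ≤ C ∧ 1 ≤ t0 ∧ ∀ t : ℝ, t0 ≤ t →
    |(Nat.card {a : idealSet K J // mixedEmbedding.norm (a : mixedSpace K) ≤ t ^ finrank ℚ K} : ℝ) - κ * t ^ finrank ℚ K|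
      ≤ C * (t ^ finrank ℚ K / √t) := by
  obtain ⟨CV, hCV, hvol⟩ := volume_dset_le K
  obtain ⟨c, hc, hp⟩ := pert K
  have hfin : ∀ a : ℝ, -(1/4) ≤ a → a ≤ 1/4 → volume (dset K a) ≠ ⊤ := by
    intro a ha _
    rw [volume_dset K a ha]
    exact ENNReal.mul_ne_top (volume_normLeOne_ne K).2 ENNReal.ofReal_ne_top
  set b := fractionalIdealLatticeBasis K (FractionalIdeal.mk0 K J) with hb
  obtain ⟨C, t0, hC, ht0, h⟩ := lat_count b volume (finrank ℚ K) finrank_pos (mixedEmbedding.finrank K) (dset K)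
    (measurableSet_dset K) _ CV ENNReal.toReal_nonneg hCV hfin hvol c hc hp (by rw [dset_zero]; exact isBounded_normLeOne K)
  refine ⟨(volume (normLeOne K)).toReal / (volume (ZSpan.fundamentalDomain b)).toReal, C, t0, ?_, hC, ht0, fun t ht => ?_⟩
  rotate_left
  · convert h t ht using 4
    refine Nat.card_congr ?_
    refine (Equiv.subtypeSubtypeEquivSubtypeInter (fun x => x ∈ idealSet K J) (fun x => mixedEmbedding.norm x ≤ t ^ finrank ℚ K)).trans (Equiv.subtypeEquivRight fun v => ?_)
    have htp : 0 < t := by linarith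
    rw [hb, span_idealLatticeBasis, dset_zero, mem_normLeOne, idealSet]
    rw [smul_mem_iff_mem (inv_ne_zero htp.ne'), mixedEmbedding.norm_smul, abs_of_pos (by positivity), inv_pow,
      inv_mul_le_iff₀ (by positivity), mul_one]
    simp only [Set.mem_inter_iff, SetLike.mem_coe]
    tauto
  · refine div_pos (ENNReal.toReal_pos (volume_normLeOne_ne K).1 (volume_normLeOne_ne K).2) (ENNReal.toReal_pos ?_ ?_)
    · exact ZSpan.measure_fundamentalDomain_ne_zero b
    · exact (ZSpan.fundamentalDomain_isBounded b).measure_lt_top.ne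

theorem aux1 {C : ClassGroup (𝓞 K)} {J : (Ideal (𝓞 K))⁰} {s : ℝ} (hJ : ClassGroup.mk0 J = C⁻¹) :
    Nat.card {I : (Ideal (𝓞 K))⁰ // absNorm (I : Ideal (𝓞 K)) ≤ s ∧ ClassGroup.mk0 I = C}
      = Nat.card {I : (Ideal (𝓞 K))⁰ // (J : Ideal (𝓞 K)) ∣ I ∧ Submodule.IsPrincipal (I : Ideal (𝓞 K)) ∧
        absNorm (I : Ideal (𝓞 K)) ≤ s * absNorm (J : Ideal (𝓞 K))} := by
  simp_rw [← nonZeroDivisors_dvd_iff_dvd_coe]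
  refine Nat.card_congr ?_
  refine ((Equiv.dvd J).subtypeEquiv fun I ↦ ?_).trans
    (Equiv.subtypeSubtypeEquivSubtypeInter (fun I : (Ideal (𝓞 K))⁰ ↦ J ∣ I) _)
  rw [← ClassGroup.mk0_eq_one_iff (SetLike.coe_mem _)]
  simp_rw [Equiv.dvd_apply, Submonoid.coe_mul, ← Submonoid.mul_def, _root_.map_mul, hJ,
    inv_mul_eq_one, Nat.cast_mul, mul_comm s, eq_comm, and_comm, and_congr_left_iff]
  exact fun _ ↦
    (mul_le_mul_iff_of_pos_left (Nat.cast_pos.mpr (absNorm_pos_of_nonZeroDivisors J))).symm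

theorem class_count (C : ClassGroup (𝓞 K)) : ∃ κ A s0 : ℝ, 0 < κ ∧ 0 ≤ A ∧ 1 ≤ s0 ∧ ∀ s : ℝ, s0 ≤ s →
    |(Nat.card {I : (Ideal (𝓞 K))⁰ // absNorm (I : Ideal (𝓞 K)) ≤ s ∧ ClassGroup.mk0 I = C} : ℝ) - κ * s| ≤
      A * s ^ (1 - 1 / (2 * (finrank ℚ K : ℝ))) := by
  obtain ⟨J, hJ⟩ := ClassGroup.mk0_surjective C⁻¹
  obtain ⟨κ, A, t0, hκ, hA, ht0, h⟩ := idealSet_count K J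
  set n := finrank ℚ K with hn
  have hn0 : 0 < n := finrank_pos
  have hnR : (0 : ℝ) < n := by exact_mod_cast hn0
  set N : ℝ := ((absNorm (J : Ideal (𝓞 K)) : ℕ) : ℝ) with hN
  have hN0 : 0 < N := Nat.cast_pos.mpr (absNorm_pos_of_nonZeroDivisors J)
  have hw : (0 : ℝ) < torsionOrder K := by exact_mod_cast Nat.pos_of_ne_zero (torsionOrder_ne_zero K)
  set w : ℝ := ((torsionOrder K : ℕ) : ℝ) with hwdef
  refine ⟨κ * N / w, A * N ^ (1 - 1 / (2 * (n : ℝ))) / w, max 1 (t0 ^ n / N), by positivity, by positivity, le_max_left _ _, fun s hs => ?_⟩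
  have hs1 : 1 ≤ s := (le_max_left _ _).trans hs
  have hs2 : t0 ^ n ≤ s * N := by
    have := (le_max_right _ _).trans hs
    rwa [div_le_iff₀ hN0] at this
  have hsN : 0 < s * N := by positivity
  set t := (s * N) ^ ((1 : ℝ) / n) with ht
  have htn : t ^ n = s * N := by
    rw [ht, ← Real.rpow_natCast, ← Real.rpow_mul hsN.le, one_div_mul_cancel hnR.ne', Real.rpow_one]
  have htt : t0 ≤ t := by
    refine le_of_pow_le_pow_left₀ hn0.ne' (by positivity) ?_
    rwa [htn]
  have h1 := h t htt
  rw [aux1 K hJ]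
  have h2 := card_isPrincipal_dvd_norm_le K J (s * N)
  rw [htn, ← h2] at h1
  have h3 : s * N / √t = N ^ (1 - 1 / (2 * (n : ℝ))) * s ^ (1 - 1 / (2 * (n : ℝ))) := by
    rw [← Real.mul_rpow hN0.le (by positivity), mul_comm N s, Real.rpow_sub hsN, Real.rpow_one, Real.sqrt_eq_rpow, ht,
      ← Real.rpow_mul hsN.le]
    congr 2
    field_simp
  rw [h3, Nat.cast_mul] at h1
  set X : ℝ := (Nat.card _ : ℝ) with hX
  have h4 : X - κ * N / w * s = (X * w - κ * (s * N)) / w := by field_simp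
  rw [h4, abs_div, abs_of_pos hw, div_le_iff₀ hw]
  refine h1.trans (le_of_eq ?_)
  field_simp

theorem ideal_count : ∃ κ A δ : ℝ, 0 < κ ∧ 0 ≤ A ∧ 0 < δ ∧ δ < 1 ∧ ∀ s : ℝ, 1 ≤ s →
    |(Nat.card {I : (Ideal (𝓞 K))⁰ // absNorm (I : Ideal (𝓞 K)) ≤ s} : ℝ) - κ * s| ≤ A * s ^ (1 - δ) := by
  choose κ A s0 hκ hA hs0 h using class_count K
  set δ := 1 / (2 * (finrank ℚ K : ℝ)) with hδ
  have hnR : (1 : ℝ) ≤ finrank ℚ K := by exact_mod_cast (finrank_pos : 0 < finrank ℚ K)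
  have hδ0 : 0 < δ := by positivity
  have hδ1 : δ < 1 := by rw [hδ, div_lt_one (by positivity)]; linarith
  set N : ℝ → ℝ := fun s => (Nat.card {I : (Ideal (𝓞 K))⁰ // absNorm (I : Ideal (𝓞 K)) ≤ s} : ℝ) with hN
  have hfin : ∀ s : ℝ, 0 ≤ s → Finite {I : (Ideal (𝓞 K))⁰ // absNorm (I : Ideal (𝓞 K)) ≤ s} := by
    intro s hs
    simp_rw [← Nat.le_floor_iff hs]
    exact finite_setOfPred_absNorm_le₀ ⌊s⌋₊
  have hsum : ∀ s : ℝ, 0 ≤ s → N s = ∑ C : ClassGroup (𝓞 K), (Nat.card {I : (Ideal (𝓞 K))⁰ // absNorm (I : Ideal (𝓞 K)) ≤ s ∧ ClassGroup.mk0 I = C} : ℝ) := by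
    intro s hs
    have := hfin s hs
    have hf2 : ∀ C : ClassGroup (𝓞 K), Finite {I : (Ideal (𝓞 K))⁰ // absNorm (I : Ideal (𝓞 K)) ≤ s ∧ ClassGroup.mk0 I = C} := fun C =>
      Finite.of_equiv _ (Equiv.subtypeSubtypeEquivSubtypeInter (fun I : (Ideal (𝓞 K))⁰ => (absNorm (I : Ideal (𝓞 K)) : ℝ) ≤ s) (fun I => ClassGroup.mk0 I = C))
    simp only [hN]
    rw [← Nat.cast_sum, ← Nat.card_sigma]
    congr 1
    refine Nat.card_congr ?_
    refine (Equiv.sigmaFiberEquiv (fun I : {I : (Ideal (𝓞 K))⁰ // absNorm (I : Ideal (𝓞 K)) ≤ s} => ClassGroup.mk0 I.1)).symm.trans ?_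
    refine Equiv.sigmaCongrRight fun C => ?_
    exact Equiv.subtypeSubtypeEquivSubtypeInter (fun I : (Ideal (𝓞 K))⁰ => (absNorm (I : Ideal (𝓞 K)) : ℝ) ≤ s) (fun I => ClassGroup.mk0 I = C)
  set s1 := ∑ C, s0 C with hs1
  have hs1C : ∀ C, s0 C ≤ s1 := fun C => Finset.single_le_sum (f := s0) (fun i _ => by linarith [hs0 i]) (Finset.mem_univ C)
  have hs11 : 1 ≤ s1 := (hs0 1).trans (hs1C 1)
  have hκ' : 0 < ∑ C, κ C := Finset.sum_pos (fun C _ => hκ C) Finset.univ_nonempty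
  have hA' : 0 ≤ ∑ C, A C := Finset.sum_nonneg (fun C _ => hA C)
  have hN0 : ∀ s, 0 ≤ N s := fun s => Nat.cast_nonneg _
  refine ⟨∑ C, κ C, (∑ C, A C) + N s1 + (∑ C, κ C) * s1, δ, hκ', ?_, hδ0, hδ1, fun s hs => ?_⟩
  · have := hN0 s1; positivity
  have hsp : 1 ≤ s ^ (1 - δ) := Real.one_le_rpow hs (by linarith)
  change |N s - _| ≤ _
  rcases le_total s1 s with hle | hle
  · rw [hsum s (by linarith), Finset.sum_mul, ← Finset.sum_sub_distrib]
    refine (Finset.abs_sum_le_sum_abs _ _).trans ?_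
    refine (Finset.sum_le_sum fun C _ => h C s ((hs1C C).trans hle)).trans ?_
    rw [← Finset.sum_mul]
    have := hN0 s1
    gcongr
    have : 0 ≤ (∑ C, κ C) * s1 := by positivity
    linarith
  · have h1 : N s ≤ N s1 := by
      have := hfin s1 (by linarith)
      simp only [hN]
      exact_mod_cast Nat.card_le_card_of_injective (fun I : {I : (Ideal (𝓞 K))⁰ // absNorm (I : Ideal (𝓞 K)) ≤ s} => (⟨I.1, I.2.trans hle⟩ : {I : (Ideal (𝓞 K))⁰ // absNorm (I : Ideal (𝓞 K)) ≤ s1})) (fun a b hab => by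
        simp only [Subtype.mk.injEq] at hab; exact Subtype.ext hab)
    have h2 : (∑ C, κ C) * s ≤ (∑ C, κ C) * s1 := by gcongr
    have h3 : 0 ≤ (∑ C, κ C) * s := by positivity
    have := hN0 s
    have h4 : |N s - (∑ C, κ C) * s| ≤ N s1 + (∑ C, κ C) * s1 := by
      rw [abs_le]; constructor <;> linarith
    have h5 : N s1 + (∑ C, κ C) * s1 ≤ (N s1 + (∑ C, κ C) * s1) * s ^ (1 - δ) := le_mul_of_one_le_right (by linarith) hsp
    have h6 : 0 ≤ (∑ C, A C) * s ^ (1 - δ) := by positivity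
    linarith
end lat
end Fact4
end part10

section part11
namespace Fact4
section alg
open NumberField Module Ideal UniqueFactorizationMonoid
open scoped Classical

variable (K : Type*) [Field K] [NumberField K]

noncomputable def fn (n : ℕ) : Finset (Ideal (𝓞 K)) := (Ideal.finite_setOfPred_absNorm_eq (S := 𝓞 K) n).toFinset

theorem mem_fn {n : ℕ} {I : Ideal (𝓞 K)} : I ∈ fn K n ↔ absNorm I = n := by simp [fn]

noncomputable def pn (n : ℕ) : Finset (Ideal (𝓞 K)) :=
  (Ideal.finite_setOfPred_absNorm_le (S := 𝓞 K) n).toFinset.filter (fun P => Prime P)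

theorem mem_pn {n : ℕ} {P : Ideal (𝓞 K)} : P ∈ pn K n ↔ absNorm P ≤ n ∧ Prime P := by simp [pn]

noncomputable def aK (n : ℕ) : ℝ := (fn K n).card

noncomputable def LK (n : ℕ) : ℝ :=
  ∑ P ∈ pn K n, ∑ k ∈ Finset.Icc 1 n, if absNorm P ^ k = n then Real.log (absNorm P) else 0

variable {K}

theorem two_le_absNorm {P : Ideal (𝓞 K)} (hP : Prime P) : 2 ≤ absNorm P := by
  have h1 : absNorm P ≠ 0 := by rw [Ne, absNorm_eq_zero_iff]; exact hP.ne_zero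
  have h2 : absNorm P ≠ 1 := by
    rw [Ne, absNorm_eq_one_iff, ← Ideal.isUnit_iff]; exact hP.not_isUnit
  omega

theorem exp_le {P : Ideal (𝓞 K)} (hP : Prime P) {k m : ℕ} (h : absNorm P ^ k ≤ m) : k ≤ m := by
  have h1 := two_le_absNorm hP
  have h2 : k < 2 ^ k := Nat.lt_two_pow_self
  have h3 : 2 ^ k ≤ absNorm P ^ k := Nat.pow_le_pow_left h1 k
  omega

theorem LK_ext {m n : ℕ} (h : m ≤ n) : LK K m =
    ∑ P ∈ pn K n, ∑ k ∈ Finset.Icc 1 n, if absNorm P ^ k = m then Real.log (absNorm P) else 0 := by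
  rw [LK]
  have hsub : pn K m ⊆ pn K n := fun P hP => by
    rw [mem_pn] at hP ⊢; exact ⟨hP.1.trans h, hP.2⟩
  rw [← Finset.sum_subset hsub]
  · refine Finset.sum_congr rfl fun P hP => ?_
    refine Finset.sum_subset (Finset.Icc_subset_Icc_right h) fun k hk hk' => ?_
    rw [if_neg]
    intro h1
    rw [mem_pn] at hP
    exact hk' (Finset.mem_Icc.mpr ⟨(Finset.mem_Icc.mp hk).1, exp_le hP.2 h1.le⟩)
  · intro P hP hP'
    rw [mem_pn] at hP hP'
    refine Finset.sum_eq_zero fun k hk => ?_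
    rw [if_neg]
    intro h1
    refine hP' ⟨?_, hP.2⟩
    rw [← h1]
    exact Nat.le_self_pow (by have := (Finset.mem_Icc.mp hk).1; omega) _

theorem cnt (Q : Ideal (𝓞 K)) (hQ : Q ≠ ⊥) (n : ℕ) (hn : n ≠ 0) :
    ∑ p ∈ n.divisorsAntidiagonal, (if absNorm Q = p.1 then aK K p.2 else 0) = ((fn K n).filter (Q ∣ ·)).card := by
  rw [Nat.sum_divisorsAntidiagonal (f := fun d e => if absNorm Q = d then aK K e else 0), Finset.sum_ite_eq]
  split_ifs with h
  · rw [Nat.mem_divisors] at h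
    have hm : 0 < absNorm Q := Nat.pos_of_ne_zero (by rwa [Ne, absNorm_eq_zero_iff])
    obtain ⟨e, he⟩ := h.1
    rw [he, Nat.mul_div_cancel_left _ hm, aK]
    congr 1
    refine Finset.card_bij (fun I _ => Q * I) ?_ ?_ ?_
    · intro I hI
      rw [mem_fn] at hI
      rw [Finset.mem_filter, mem_fn, map_mul, hI]
      exact ⟨rfl, dvd_mul_right _ _⟩
    · intro I _ J _ h
      exact mul_left_cancel₀ hQ h
    · intro I hI
      rw [Finset.mem_filter, mem_fn] at hI
      obtain ⟨J, rfl⟩ := hI.2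
      refine ⟨J, ?_, rfl⟩
      rw [mem_fn]
      have := hI.1
      rw [map_mul] at this
      exact Nat.eq_of_mul_eq_mul_left hm this
  · symm
    rw [Nat.cast_eq_zero, Finset.card_eq_zero, Finset.filter_eq_empty_iff]
    intro I hI hQI
    rw [mem_fn] at hI
    refine h (Nat.mem_divisors.mpr ⟨?_, hn⟩)
    rw [← hI]
    exact map_dvd absNorm hQI

theorem log_absNorm (I : Ideal (𝓞 K)) (n : ℕ) (hn : n ≠ 0) (hI : absNorm I = n) :
    Real.log n = ∑ P ∈ pn K n, ∑ k ∈ Finset.Icc 1 n, if P ^ k ∣ I then Real.log (absNorm P) else 0 := by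
  have hI0 : I ≠ ⊥ := fun h => hn (by rw [← hI, h]; exact absNorm_eq_zero_iff.mpr rfl)
  have h1 : ∀ P ∈ pn K n, (∑ k ∈ Finset.Icc 1 n, if P ^ k ∣ I then Real.log (absNorm P) else 0) =
      (normalizedFactors I).count P • Real.log (absNorm P) := by
    intro P hP
    rw [mem_pn] at hP
    have hiff : ∀ k, P ^ k ∣ I ↔ k ≤ (normalizedFactors I).count P := by
      intro k
      rw [pow_dvd_iff_le_emultiplicity, emultiplicity_eq_count_normalizedFactors hP.2.irreducible hI0, normalize_eq]
      exact Nat.cast_le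
    have hc : (normalizedFactors I).count P ≤ n := by
      refine exp_le hP.2 ?_
      rw [← map_pow, ← hI]
      exact Nat.le_of_dvd (by omega) (map_dvd absNorm ((hiff _).mpr le_rfl))
    simp_rw [hiff]
    rw [← Finset.sum_filter, Finset.sum_const]
    congr 1
    have : (Finset.Icc 1 n).filter (fun k => k ≤ (normalizedFactors I).count P) = Finset.Icc 1 ((normalizedFactors I).count P) := by
      ext k; simp only [Finset.mem_filter, Finset.mem_Icc]; omega
    rw [this, Nat.card_Icc]; simp
  rw [Finset.sum_congr rfl h1]
  have h2 : Real.log n = ((normalizedFactors I).map (fun P => Real.log (absNorm P))).sum := by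
    have h3 : ∀ s : Multiset (Ideal (𝓞 K)), (∀ P ∈ s, Prime P) → Real.log (absNorm s.prod) = (s.map (fun P => Real.log (absNorm P))).sum := by
      intro s
      induction s using Multiset.induction_on with
      | empty => simp
      | cons P s ih =>
        intro hs
        rw [Multiset.prod_cons, Multiset.map_cons, Multiset.sum_cons, map_mul, Nat.cast_mul, Real.log_mul, ih]
        · exact fun Q hQ => hs Q (Multiset.mem_cons_of_mem hQ)
        · have := two_le_absNorm (hs P (Multiset.mem_cons_self _ _))
          exact_mod_cast (by omega)
        · rw [Nat.cast_ne_zero, Ne, absNorm_eq_zero_iff]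
          refine Multiset.prod_ne_zero fun h0 => ?_
          exact (hs 0 (Multiset.mem_cons_of_mem h0)).ne_zero rfl
    rw [← h3 _ (fun P hP => prime_of_normalized_factor P hP), Ideal.prod_normalizedFactors_eq_self hI0, hI]
  rw [h2, Finset.sum_multiset_map_count]
  refine Finset.sum_subset ?_ ?_
  · intro P hP
    rw [Multiset.mem_toFinset] at hP
    rw [mem_pn]
    refine ⟨?_, prime_of_normalized_factor P hP⟩
    rw [← hI]
    exact Nat.le_of_dvd (by omega) (map_dvd absNorm (dvd_of_mem_normalizedFactors hP))
  · intro P _ hP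
    rw [Multiset.mem_toFinset] at hP
    rw [Multiset.count_eq_zero_of_notMem hP, zero_smul]

theorem conv (n : ℕ) : aK K n * Real.log n = ∑ p ∈ n.divisorsAntidiagonal, LK K p.1 * aK K p.2 := by
  rcases eq_or_ne n 0 with rfl | hn
  · simp
  have h1 : aK K n * Real.log n = ∑ I ∈ fn K n, ∑ P ∈ pn K n, ∑ k ∈ Finset.Icc 1 n, if P ^ k ∣ I then Real.log (absNorm P) else 0 := by
    rw [← Finset.sum_congr rfl (fun I hI => log_absNorm I n hn ((mem_fn K).mp hI)), Finset.sum_const, nsmul_eq_mul, aK]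
  rw [h1, Finset.sum_comm]
  have h2 : ∀ p ∈ n.divisorsAntidiagonal, LK K p.1 * aK K p.2 =
      ∑ P ∈ pn K n, ∑ k ∈ Finset.Icc 1 n, Real.log (absNorm P) * (if absNorm (P ^ k) = p.1 then aK K p.2 else 0) := by
    intro p hp
    have hle : p.1 ≤ n := Nat.le_of_dvd (by omega) (Nat.fst_mem_divisors_of_mem_antidiagonal hp |> Nat.dvd_of_mem_divisors)
    rw [LK_ext hle, Finset.sum_mul]
    refine Finset.sum_congr rfl fun P _ => ?_
    rw [Finset.sum_mul]
    refine Finset.sum_congr rfl fun k _ => ?_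
    rw [map_pow]
    split_ifs <;> simp
  rw [Finset.sum_congr rfl h2]
  symm
  rw [Finset.sum_comm]
  symm
  refine Finset.sum_congr rfl fun P hP => ?_
  rw [Finset.sum_comm]
  symm
  rw [Finset.sum_comm]
  symm
  refine Finset.sum_congr rfl fun k hk => ?_
  rw [← Finset.mul_sum, cnt _ (pow_ne_zero _ ((mem_pn K).mp hP).2.ne_zero) n hn, ← Finset.sum_filter, Finset.sum_const, nsmul_eq_mul, mul_comm]

theorem LK_nonneg (n : ℕ) : 0 ≤ LK K n := by
  refine Finset.sum_nonneg fun P _ => Finset.sum_nonneg fun k _ => ?_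
  split_ifs
  · exact Real.log_natCast_nonneg _
  · exact le_rfl

theorem prime_under {P : Ideal (𝓞 K)} (hP : Prime P) : ∃ q : ℕ, q.Prime ∧ (q : 𝓞 K) ∈ P ∧ ∃ f : ℕ, f ≠ 0 ∧ absNorm P = q ^ f := by
  have hpr : P.IsPrime := (Ideal.prime_iff_isPrime hP.ne_zero).mp hP
  have h0 := absNorm_mem P
  have hne : absNorm P ≠ 0 := by have := two_le_absNorm hP; omega
  rw [← Nat.prod_primeFactorsList hne] at h0
  have h1 : ∃ q ∈ (absNorm P).primeFactorsList, (q : 𝓞 K) ∈ P := by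
    generalize (absNorm P).primeFactorsList = l at h0
    induction l with
    | nil =>
      simp at h0
      exact absurd ((Ideal.eq_top_iff_one P).mpr h0) hpr.ne_top
    | cons a l ih =>
      rw [List.prod_cons, Nat.cast_mul] at h0
      rcases hpr.mem_or_mem h0 with h | h
      · exact ⟨a, by simp, h⟩
      · obtain ⟨q, hq, hq'⟩ := ih h
        exact ⟨q, by simp [hq], hq'⟩
  obtain ⟨q, hq, hq'⟩ := h1
  have hqp := Nat.prime_of_mem_primeFactorsList hq
  refine ⟨q, hqp, hq', ?_⟩
  have h2 : absNorm P ∣ q ^ finrank ℚ K := by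
    have := absNorm_dvd_norm_of_mem hq'
    rw [show (q : 𝓞 K) = algebraMap ℤ (𝓞 K) q by simp, Algebra.norm_algebraMap, RingOfIntegers.rank] at this
    exact_mod_cast this
  obtain ⟨f, _, hf⟩ := (Nat.dvd_prime_pow hqp).mp h2
  refine ⟨f, ?_, hf⟩
  rintro rfl
  have := two_le_absNorm hP
  rw [pow_zero] at hf; omega

theorem LK_le (n : ℕ) : LK K n ≤ finrank ℚ K * ArithmeticFunction.vonMangoldt n := by
  by_cases hn : ∃ P : Ideal (𝓞 K), Prime P ∧ ∃ k, 1 ≤ k ∧ absNorm P ^ k = n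
  · obtain ⟨P0, hP0, k0, hk0, hn0⟩ := hn
    obtain ⟨q, hq, hqP, f, hf, hPf⟩ := prime_under hP0
    have hnq : n = q ^ (f * k0) := by rw [← hn0, hPf, pow_mul]
    have hfk : f * k0 ≠ 0 := mul_ne_zero hf (by omega)
    have hL : ArithmeticFunction.vonMangoldt n = Real.log q := by
      rw [hnq, ArithmeticFunction.vonMangoldt_apply_pow hfk, ArithmeticFunction.vonMangoldt_apply_prime hq]
    rw [hL]
    set s := (pn K n).filter (fun P => (q : 𝓞 K) ∈ P) with hs
    have h1 : LK K n ≤ ∑ P ∈ s, Real.log (absNorm P) := by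
      rw [LK, hs, Finset.sum_filter]
      refine Finset.sum_le_sum fun P hP => ?_
      rw [mem_pn] at hP
      by_cases hk : ∃ k, 1 ≤ k ∧ absNorm P ^ k = n
      · obtain ⟨k, hk1, hk⟩ := hk
        obtain ⟨q', hq', hqP', f', hf', hPf'⟩ := prime_under hP.2
        have hqq : q' = q := by
          have h2 : q' ∣ n := by
            rw [← hk, hPf', ← pow_mul]
            exact dvd_pow_self _ (mul_ne_zero hf' (by omega))
          rw [hnq] at h2
          exact (Nat.prime_dvd_prime_iff_eq hq' hq).mp (hq'.dvd_of_dvd_pow h2)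
        rw [← hqq, if_pos hqP']
        have : ∀ j ∈ Finset.Icc 1 n, (if absNorm P ^ j = n then Real.log (absNorm P) else 0) = if j = k then Real.log (absNorm P) else 0 := by
          intro j _
          congr 1
          refine propext ⟨fun h => ?_, fun h => by rw [h]; exact hk⟩
          exact Nat.pow_right_injective (two_le_absNorm hP.2) (h.trans hk.symm)
        rw [Finset.sum_congr rfl this, Finset.sum_ite_eq']
        split_ifs
        · exact le_rfl
        · exact Real.log_natCast_nonneg _
      · rw [Finset.sum_eq_zero]
        · split_ifs
          · exact Real.log_natCast_nonneg _
          · exact le_rfl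
        · intro j hj
          rw [if_neg]
          intro h
          exact hk ⟨j, (Finset.mem_Icc.mp hj).1, h⟩
    refine h1.trans ?_
    have hpos : ∀ P ∈ s, (absNorm P : ℝ) ≠ 0 := by
      intro P hP
      rw [hs, Finset.mem_filter, mem_pn] at hP
      have := two_le_absNorm hP.1.2
      exact_mod_cast (by omega)
    rw [← Real.log_prod hpos, ← Nat.cast_prod, ← map_prod, ← Real.log_pow, ← Nat.cast_pow]
    have hdvd : ∏ P ∈ s, P ∣ Ideal.span {(q : 𝓞 K)} := by
      refine Finset.prod_primes_dvd _ ?_ ?_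
      · intro P hP
        rw [hs, Finset.mem_filter, mem_pn] at hP
        exact hP.1.2
      · intro P hP
        rw [hs, Finset.mem_filter] at hP
        rw [Ideal.dvd_span_singleton]; exact hP.2
    have hN : absNorm (Ideal.span {(q : 𝓞 K)}) = q ^ finrank ℚ K := by
      rw [absNorm_span_singleton, show (q : 𝓞 K) = algebraMap ℤ (𝓞 K) q by simp, Algebra.norm_algebraMap, RingOfIntegers.rank,
        Int.natAbs_pow, Int.natAbs_natCast]
    have h3 := map_dvd absNorm hdvd
    rw [hN] at h3
    have hqpos : 0 < q ^ finrank ℚ K := pow_pos hq.pos _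
    refine Real.log_le_log ?_ (by exact_mod_cast Nat.le_of_dvd hqpos h3)
    exact_mod_cast Nat.pos_of_dvd_of_pos h3 hqpos
  · have : LK K n = 0 := by
      refine Finset.sum_eq_zero fun P hP => Finset.sum_eq_zero fun k hk => ?_
      rw [if_neg]
      intro h
      exact hn ⟨P, ((mem_pn K).mp hP).2, k, (Finset.mem_Icc.mp hk).1, h⟩
    rw [this]
    exact mul_nonneg (Nat.cast_nonneg _) ArithmeticFunction.vonMangoldt_nonneg

noncomputable def nu (K : Type*) [Field K] [NumberField K] (p : ℕ) : ℕ := ((pn K p).filter (fun P => absNorm P = p)).card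

theorem LK_prime (p : ℕ) (hp : p.Prime) : LK K p = nu K p * Real.log p := by
  rw [LK, nu, ← nsmul_eq_mul, ← Finset.sum_const, Finset.sum_filter]
  refine Finset.sum_congr rfl fun P hP => ?_
  have : ∀ k ∈ Finset.Icc 1 p, (if absNorm P ^ k = p then Real.log (absNorm P) else 0) = if k = 1 then (if absNorm P = p then Real.log p else 0) else 0 := by
    intro k hk
    by_cases hk1 : k = 1
    · subst hk1
      simp only [pow_one, if_true]
      split_ifs with h
      · rw [h]
      · rfl
    · rw [if_neg hk1, if_neg]
      intro h
      rw [← h] at hp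
      exact Nat.Prime.not_prime_pow (by have := (Finset.mem_Icc.mp hk).1; omega) hp
  rw [Finset.sum_congr rfl this, Finset.sum_ite_eq', if_pos (Finset.mem_Icc.mpr ⟨le_rfl, hp.one_lt.le⟩)]

theorem LK_tau (K : Type*) [Field K] [NumberField K] (R : ℝ) (hR : 0 < R) : Filter.Tendsto (fun T => ∑' n : ℕ, (LK K n - 1) * (fej R (Real.log n - T) / n)) Filter.atTop (nhds 0) := by
  obtain ⟨κ, A, δ, hκ, hA, hδ, hδ1, h⟩ := ideal_count K
  refine tau_of_counting (aK K) (fun n => Nat.cast_nonneg _) ?_ κ A δ (finrank ℚ K) hκ hδ hδ1 ?_ (LK K) LK_nonneg (Nat.cast_nonneg _) LK_le conv R hR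
  · rw [aK, Nat.cast_pos, Finset.card_pos]
    exact ⟨⊤, by rw [mem_fn]; simp⟩
  · intro x hx
    convert h x hx using 3
    simp only [aK]
    rw [← Nat.cast_sum, ← Finset.card_biUnion]
    · congr 1
      rw [← Fintype.card_coe, ← Nat.card_eq_fintype_card]
      refine Nat.card_congr
        { toFun := fun I => ⟨⟨I.1, ?_⟩, ?_⟩
          invFun := fun I => ⟨I.1.1, ?_⟩
          left_inv := fun I => rfl
          right_inv := fun I => rfl }
      · obtain ⟨I, hI⟩ := I
        rw [Finset.mem_biUnion] at hI
        obtain ⟨n, hn, hI⟩ := hI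
        rw [mem_fn] at hI
        rw [mem_nonZeroDivisors_iff_ne_zero]
        rintro rfl
        rw [Finset.mem_Icc] at hn
        have h0 : absNorm (0 : Ideal (𝓞 K)) = 0 := absNorm_eq_zero_iff.mpr rfl
        omega
      · obtain ⟨I, hI⟩ := I
        rw [Finset.mem_biUnion] at hI
        obtain ⟨n, hn, hI⟩ := hI
        rw [mem_fn] at hI
        rw [Finset.mem_Icc] at hn
        show (absNorm I : ℝ) ≤ x
        rw [hI]
        exact (Nat.le_floor_iff (by linarith)).mp hn.2
      · obtain ⟨⟨I, hI0⟩, hI⟩ := I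
        rw [Finset.mem_biUnion]
        refine ⟨absNorm I, ?_, (mem_fn K).mpr rfl⟩
        rw [Finset.mem_Icc, Nat.le_floor_iff (by linarith)]
        refine ⟨Nat.one_le_iff_ne_zero.mpr fun h => ?_, hI⟩
        rw [mem_nonZeroDivisors_iff_ne_zero] at hI0
        exact hI0 (absNorm_eq_zero_iff.mp h)
    · intro i _ j _ hij
      refine Finset.disjoint_left.mpr fun I hI hJ => hij ?_
      rw [mem_fn] at hI hJ
      exact hI.symm.trans hJ
end alg
end Fact4
end part11

section part12
namespace Fact4
section homs
open NumberField Module Ideal Polynomial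
open scoped Classical

variable {K : Type*} [Field K] [NumberField K]

theorem hom_ker {p : ℕ} (hp : p.Prime) (φ : 𝓞 K →+* ZMod p) :
    RingHom.ker φ ∈ (pn K p).filter (fun P => absNorm P = p) := by
  haveI : Fact p.Prime := ⟨hp⟩
  have h1 : absNorm (RingHom.ker φ) = p := by
    rw [absNorm_apply, Submodule.cardQuot_apply]
    have e := RingHom.quotientKerEquivOfSurjective (ZMod.ringHom_surjective φ)
    rw [show Nat.card (𝓞 K ⧸ RingHom.ker φ) = Nat.card (ZMod p) from Nat.card_congr e.toEquiv, Nat.card_zmod]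
  have h0 : RingHom.ker φ ≠ ⊥ := by
    intro h
    rw [h] at h1
    have h2 : absNorm (⊥ : Ideal (𝓞 K)) = 0 := absNorm_eq_zero_iff.mpr rfl
    exact hp.ne_zero (h1.symm.trans h2)
  rw [Finset.mem_filter, mem_pn]
  exact ⟨⟨h1.le, (Ideal.prime_iff_isPrime h0).mpr (RingHom.ker_isPrime φ)⟩, h1⟩

theorem nu_ne_zero_of_hom {p : ℕ} (hp : p.Prime) (φ : 𝓞 K →+* ZMod p) : nu K p ≠ 0 :=
  Finset.card_ne_zero_of_mem (hom_ker hp φ)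

theorem hom_of_nu {p : ℕ} (hp : p.Prime) (h : nu K p ≠ 0) : ∃ P : Ideal (𝓞 K), absNorm P = p ∧
    ∃ φ : 𝓞 K →+* ZMod p, RingHom.ker φ = P := by
  haveI : Fact p.Prime := ⟨hp⟩
  obtain ⟨P, hP⟩ := Finset.card_pos.mp (Nat.pos_of_ne_zero h)
  rw [Finset.mem_filter, mem_pn] at hP
  refine ⟨P, hP.2, ?_⟩
  have hc : Nat.card (𝓞 K ⧸ P) = p := by
    rw [← hP.2, absNorm_apply, Submodule.cardQuot_apply]
  haveI : Finite (𝓞 K ⧸ P) := Nat.finite_of_card_ne_zero (by rw [hc]; exact hp.ne_zero)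
  haveI := Fintype.ofFinite (𝓞 K ⧸ P)
  have e := ZMod.ringEquivOfPrime (𝓞 K ⧸ P) hp (by rw [← Nat.card_eq_fintype_card, hc])
  refine ⟨e.symm.toRingHom.comp (Ideal.Quotient.mk P), ?_⟩
  ext x
  simp [RingHom.mem_ker, Ideal.Quotient.eq_zero_iff_mem]

theorem nu_two {K' : Type*} [Field K'] [NumberField K'] (σ₁ σ₂ : K →+* K') (hσ : σ₁ ≠ σ₂) :
    ∃ P0 : ℕ, ∀ p : ℕ, p.Prime → P0 ≤ p → nu K' p ≠ 0 → 2 ≤ nu K p := by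
  obtain ⟨β, hβ⟩ : ∃ β : 𝓞 K, σ₁ β ≠ σ₂ β := by
    by_contra! h
    refine hσ (RingHom.ext fun x => ?_)
    obtain ⟨a, b, hb, rfl⟩ := IsFractionRing.div_surjective (A := 𝓞 K) x
    rw [map_div₀, map_div₀]
    exact congr_arg₂ _ (h a) (h b)
  set τ₁ := RingOfIntegers.mapRingHom σ₁
  set τ₂ := RingOfIntegers.mapRingHom σ₂
  set γ : 𝓞 K' := τ₁ β - τ₂ β with hγ
  have hγ0 : γ ≠ 0 := by
    rw [hγ, sub_ne_zero]
    intro h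
    exact hβ (congrArg (fun x : 𝓞 K' => (x : K')) h)
  have hn0 : Algebra.norm ℤ γ ≠ 0 := Algebra.norm_ne_zero_iff.mpr hγ0
  refine ⟨(Algebra.norm ℤ γ).natAbs + 1, fun p hp hpP h => ?_⟩
  haveI : Fact p.Prime := ⟨hp⟩
  obtain ⟨P, hP, φ, hφ⟩ := hom_of_nu hp h
  refine Finset.one_lt_card.mpr ⟨_, hom_ker hp (φ.comp τ₁), _, hom_ker hp (φ.comp τ₂), fun heq => ?_⟩
  obtain ⟨m, hm⟩ := ZMod.intCast_surjective (φ (τ₁ β))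
  have h1 : β - (m : 𝓞 K) ∈ RingHom.ker (φ.comp τ₁) := by
    rw [RingHom.mem_ker]; simp [hm]
  rw [heq, RingHom.mem_ker] at h1
  have h2 : φ γ = 0 := by
    rw [hγ, map_sub, ← hm]
    simp at h1
    rw [sub_eq_zero] at h1 ⊢
    exact h1.symm
  have h3 : γ ∈ P := by rw [← hφ]; exact h2
  have h4 := absNorm_dvd_norm_of_mem h3
  rw [hP] at h4
  have h5 := Nat.le_of_dvd (Int.natAbs_pos.mpr hn0) (Int.natCast_dvd.mp h4)
  omega

theorem common_den (θ : K) (hgen : ∀ x : K, ∃ h : ℚ[X], aeval θ h = x) :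
    ∃ M : ℕ, M ≠ 0 ∧ ∀ x : 𝓞 K, ∃ h : ℤ[X], aeval θ h = (M : K) * x := by
  have h1 : ∀ x : K, ∃ M : ℕ, M ≠ 0 ∧ ∃ h : ℤ[X], aeval θ h = (M : K) * x := by
    intro x
    obtain ⟨h, rfl⟩ := hgen x
    obtain ⟨b, hb⟩ := IsLocalization.integerNormalization_map_to_map (nonZeroDivisors ℤ) h
    have hb0 : (b : ℤ) ≠ 0 := nonZeroDivisors.coe_ne_zero b
    have h2 : aeval θ (IsLocalization.integerNormalization (nonZeroDivisors ℤ) h) = ((b : ℤ) : K) * aeval θ h := by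
      rw [← aeval_map_algebraMap ℚ, hb, map_zsmul, zsmul_eq_mul]
    rcases Int.natAbs_eq (b : ℤ) with hbb | hbb
    · refine ⟨(b : ℤ).natAbs, Int.natAbs_ne_zero.mpr hb0, IsLocalization.integerNormalization (nonZeroDivisors ℤ) h, ?_⟩
      have h3 := congrArg (Int.cast : ℤ → K) hbb
      rw [Int.cast_natCast] at h3
      rw [h2, ← h3]
    · refine ⟨(b : ℤ).natAbs, Int.natAbs_ne_zero.mpr hb0, -IsLocalization.integerNormalization (nonZeroDivisors ℤ) h, ?_⟩
      have h3 := congrArg (Int.cast : ℤ → K) hbb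
      rw [Int.cast_neg, Int.cast_natCast] at h3
      rw [map_neg, h2, h3]
      ring
  choose M hM0 g hg using h1
  obtain ⟨s, hs⟩ := (Module.Finite.fg_top : (⊤ : Submodule ℤ (𝓞 K)).FG)
  refine ⟨∏ w ∈ s, M w, Finset.prod_ne_zero_iff.mpr fun w _ => hM0 w, fun x => ?_⟩
  have hx : x ∈ Submodule.span ℤ (s : Set (𝓞 K)) := by rw [hs]; trivial
  induction hx using Submodule.span_induction with
  | mem w hw =>
    refine ⟨((∏ v ∈ s.erase w, M v : ℕ) : ℤ[X]) * g w, ?_⟩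
    rw [map_mul, hg, map_natCast, ← Finset.prod_erase_mul s _ hw]
    push_cast
    ring
  | zero => exact ⟨0, by simp⟩
  | add x y _ _ hx hy =>
    obtain ⟨a, ha⟩ := hx
    obtain ⟨b, hb⟩ := hy
    exact ⟨a + b, by rw [map_add, ha, hb]; push_cast; ring⟩
  | smul c x _ hx =>
    obtain ⟨a, ha⟩ := hx
    refine ⟨(c : ℤ[X]) * a, ?_⟩
    rw [map_mul, map_intCast, ha]
    have hc : algebraMap (𝓞 K) K (c • x) = (c : K) * algebraMap (𝓞 K) K x := by
      rw [map_zsmul, zsmul_eq_mul]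
    refine Eq.trans (mul_left_comm _ _ _) (congrArg (((∏ w ∈ s, M w : ℕ) : K) * ·) ?_)
    exact hc.symm

theorem hom_of_root (F : ℤ[X]) (hF : Irreducible F) (hd : F.natDegree ≠ 0) (θ : K) (hθ : aeval θ F = 0)
    (hgen : ∀ x : K, ∃ h : ℚ[X], aeval θ h = x) :
    ∃ P0 : ℕ, ∀ p : ℕ, p.Prime → P0 ≤ p → ∀ t : ZMod p, aeval t F = 0 → nu K p ≠ 0 := by
  obtain ⟨M, hM0, hM⟩ := common_den θ hgen
  have hprim : F.IsPrimitive := hF.isPrimitive hd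
  have hirr := (IsPrimitive.Int.irreducible_iff_irreducible_map_cast hprim).mp hF
  have hdvd : ∀ h : ℤ[X], aeval θ h = 0 → F ∣ h := by
    intro h hh
    rw [IsPrimitive.Int.dvd_iff_map_cast_dvd_map_cast _ _ hprim]
    have e1 : aeval θ (F.map (Int.castRingHom ℚ)) = 0 := by
      rw [← hθ]; exact aeval_map_algebraMap ℚ θ F
    have e2 : aeval θ (h.map (Int.castRingHom ℚ)) = 0 := by
      rw [← hh]; exact aeval_map_algebraMap ℚ θ h
    have a1 := minpoly.dvd ℚ θ e1
    have a2 := minpoly.dvd ℚ θ e2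
    have hass : Associated (minpoly ℚ θ) (F.map (Int.castRingHom ℚ)) :=
      (minpoly.irreducible (Algebra.IsIntegral.isIntegral θ)).associated_of_dvd hirr a1
    exact hass.symm.dvd.trans a2
  refine ⟨M + 1, fun p hp hpM t ht => ?_⟩
  haveI : Fact p.Prime := ⟨hp⟩
  have hMp : (M : ZMod p) ≠ 0 := by
    rw [Ne, ZMod.natCast_eq_zero_iff]
    intro h
    have := Nat.le_of_dvd (Nat.pos_of_ne_zero hM0) h
    omega
  have key : ∀ a b : ℤ[X], aeval θ a = aeval θ b → aeval t a = aeval t b := by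
    intro a b hab
    obtain ⟨c, hc⟩ := hdvd (a - b) (by rw [map_sub, hab, sub_self])
    rw [← sub_eq_zero, ← map_sub, hc, map_mul, ht, zero_mul]
  choose g hg using hM
  refine nu_ne_zero_of_hom hp
    { toFun := fun x => aeval t (g x) * (M : ZMod p)⁻¹
      map_one' := ?_
      map_mul' := ?_
      map_zero' := ?_
      map_add' := ?_ }
  · have := key (g 1) (M : ℤ[X]) (by rw [hg]; simp)
    rw [this]; simp [hMp]
  · intro x y
    have := key ((M : ℤ[X]) * g (x * y)) (g x * g y) (by rw [map_mul, map_mul, hg, hg, hg]; simp; ring)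
    rw [map_mul, map_mul] at this
    simp only [map_natCast] at this
    field_simp
    linear_combination this
  · have := key (g 0) 0 (by rw [hg]; simp)
    rw [this]; simp
  · intro x y
    have := key (g (x + y)) (g x + g y) (by rw [map_add, hg, hg, hg]; push_cast; ring)
    rw [this, map_add]; ring
end homs
end Fact4
end part12

section part13
namespace Fact4
section good
open NumberField Module Ideal Polynomial

theorem good_primes_aux (K K' : Type) [Field K] [NumberField K] [Field K'] [NumberField K'] (σ₁ σ₂ : K →+* K') (hσ : σ₁ ≠ σ₂) :
    ∃ N0 : ℕ, ∀ N : ℕ, N0 ≤ N → ∃ p : ℕ, p.Prime ∧ N < 2 * p ∧ p ≤ N ∧ nu K p = 0 := by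
  obtain ⟨P0, hP0⟩ := nu_two σ₁ σ₂ hσ
  set D : ℝ := finrank ℚ K + finrank ℚ K' with hD
  have hk : (0 : ℝ) ≤ finrank ℚ K := Nat.cast_nonneg _
  have hk' : (0 : ℝ) ≤ finrank ℚ K' := Nat.cast_nonneg _
  have hΛ : ∀ n, (0 : ℝ) ≤ ArithmeticFunction.vonMangoldt n := fun n => ArithmeticFunction.vonMangoldt_nonneg
  have hLD : ∀ n, LK K n ≤ D * ArithmeticFunction.vonMangoldt n := fun n =>
    (LK_le n).trans (mul_le_mul_of_nonneg_right (by linarith) (hΛ n))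
  have hLD' : ∀ n, LK K' n ≤ D * ArithmeticFunction.vonMangoldt n := fun n =>
    (LK_le n).trans (mul_le_mul_of_nonneg_right (by linarith) (hΛ n))
  obtain ⟨N0, hN0⟩ := window (LK K) (LK K') D (by linarith) LK_nonneg hLD LK_nonneg hLD'
    (fun R hR => LK_tau K R hR) (fun R hR => LK_tau K' R hR) P0 (by
      intro p hp hpP hL
      have hlog : 0 < Real.log p := Real.log_pos (by exact_mod_cast hp.one_lt)
      rw [LK_prime p hp] at hL
      have hnu : nu K p ≠ 0 := by
        intro h; apply hL; rw [h]; simp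
      rw [LK_prime (K := K) p hp]
      by_cases h : nu K' p = 0
      · rw [LK_prime p hp, h, Nat.cast_zero, zero_mul]
        refine mul_nonneg (by linarith) ?_
        have : (1 : ℝ) ≤ nu K p := by exact_mod_cast Nat.one_le_iff_ne_zero.mpr hnu
        nlinarith
      · have h2 : (2 : ℝ) ≤ nu K p := by exact_mod_cast hP0 p hp hpP h
        refine (hLD' p).trans ?_
        rw [ArithmeticFunction.vonMangoldt_apply_prime hp]
        refine mul_le_mul_of_nonneg_left ?_ (by linarith)
        nlinarith)
  refine ⟨N0, fun N hN => ?_⟩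
  obtain ⟨p, hp, h1, h2, h3⟩ := hN0 N hN
  refine ⟨p, hp, h1, h2, ?_⟩
  rw [LK_prime p hp] at h3
  have hlog : 0 < Real.log p := Real.log_pos (by exact_mod_cast hp.one_lt)
  rcases mul_eq_zero.mp h3 with h | h
  · exact_mod_cast h
  · exact absurd h hlog.ne'

theorem good_primes (F : ℤ[X]) (hF : Irreducible F) (hd : 2 ≤ F.natDegree) :
    ∃ N0 : ℕ, ∀ N : ℕ, N0 ≤ N → ∃ p : ℕ, p.Prime ∧ N < 2 * p ∧ p ≤ N ∧ ∀ t : ZMod p, aeval t F ≠ 0 := by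
  have hprim : F.IsPrimitive := hF.isPrimitive (by omega)
  have hirr := (IsPrimitive.Int.irreducible_iff_irreducible_map_cast hprim).mp hF
  set G := F.map (Int.castRingHom ℚ) with hG
  haveI : Fact (Irreducible G) := ⟨hirr⟩
  have hGd : G.natDegree = F.natDegree := natDegree_map_eq_of_injective Int.cast_injective F
  haveI : CharZero (AdjoinRoot G) := charZero_of_injective_algebraMap (algebraMap ℚ (AdjoinRoot G)).injective
  have hfd : FiniteDimensional ℚ (AdjoinRoot G) := (AdjoinRoot.powerBasis hirr.ne_zero).finite
  haveI : NumberField (AdjoinRoot G) := { to_charZero := inferInstance, to_finiteDimensional := (by convert hfd) }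
  haveI : NumberField G.SplittingField := { to_charZero := inferInstance, to_finiteDimensional := (by convert (inferInstance : FiniteDimensional ℚ G.SplittingField)) }
  have hsep : G.Separable := hirr.separable
  have hcard : Fintype.card (G.rootSet G.SplittingField) = G.natDegree :=
    card_rootSet_eq_natDegree hsep (SplittingField.splits G)
  obtain ⟨⟨a, ha⟩, ⟨b, hb⟩, hab⟩ := Fintype.exists_pair_of_one_lt_card (α := G.rootSet G.SplittingField) (by omega)
  have hab' : a ≠ b := fun h => hab (by simp [h])
  rw [mem_rootSet] at ha hb
  obtain ⟨N0, hN0⟩ := good_primes_aux (AdjoinRoot G) G.SplittingField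
    (AdjoinRoot.lift (algebraMap ℚ _) a ha.2) (AdjoinRoot.lift (algebraMap ℚ _) b hb.2) (by
      intro h
      have e := RingHom.congr_fun h (AdjoinRoot.root G)
      exact hab' ((AdjoinRoot.lift_root ha.2).symm.trans (Eq.trans e (AdjoinRoot.lift_root hb.2))))
  obtain ⟨P0, hP0⟩ := hom_of_root (K := AdjoinRoot G) F hF (by omega) (AdjoinRoot.root G) (by
      have e : eval₂ (AdjoinRoot.of G) (AdjoinRoot.root G) (F.map (Int.castRingHom ℚ)) = 0 := AdjoinRoot.eval₂_root G
      rw [eval₂_map] at e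
      rw [aeval_def, ← e]
      congr 1) (by
      intro x
      induction x using AdjoinRoot.induction_on with
      | ih p =>
        refine ⟨p, ?_⟩
        rw [← AdjoinRoot.aeval_eq, aeval_def, aeval_def]
        congr 1)
  refine ⟨max N0 (2 * P0), fun N hN => ?_⟩
  obtain ⟨p, hp, h1, h2, h3⟩ := hN0 N (le_trans (le_max_left _ _) hN)
  refine ⟨p, hp, h1, h2, fun t ht => hP0 p hp ?_ t ht h3⟩
  have := le_trans (le_max_right _ _) hN
  omega
end good
end Fact4
end part13

namespace Fact4
section red
open Polynomial

theorem eval_hom {S : Type*} [CommRing S] (F : ℤ[X]) (d : ℕ) (x y : S) :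
    MvPolynomial.aeval ![x, y] (F.homogenize d) = ∑ kl ∈ Finset.HasAntidiagonal.antidiagonal d, (F.coeff kl.1 : S) * (x ^ kl.1 * y ^ kl.2) := by
  rw [homogenize, map_sum]
  refine Finset.sum_congr rfl fun kl _ => ?_
  rw [MvPolynomial.aeval_monomial, Finsupp.update_eq_add_single (by simp), Finsupp.prod_add_index' (by simp) (by intros; rw [pow_add])]
  simp

theorem dehom (d : ℕ) (hd : 2 ≤ d) (f : MvPolynomial (Fin 2) ℤ) (hirr : Irreducible f)
    (hhom : f.IsHomogeneous d) : ∃ F : ℤ[X], Irreducible F ∧ F.natDegree = d ∧ F.homogenize d = f := by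
  set F : ℤ[X] := MvPolynomial.aeval ![X, 1] f with hF
  have hf : F.homogenize d = f := homogenize_eq_of_isHomogeneous hhom rfl
  have hle : F.natDegree ≤ d := by
    have : F = ∑ kl ∈ Finset.HasAntidiagonal.antidiagonal d, (F.coeff kl.1 : ℤ[X]) * (X ^ kl.1 * 1 ^ kl.2) := by
      conv_lhs => rw [hF, ← hf]
      exact eval_hom F d X 1
    rw [this]
    refine natDegree_sum_le_of_forall_le _ _ fun kl hkl => ?_
    rw [one_pow, mul_one, ← C_eq_intCast]
    refine (natDegree_C_mul_X_pow_le _ _).trans ?_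
    rw [Finset.HasAntidiagonal.mem_antidiagonal] at hkl
    omega
  have hX : Irreducible (MvPolynomial.X 1 : MvPolynomial (Fin 2) ℤ) := MvPolynomial.X_prime.irreducible
  have hdeg : F.natDegree = d := by
    by_contra hne
    have h1 : f = F.homogenize F.natDegree * MvPolynomial.X 1 ^ (d - F.natDegree) := by
      rw [← homogenize_one, ← homogenize_mul _ _ le_rfl (by simp), mul_one, Nat.add_sub_cancel' hle, hf]
    have h2 : MvPolynomial.X 1 ∣ f := by
      rw [h1]
      exact Dvd.dvd.mul_left (dvd_pow_self _ (by omega)) _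
    have h3 := hX.associated_of_dvd hirr h2
    obtain ⟨g, hg⟩ := h3.symm.dvd
    have hg0 : g ≠ 0 := by
      rintro rfl
      rw [mul_zero] at hg
      exact hX.ne_zero hg
    have h4 := MvPolynomial.totalDegree_mul_of_isDomain hirr.ne_zero hg0
    rw [← hg, MvPolynomial.totalDegree_X, hhom.totalDegree hirr.ne_zero] at h4
    omega
  refine ⟨F, ⟨?_, ?_⟩, hdeg, hf⟩
  · intro hu
    have := natDegree_eq_zero_of_isUnit hu
    omega
  · intro a b hab
    have hF0 : F ≠ 0 := by
      rintro h; rw [h] at hdeg; simp at hdeg; omega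
    have ha : a ≠ 0 := by rintro rfl; simp at hab; exact hF0 hab
    have hb : b ≠ 0 := by rintro rfl; simp at hab; exact hF0 hab
    have h1 : f = a.homogenize a.natDegree * b.homogenize b.natDegree := by
      rw [← homogenize_mul _ _ le_rfl le_rfl, ← natDegree_mul ha hb, ← hab, hdeg, hf]
    rcases hirr.isUnit_or_isUnit h1 with h | h
    · left
      have := h.map (MvPolynomial.aeval ![(X : ℤ[X]), 1])
      rwa [aeval_homogenize_X_one _ le_rfl] at this
    · right
      have := h.map (MvPolynomial.aeval ![(X : ℤ[X]), 1])
      rwa [aeval_homogenize_X_one _ le_rfl] at this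

theorem zero_mod (F : ℤ[X]) (d : ℕ) (hd0 : d ≠ 0) (hd : F.natDegree = d) (p : ℕ) (hp : p.Prime)
    (hlc : ¬ (p : ℤ) ∣ F.leadingCoeff) (hroot : ∀ t : ZMod p, aeval t F ≠ 0) (x y : ℤ)
    (h : (p : ℤ) ∣ MvPolynomial.eval ![x, y] (F.homogenize d)) :
    ((p : ℤ) ^ d) ∣ MvPolynomial.eval ![x, y] (F.homogenize d) := by
  haveI : Fact p.Prime := ⟨hp⟩
  have he : MvPolynomial.eval ![x, y] (F.homogenize d) =
      ∑ kl ∈ Finset.HasAntidiagonal.antidiagonal d, F.coeff kl.1 * (x ^ kl.1 * y ^ kl.2) := by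
    have := eval_hom F d x y
    rw [← MvPolynomial.coe_aeval_eq_eval]
    exact this
  have hlc' : ((F.leadingCoeff : ℤ) : ZMod p) ≠ 0 := by
    rwa [Ne, ZMod.intCast_zmod_eq_zero_iff_dvd]
  rw [he, ← ZMod.intCast_zmod_eq_zero_iff_dvd] at h
  push_cast at h
  have hy : (y : ZMod p) = 0 := by
    by_contra hy
    refine hroot (x / y) ?_
    have h1 : aeval ((x : ZMod p) / y) F * (y : ZMod p) ^ d = 0 := by
      rw [← h, aeval_eq_sum_range' (n := d + 1) (by omega), Finset.Nat.sum_antidiagonal_eq_sum_range_succ_mk, Finset.sum_mul]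
      refine Finset.sum_congr rfl fun k hk => ?_
      have hk' : k ≤ d := by rw [Finset.mem_range] at hk; omega
      have h2 : (y : ZMod p) ^ d = y ^ k * y ^ (d - k) := by rw [← pow_add, Nat.add_sub_cancel' hk']
      rw [h2, zsmul_eq_mul, div_pow]
      field_simp
    exact (mul_eq_zero.mp h1).resolve_right (pow_ne_zero _ hy)
  have hx : (x : ZMod p) = 0 := by
    rw [hy, Finset.sum_eq_single (d, 0)] at h
    · simp only [pow_zero, mul_one] at h
      rw [← hd, coeff_natDegree] at h
      exact pow_eq_zero_iff (by omega) |>.mp ((mul_eq_zero.mp h).resolve_left hlc')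
    · rintro ⟨k, l⟩ hkl hne
      rw [Finset.HasAntidiagonal.mem_antidiagonal] at hkl
      have hl : l ≠ 0 := by
        rintro rfl
        exact hne (by simpa using hkl)
      simp [hl]
    · intro hn
      exact absurd (Finset.HasAntidiagonal.mem_antidiagonal.mpr (by simp)) hn
  rw [ZMod.intCast_zmod_eq_zero_iff_dvd] at hx hy
  obtain ⟨x', rfl⟩ := hx
  obtain ⟨y', rfl⟩ := hy
  rw [he]
  refine Finset.dvd_sum fun kl hkl => ?_
  rw [Finset.HasAntidiagonal.mem_antidiagonal] at hkl
  refine ⟨F.coeff kl.1 * (x' ^ kl.1 * y' ^ kl.2), ?_⟩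
  rw [← hkl, pow_add, mul_pow, mul_pow]
  ring

theorem fact_val (p : ℕ) (hp : p.Prime) (n : ℕ) (hn : n < 2 * p) : ¬ p ^ 2 ∣ n.factorial := by
  have hpp : n < p ^ 2 := by nlinarith [hp.two_le]
  rw [hp.pow_dvd_factorial_iff (b := 2) (Nat.log_lt_of_lt_pow' (by norm_num) hpp)]
  simp
  rw [← Nat.lt_succ_iff, Nat.div_lt_iff_lt_mul hp.pos]
  exact hn

theorem prod_val {ι : Type*} (s : Finset ι) (p : ℕ) (hp : p.Prime) (g : ι → ℕ)
    (hg : ∀ i ∈ s, ¬ p ^ 2 ∣ g i) : ∀ e : ℕ, p ^ e ∣ ∏ i ∈ s, g i → e ≤ s.card := by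
  intro e he
  rw [pow_dvd_iff_le_emultiplicity, Finset.emultiplicity_prod hp.prime] at he
  have h1 : ∑ i ∈ s, emultiplicity p (g i) ≤ ∑ i ∈ s, (1 : ℕ∞) := by
    refine Finset.sum_le_sum fun i hi => ?_
    have := emultiplicity_lt_iff_not_dvd.mpr (hg i hi)
    exact Order.le_of_lt_add_one (by exact_mod_cast this)
  have h2 := he.trans h1
  simp at h2
  exact h2
end red
end Fact4

theorem stmt_4 (d : ℕ) (f : MvPolynomial (Fin 2) ℤ) (hirr : Irreducible f)
    (hhom : f.IsHomogeneous d) (r : ℕ) (b : ℤ) (hb : b ≠ 0)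
    (A : Fin r → ℕ) (hA : ∀ i, 0 < A i) (hd : r < d) :
    {n : Fin r → ℕ | (∀ i, 0 < n i) ∧ ∃ x y : ℤ,
      b * ∏ i, (((n i).factorial : ℤ) * (A i : ℤ) ^ (n i)) =
        MvPolynomial.eval ![x, y] f}.Finite := by
  rcases Nat.eq_zero_or_pos r with rfl | hr
  · exact Set.toFinite _
  obtain ⟨F, hF, hdeg, rfl⟩ := Fact4.dehom d (by omega) f hirr hhom
  obtain ⟨N0, hN0⟩ := Fact4.good_primes F hF (by omega)
  set B := N0 + 2 * (b.natAbs + ∑ i, A i + F.leadingCoeff.natAbs) with hB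
  refine (Set.finite_Iic (fun _ : Fin r => B)).subset ?_
  rintro n ⟨hn, x, y, hxy⟩
  by_contra hnot
  have hj : ∃ j, B < n j := by
    by_contra! h
    exact hnot h
  obtain ⟨j0, hj0⟩ := hj
  haveI : Nonempty (Fin r) := ⟨j0⟩
  obtain ⟨j, hj⟩ := Finite.exists_max n
  obtain ⟨p, hp, hp1, hp2, hp3⟩ := hN0 (n j) (by have := hj j0; omega)
  have hpB : b.natAbs + ∑ i, A i + F.leadingCoeff.natAbs < p := by have := hj j0; omega
  have hpZ : Prime (p : ℤ) := Nat.prime_iff_prime_int.mp hp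
  have hF0 : F.leadingCoeff ≠ 0 := by
    rw [Ne, Polynomial.leadingCoeff_eq_zero]; exact hF.ne_zero
  have hlc : ¬ (p : ℤ) ∣ F.leadingCoeff := by
    intro h
    have := Nat.le_of_dvd (Int.natAbs_pos.mpr hF0) (Int.natCast_dvd.mp h)
    omega
  have hpb : ¬ (p : ℤ) ∣ b := by
    intro h
    have := Nat.le_of_dvd (Int.natAbs_pos.mpr hb) (Int.natCast_dvd.mp h)
    omega
  have hpA : ∀ i, ¬ p ∣ A i := by
    intro i h
    have h1 := Nat.le_of_dvd (hA i) h
    have h2 := Finset.single_le_sum (f := A) (fun i _ => Nat.zero_le _) (Finset.mem_univ i)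
    omega
  have h1 : (p : ℤ) ∣ MvPolynomial.eval ![x, y] (F.homogenize d) := by
    rw [← hxy]
    refine Dvd.dvd.mul_left ?_ _
    refine Dvd.dvd.trans ?_ (Finset.dvd_prod_of_mem _ (Finset.mem_univ j))
    refine Dvd.dvd.mul_right ?_ _
    exact_mod_cast (Nat.Prime.dvd_factorial hp).mpr hp2
  have h2 := Fact4.zero_mod F d (by omega) hdeg p hp hlc hp3 x y h1
  rw [← hxy, Finset.prod_mul_distrib] at h2
  have h3 := hpZ.pow_dvd_of_dvd_mul_left d hpb h2
  have h4 : ¬ (p : ℤ) ∣ ∏ i, (A i : ℤ) ^ n i := by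
    intro h
    obtain ⟨i, _, hi⟩ := (Prime.dvd_finsetProd_iff hpZ _).mp h
    exact hpA i (by exact_mod_cast hpZ.dvd_of_dvd_pow hi)
  have h5 := hpZ.pow_dvd_of_dvd_mul_right d h4 h3
  have h6 : p ^ d ∣ ∏ i, (n i).factorial := by exact_mod_cast h5
  have h7 := Fact4.prod_val Finset.univ p hp (fun i => (n i).factorial)
    (fun i _ => Fact4.fact_val p hp (n i) (by have := hj i; omega)) d h6
  rw [Finset.card_univ, Fintype.card_fin] at h7
  omega
end
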